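/- Assume that I_q^3 F = 0. Let (A, σ, f) be an F-algebra with quadratic pair such that deg A is divisible by 4, deg A > 4, ind A ≤ 2, and disc(σ, f) is trivial. If both simple components C⁺ and C⁻ of the Clifford algebra C(A, σ, f) have Schur index at most 2, then (A, σ, f) is isotropic. -/

import Mathlib

/-!  Common definitions for formalizing results of
"Triality over fields with I³ = 0" (F. K. Bingöl, A. Quéguiner-Mathieu).

We model an algebra with quadratic pair `(A, σ, f)` by the data of the reduced trace
`T` of `A` (given together with the property `IsReducedTrace` characterising it via a
splitting field), the involution `σ`, and an element `ℓ ∈ A` with `ℓ + σ(ℓ) = 1`; the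
semi-trace is `f = f_ℓ : s ↦ T(ℓ s)`.  By [KMRT, (5.7)] every semi-trace is of this
form, so this is an equivalent description of quadratic pairs.  -/

open scoped TensorProduct
open Module

noncomputable section

namespace Triality

variable (F : Type) [CommRing F]

/-- A (finite-dimensional) central simple algebra. -/
def IsCSA (A : Type) [Ring A] [Algebra F A] : Prop :=
  Algebra.IsCentral F A ∧ IsSimpleRing A ∧ Module.Finite F A

/-- The degree of a central simple algebra: the square root of its dimension. -/
def deg (A : Type) [Ring A] [Algebra F A] : ℕ := Nat.sqrt (Module.finrank F A)

/-- Brauer equivalence of two algebras. -/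
def BrauerEquiv (A B : Type) [Ring A] [Algebra F A] [Ring B] [Algebra F B] : Prop :=
  ∃ n m : ℕ, 0 < n ∧ 0 < m ∧
    Nonempty (Matrix (Fin n) (Fin n) A ≃ₐ[F] Matrix (Fin m) (Fin m) B)

/-- An algebra is split if it is isomorphic to a matrix algebra over the base. -/
def IsSplit (A : Type) [Ring A] [Algebra F A] : Prop :=
  ∃ n : ℕ, 0 < n ∧ Nonempty (A ≃ₐ[F] Matrix (Fin n) (Fin n) F)

/-- The Schur index of a central simple algebra: the smallest degree of a central
simple algebra in its Brauer class (realised by the underlying division algebra). -/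
def schurIndex (A : Type) [Ring A] [Algebra F A] : ℕ :=
  sInf { d : ℕ | 0 < d ∧ ∃ (D : Type) (_ : Ring D) (_ : Algebra F D),
    IsCSA F D ∧ Module.finrank F D = d * d ∧ BrauerEquiv F A D }

/-- A linear involution (anti-automorphism of period 2) on an algebra. -/
def IsInvolution {A : Type} [Ring A] [Algebra F A] (σ : A →ₗ[F] A) : Prop :=
  (∀ x y : A, σ (x * y) = σ y * σ x) ∧ (∀ x : A, σ (σ x) = x)

/-- `T` is the reduced trace of the central simple algebra `A`: over some splitting field
it is given by the trace of matrices. -/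
def IsReducedTrace (A : Type) [Ring A] [Algebra F A] (T : A →ₗ[F] F) : Prop :=
  ∃ (E : Type) (_ : Field E) (_ : Algebra F E) (n : ℕ)
    (e : E ⊗[F] A ≃ₐ[E] Matrix (Fin n) (Fin n) E),
    ∀ a : A, algebraMap F E (T a) = Matrix.trace (e ((1 : E) ⊗ₜ[F] a))

/-- The submodule of symmetric elements of an involution. -/
def symSet {A : Type} [Ring A] [Algebra F A] (σ : A →ₗ[F] A) : Submodule F A :=
  LinearMap.ker (σ - LinearMap.id)

/-- A quadratic pair on a central simple algebra `A` with reduced trace `T`, encoded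
by the involution `σ` together with an element `ℓ` with `ℓ + σ(ℓ) = 1`; the semi-trace of
the pair is `f_ℓ : s ↦ T(ℓ s)` on symmetric elements. -/
def IsQuadraticPair (A : Type) [Ring A] [Algebra F A] (T : A →ₗ[F] F)
    (σ : A →ₗ[F] A) (ℓ : A) : Prop :=
  IsInvolution F σ ∧
  2 * Module.finrank F (symSet F σ) = deg F A * (deg F A + 1) ∧
  (∀ x : A, σ x = -x → T x = 0) ∧
  ℓ + σ ℓ = 1

/-- A right ideal of `A`, as a submodule over the base. -/
def IsRightIdeal (A : Type) [Ring A] [Algebra F A] (I : Submodule F A) : Prop :=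
  ∀ x ∈ I, ∀ a : A, x * a ∈ I

/-- An isotropic right ideal for the quadratic pair `(σ, f_ℓ)`:
`σ(I)·I = 0` and the semi-trace `f_ℓ = T(ℓ·)` vanishes on `I ∩ Sym(A,σ)`. -/
def IsIsotropicIdeal (A : Type) [Ring A] [Algebra F A] (T : A →ₗ[F] F)
    (σ : A →ₗ[F] A) (ℓ : A) (I : Submodule F A) : Prop :=
  IsRightIdeal F A I ∧
  (∀ x ∈ I, ∀ y ∈ I, σ x * y = 0) ∧
  (∀ x ∈ I, σ x = x → T (ℓ * x) = 0)

/-- The algebra with quadratic pair `(A, σ, f_ℓ)` is isotropic. -/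
def QPIsotropic (A : Type) [Ring A] [Algebra F A] (T : A →ₗ[F] F)
    (σ : A →ₗ[F] A) (ℓ : A) : Prop :=
  ∃ I : Submodule F A, IsIsotropicIdeal F A T σ ℓ I ∧ I ≠ ⊥

/-- The algebra with quadratic pair `(A, σ, f_ℓ)` is hyperbolic. -/
def QPHyperbolic (A : Type) [Ring A] [Algebra F A] (T : A →ₗ[F] F)
    (σ : A →ₗ[F] A) (ℓ : A) : Prop :=
  ∃ I : Submodule F A, IsIsotropicIdeal F A T σ ℓ I ∧
    2 * Module.finrank F I = Module.finrank F A

/-- The index of an algebra with quadratic pair: the set of reduced dimensions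
`dim_F I / deg A` of isotropic right ideals `I`. -/
def qpIndexSet (A : Type) [Ring A] [Algebra F A] (T : A →ₗ[F] F)
    (σ : A →ₗ[F] A) (ℓ : A) : Set ℕ :=
  { r : ℕ | ∃ I : Submodule F A, IsIsotropicIdeal F A T σ ℓ I ∧
      Module.finrank F I = r * deg F A }

/-- A symplectic involution, characterised characteristic-freely: in characteristic 2,
`1` is an alternating element; in characteristic `≠ 2`, the symmetric elements have
dimension `n(n-1)/2`. -/
def IsSymplectic (A : Type) [Ring A] [Algebra F A] (σ : A →ₗ[F] A) : Prop :=
  IsInvolution F σ ∧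
    ((ringChar F = 2 ∧ ∃ y : A, 1 = y + σ y) ∨
     (ringChar F ≠ 2 ∧ 2 * Module.finrank F (symSet F σ) = deg F A * (deg F A - 1)))

/-- The sandwich map `Sand : A ⊗ A → End_F(A)`, `Sand(a ⊗ b)(x) = a x b`. -/
def sand (A : Type) [Ring A] [Algebra F A] : A ⊗[F] A →ₗ[F] A →ₗ[F] A :=
  TensorProduct.lift
    (LinearMap.mk₂ F (fun a b => (LinearMap.mulRight F b).comp (LinearMap.mulLeft F a))
      (fun a a' b => by ext x; simp [add_mul])
      (fun c a b => by ext x; simp [smul_mul_assoc])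
      (fun a b b' => by ext x; simp [mul_add])
      (fun c a b => by ext x; simp [mul_smul_comm]))

/-- The degree-two part map `A ⊗ A → T(A)`, `a ⊗ b ↦ ι a * ι b`. -/
def mu2 (A : Type) [Ring A] [Algebra F A] : A ⊗[F] A →ₗ[F] TensorAlgebra F A :=
  TensorProduct.lift
    (LinearMap.mk₂ F (fun a b => TensorAlgebra.ι F a * TensorAlgebra.ι F b)
      (fun a a' b => by simp [add_mul])
      (fun c a b => by simp [smul_mul_assoc])
      (fun a b b' => by simp [mul_add])
      (fun c a b => by simp [mul_smul_comm]))

/-- The defining relations of the Clifford algebra `C(A, σ, f)` of an algebra with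
quadratic pair, following [KMRT, §8.B]: in the tensor algebra `T(A)`, a symmetric
element `s`, viewed in degree one, is identified with the scalar `f(s) = T(ℓ s)`, and a
`σ₂`-symmetric element `c ∈ A ⊗ A` (i.e. `Sand(c) ∘ σ = Sand(c)`), viewed in degree two,
is identified with the degree-one element `Sand(c)(ℓ)`.  (In the split case
`A = End(V)`, `(σ, f) = ad(q)`, these are the Bichsel–Knus relations presenting
the even Clifford algebra `C₀(q)`.) -/
inductive CliffordRel (A : Type) [Ring A] [Algebra F A] (T : A →ₗ[F] F)
    (σ : A →ₗ[F] A) (ℓ : A) : TensorAlgebra F A → TensorAlgebra F A → Prop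
  | sym (s : A) (hs : σ s = s) :
      CliffordRel A T σ ℓ (TensorAlgebra.ι F s) (algebraMap F _ (T (ℓ * s)))
  | deg2 (c : A ⊗[F] A) (hc : ∀ x : A, sand F A c (σ x) = sand F A c x) :
      CliffordRel A T σ ℓ (mu2 F A c) (TensorAlgebra.ι F (sand F A c ℓ))

/-- The Clifford algebra of an algebra with quadratic pair [KMRT, §8.B]. -/
def CliffordAlg (A : Type) [Ring A] [Algebra F A] (T : A →ₗ[F] F)
    (σ : A →ₗ[F] A) (ℓ : A) : Type :=
  RingQuot (CliffordRel F A T σ ℓ)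

instance (A : Type) [Ring A] [Algebra F A] (T : A →ₗ[F] F) (σ : A →ₗ[F] A) (ℓ : A) :
    Ring (CliffordAlg F A T σ ℓ) := inferInstanceAs (Ring (RingQuot _))

instance (A : Type) [Ring A] [Algebra F A] (T : A →ₗ[F] F) (σ : A →ₗ[F] A) (ℓ : A) :
    Algebra F (CliffordAlg F A T σ ℓ) := inferInstanceAs (Algebra F (RingQuot _))

/-- The canonical image of `a ∈ A` as a degree-one element of the Clifford algebra. -/
def cliffGen (A : Type) [Ring A] [Algebra F A] (T : A →ₗ[F] F)
    (σ : A →ₗ[F] A) (ℓ : A) (a : A) : CliffordAlg F A T σ ℓ :=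
  RingQuot.mkAlgHom F (CliffordRel F A T σ ℓ) (TensorAlgebra.ι F a)

/-- The quadratic pair `(σ, f)` has trivial discriminant: the centre of its Clifford
algebra is the split étale quadratic algebra, i.e. contains a nontrivial idempotent. -/
def HasTrivialDiscriminant (A : Type) [Ring A] [Algebra F A] (T : A →ₗ[F] F)
    (σ : A →ₗ[F] A) (ℓ : A) : Prop :=
  ∃ e : CliffordAlg F A T σ ℓ, e ∈ Subalgebra.center F (CliffordAlg F A T σ ℓ) ∧
    e * e = e ∧ e ≠ 0 ∧ e ≠ 1

/-- `(A, σ)` (an algebra with involution) is a quadratic extension of the algebra with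
unitary involution `(C, σ_C)`, where `uC` is a distinguished generator of the centre `K`
of `C` over `F`:  `C` embeds in `A` compatibly with the involutions, with image the
centralizer of the image of `K`. -/
def IsInvQuadExt (A : Type) [Ring A] [Algebra F A] (σ : A →ₗ[F] A)
    (C : Type) [Ring C] [Algebra F C] (σC : C →ₗ[F] C) (uC : C) : Prop :=
  ∃ j : C →ₐ[F] A, Function.Injective j ∧ (∀ x : C, σ (j x) = j (σC x)) ∧
    (Set.range (j : C → A) = Set.centralizer {j uC})

/-- `(A, σ, f_ℓ)` (an algebra with quadratic pair) is a quadratic extension of the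
algebra with unitary involution `(C, σ_C)`:  in addition to the conditions of
`IsInvQuadExt`, the semi-trace `f_ℓ` coincides on symmetric elements with `f_{ℓK}` for
some generator `ℓK` of the quadratic étale algebra `K = F[j(uC)] ⊆ A` with
`ℓK² - ℓK ∈ F`. -/
def IsQPQuadExt (A : Type) [Ring A] [Algebra F A] (T : A →ₗ[F] F)
    (σ : A →ₗ[F] A) (ℓ : A)
    (C : Type) [Ring C] [Algebra F C] (σC : C →ₗ[F] C) (uC : C) : Prop :=
  ∃ j : C →ₐ[F] A, Function.Injective j ∧ (∀ x : C, σ (j x) = j (σC x)) ∧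
    (Set.range (j : C → A) = Set.centralizer {j uC}) ∧
    ∃ ℓK ∈ Algebra.adjoin F ({j uC} : Set A),
      ℓK ∉ Set.range (algebraMap F A) ∧
      (ℓK * ℓK - ℓK) ∈ Set.range (algebraMap F A) ∧
      ∀ s : A, σ s = s → T (ℓ * s) = T (ℓK * s)

/-- The algebra with unitary involution `(C, σ_C)` is isotropic: there is a nonzero
right ideal `J` with `σ_C(J)·J = 0`. -/
def UnitaryIsotropic (C : Type) [Ring C] [Algebra F C] (σC : C →ₗ[F] C) : Prop :=
  ∃ J : Submodule F C, IsRightIdeal F C J ∧ (∀ x ∈ J, ∀ y ∈ J, σC x * y = 0) ∧ J ≠ ⊥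

/-- The algebra with unitary involution `(C, σ_C)` is hyperbolic: there is a right
ideal `J` with `σ_C(J)·J = 0` of half the dimension (over `F`; equivalently, of half the
dimension over the centre). -/
def UnitaryHyperbolic (C : Type) [Ring C] [Algebra F C] (σC : C →ₗ[F] C) : Prop :=
  ∃ J : Submodule F C, IsRightIdeal F C J ∧ (∀ x ∈ J, ∀ y ∈ J, σC x * y = 0) ∧
    2 * Module.finrank F J = Module.finrank F C

/-- The 3-fold quadratic Pfister form `⟨⟨a, b, c]]` on `F⁸`. -/
def pfister3Form (a b c : F) : (Fin 8 → F) → F := fun v =>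
  (v 0 * v 0 + v 0 * v 1 + c * (v 1 * v 1))
  + a * (v 2 * v 2 + v 2 * v 3 + c * (v 3 * v 3))
  + b * (v 4 * v 4 + v 4 * v 5 + c * (v 5 * v 5))
  + a * b * (v 6 * v 6 + v 6 * v 7 + c * (v 7 * v 7))

/-- `I_q³ F = 0`: every 3-fold quadratic Pfister form over `F` is hyperbolic, i.e.
vanishes on a totally isotropic subspace of half the dimension. -/
def I3Trivial : Prop :=
  ∀ a b c : F, a ≠ 0 → b ≠ 0 → (1 : F) - 4 * c ≠ 0 →
    ∃ W : Submodule F (Fin 8 → F), Module.finrank F W = 4 ∧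
      ∀ v ∈ W, pfister3Form F a b c v = 0

/-- An algebra with quadratic pair, bundled. -/
structure QPAlgebra : Type 1 where
  A : Type
  [ring : Ring A]
  [alg : Algebra F A]
  T : A →ₗ[F] F
  σ : A →ₗ[F] A
  ℓ : A
  csa : IsCSA F A
  trd : IsReducedTrace F A T
  pair : IsQuadraticPair F A T σ ℓ

attribute [instance] QPAlgebra.ring QPAlgebra.alg

/-- A trialitarian triple: three degree-8 algebras with quadratic pair such that the
Clifford algebra of the first, with its canonical quadratic pair, is isomorphic to the
product of the other two.  The isomorphism intertwines the canonical involution of the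
Clifford algebra (which maps the degree-one generator attached to `a` to the one
attached to `σ(a)`) with the product involution; since the degree-one elements generate
the Clifford algebra, this is recorded on generators. -/
def IsTrialitarianTriple (X Y Z : QPAlgebra F) : Prop :=
  Module.finrank F X.A = 64 ∧ Module.finrank F Y.A = 64 ∧ Module.finrank F Z.A = 64 ∧
  ∃ φ : CliffordAlg F X.A X.T X.σ X.ℓ ≃ₐ[F] (Y.A × Z.A),
    ∀ a : X.A,
      φ (cliffGen F X.A X.T X.σ X.ℓ (X.σ a)) =
        (Y.σ (φ (cliffGen F X.A X.T X.σ X.ℓ a)).1,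
         Z.σ (φ (cliffGen F X.A X.T X.σ X.ℓ a)).2)

/-- A trialitarian triple is isotropic if one of its three members is isotropic
(equivalently, by triality, each of them is). -/
def TripleIsotropic (X Y Z : QPAlgebra F) : Prop :=
  QPIsotropic F X.A X.T X.σ X.ℓ ∨ QPIsotropic F Y.A Y.T Y.σ Y.ℓ ∨
    QPIsotropic F Z.A Z.T Z.σ Z.ℓ

/-- The (unordered) triple of Schur indices of a trialitarian triple; the index
`ind T = (a, b, c)` with `a ≤ b ≤ c` of the paper corresponds to this multiset being
`{a, b, c}`. -/
def indexMultiset (X Y Z : QPAlgebra F) : Multiset ℕ :=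
  {schurIndex F X.A, schurIndex F Y.A, schurIndex F Z.A}

/-- The relations of the quaternion algebra `[a, b)_F = F⟨i, j⟩` with
`i² - i = a`, `j² = b`, `ji = (1 - i)j`. -/
inductive QuatRel (a b : F) : FreeAlgebra F (Fin 2) → FreeAlgebra F (Fin 2) → Prop
  | ii : QuatRel a b (FreeAlgebra.ι F 0 * FreeAlgebra.ι F 0)
      (FreeAlgebra.ι F 0 + algebraMap F _ a)
  | jj : QuatRel a b (FreeAlgebra.ι F 1 * FreeAlgebra.ι F 1) (algebraMap F _ b)
  | ji : QuatRel a b (FreeAlgebra.ι F 1 * FreeAlgebra.ι F 0)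
      ((1 - FreeAlgebra.ι F 0) * FreeAlgebra.ι F 1)

/-- The quaternion algebra `[a, b)_F`, presented by generators and relations. -/
def QuatAlg (a b : F) : Type := RingQuot (QuatRel F a b)

instance (a b : F) : Ring (QuatAlg F a b) := inferInstanceAs (Ring (RingQuot _))
instance (a b : F) : Algebra F (QuatAlg F a b) := inferInstanceAs (Algebra F (RingQuot _))

/-- A ring in which every nonzero element is invertible. -/
def IsDivision (A : Type) [Ring A] : Prop := ∀ x : A, x ≠ 0 → IsUnit x

end Triality

end

open scoped TensorProduct
open Module

namespace Triality

section Forms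

variable {K : Type} [Field K]

/-- The binary norm form `x² + xy + cy²`. -/
def qN (c x y : K) : K := x * x + x * y + c * (y * y)

/-- The 2-fold Pfister form `N_c ⊗ ⟨1, a⟩`. -/
def rho (c a x y z t : K) : K := qN c x y + a * qN c z t

/-- `e` is represented by the 2-fold Pfister form `N_c ⊗ ⟨1, a⟩`. -/
def Rep (c a e : K) : Prop := ∃ x y z t, rho c a x y z t = e

theorem Rep.mul {c a e e' : K} (h : Rep c a e) (h' : Rep c a e') : Rep c a (e * e') := by
  obtain ⟨x, y, z, t, rfl⟩ := h
  obtain ⟨x', y', z', t', rfl⟩ := h'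
  refine ⟨(x * x' - c * y * y') - a * (z * (z' + t') + c * t * t'),
    (x * y' + y * x' + y * y') - a * (t * (z' + t') - z * t' - t * t'),
    (x * z' - c * y * t') + (z * (x' + y') + c * t * y'),
    (x * t' + y * z' + y * t') + (t * (x' + y') - z * y' - t * y'), ?_⟩
  unfold rho qN
  ring

theorem Rep.sq_mul {c a e : K} (s : K) (h : Rep c a e) : Rep c a (s * s * e) := by
  obtain ⟨x, y, z, t, rfl⟩ := h
  exact ⟨s * x, s * y, s * z, s * t, by unfold rho qN; ring⟩

theorem Rep.inv {c a e : K} (h : Rep c a e) : Rep c a e⁻¹ := by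
  by_cases he : e = 0
  · subst he; simpa using h
  have := h.sq_mul e⁻¹
  rwa [mul_assoc, inv_mul_cancel₀ he, mul_one] at this

theorem Rep.div {c a e e' : K} (h : Rep c a e) (h' : Rep c a e') : Rep c a (e / e') := by
  rw [div_eq_mul_inv]; exact h.mul h'.inv

theorem Rep.of_isotropic {c a : K} (ha : a ≠ 0) (hc : 1 - 4 * c ≠ 0) {x y z t : K}
    (h0 : rho c a x y z t = 0) (hne : ¬ (x = 0 ∧ y = 0 ∧ z = 0 ∧ t = 0)) (e : K) :
    Rep c a e := by
  obtain ⟨x', y', z', t', hp⟩ : ∃ x' y' z' t' : K,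
      2 * x * x' + x * y' + x' * y + 2 * c * y * y' +
        a * (2 * z * z' + z * t' + z' * t + 2 * c * t * t') ≠ 0 := by
    by_contra! H
    have h1 := H 1 0 0 0
    have h2 := H 0 1 0 0
    have h3 := H 0 0 1 0
    have h4 := H 0 0 0 1
    simp only [mul_one, mul_zero, zero_add, add_zero, one_mul, zero_mul, mul_eq_zero, ha,
      false_or] at h1 h2 h3 h4
    apply hne
    refine ⟨?_, ?_, ?_, ?_⟩
    · refine (mul_eq_zero.1 (?_ : (1 - 4 * c) * x = 0)).resolve_left hc
      linear_combination h2 - 2 * c * h1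
    · refine (mul_eq_zero.1 (?_ : (1 - 4 * c) * y = 0)).resolve_left hc
      linear_combination h1 - 2 * h2
    · refine (mul_eq_zero.1 (?_ : (1 - 4 * c) * z = 0)).resolve_left hc
      linear_combination h4 - 2 * c * h3
    · refine (mul_eq_zero.1 (?_ : (1 - 4 * c) * t = 0)).resolve_left hc
      linear_combination h3 - 2 * h4
  set P := 2 * x * x' + x * y' + x' * y + 2 * c * y * y' +
        a * (2 * z * z' + z * t' + z' * t + 2 * c * t * t') with hP
  set s := (e - rho c a x' y' z' t') / P with hs
  refine ⟨s * x + x', s * y + y', s * z + z', s * t + t', ?_⟩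
  have : rho c a (s * x + x') (s * y + y') (s * z + z') (s * t + t') =
      s * s * rho c a x y z t + s * P + rho c a x' y' z' t' := by
    rw [hP]; unfold rho qN; ring
  rw [this, h0, hs]
  field_simp
  ring

/-- The 3-fold-ish form `N_c ⊗ ⟨1, a, e⟩` is isotropic. -/
def Iso3 (c a e : K) : Prop := ∃ x y z t u v : K,
  ¬ (x = 0 ∧ y = 0 ∧ z = 0 ∧ t = 0 ∧ u = 0 ∧ v = 0) ∧
  qN c x y + a * qN c z t + e * qN c u v = 0

theorem rho_left (c a x y : K) : rho c a x y 0 0 = qN c x y := by simp [rho, qN]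

/-- Isotropy of `N_c ⊗ ⟨1, a, e, ae⟩` in terms of `N_c ⊗ ⟨1, a⟩`. -/
theorem Rep.of_isotropic4 {c a e : K} (ha : a ≠ 0) (hc : 1 - 4 * c ≠ 0) {x y z t u v w s : K}
    (hne : ¬ (x = 0 ∧ y = 0 ∧ z = 0 ∧ t = 0 ∧ u = 0 ∧ v = 0 ∧ w = 0 ∧ s = 0))
    (h : rho c a x y z t + e * rho c a u v w s = 0) : Rep c a (-e) := by
  by_cases h2 : rho c a u v w s = 0
  · by_cases h3 : u = 0 ∧ v = 0 ∧ w = 0 ∧ s = 0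
    · obtain ⟨rfl, rfl, rfl, rfl⟩ := h3
      rw [h2, mul_zero, add_zero] at h
      exact Rep.of_isotropic ha hc h (fun h' => hne (by simp [h'])) _
    · exact Rep.of_isotropic ha hc h2 h3 _
  · have : -e = rho c a x y z t / rho c a u v w s := by
      field_simp; linear_combination -h
    rw [this]
    exact Rep.div ⟨_, _, _, _, rfl⟩ ⟨_, _, _, _, rfl⟩

theorem iso3_iff_rep {c a e : K} (ha : a ≠ 0) (hc : 1 - 4 * c ≠ 0) :
    Iso3 c a e ↔ Rep c a (-e) := by
  constructor
  · rintro ⟨x, y, z, t, u, v, hne, h⟩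
    refine Rep.of_isotropic4 ha hc (x := x) (y := y) (z := z) (t := t) (u := u) (v := v)
      (w := 0) (s := 0) (by simpa using hne) ?_
    rw [rho_left, ← h, rho]
  · rintro ⟨x, y, z, t, h⟩
    refine ⟨x, y, z, t, 1, 0, by simp, ?_⟩
    unfold rho at h
    rw [h]; simp [qN]

theorem Iso3.symm {c a e : K} (h : Iso3 c a e) : Iso3 c e a := by
  obtain ⟨x, y, z, t, u, v, hne, h⟩ := h
  exact ⟨x, y, u, v, z, t, by tauto, by rw [← h]; ring⟩

theorem Rep.symm {c a e : K} (ha : a ≠ 0) (he : e ≠ 0) (hc : 1 - 4 * c ≠ 0)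
    (h : Rep c a (-e)) : Rep c e (-a) := by
  rw [← iso3_iff_rep he hc]
  rw [← iso3_iff_rep ha hc] at h
  exact h.symm

theorem rep_self (c a : K) : Rep c a a := ⟨0, 0, 1, 0, by simp [rho, qN]⟩

/-- Every 2-fold Pfister form represents everything: a reformulation of `I_q³ = 0`. -/
def RepAll (K : Type) [Field K] : Prop :=
  ∀ c a e : K, a ≠ 0 → e ≠ 0 → 1 - 4 * c ≠ 0 → Rep c a e

theorem RepAll.iso3 (h : RepAll K) {c a e : K} (ha : a ≠ 0) (he : e ≠ 0) (hc : 1 - 4 * c ≠ 0) :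
    Iso3 c a e := (iso3_iff_rep ha hc).2 (h c a _ ha (neg_ne_zero.2 he) hc)

theorem Rep.map {L : Type} [Field L] (f : K →+* L) {c a e : K} (h : Rep c a e) :
    Rep (f c) (f a) (f e) := by
  obtain ⟨x, y, z, t, rfl⟩ := h
  exact ⟨f x, f y, f z, f t, by simp [rho, qN]⟩

theorem repAll_of_I3Trivial (h3 : I3Trivial K) : RepAll K := by
  intro c a e ha he hc
  obtain ⟨W, hW, hW0⟩ := h3 a (-e) c ha (neg_ne_zero.2 he) hc
  let φ : W →ₗ[K] (Fin 2 → K) :=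
    (LinearMap.pi ![LinearMap.proj 6, LinearMap.proj 7]).comp W.subtype
  have hker : LinearMap.ker φ ≠ ⊥ := by
    intro hbot
    have := LinearMap.finrank_le_finrank_of_injective (LinearMap.ker_eq_bot.1 hbot)
    simp [hW] at this
  obtain ⟨⟨v, hv⟩, hv0, hvne⟩ := Submodule.exists_mem_ne_zero_of_ne_bot hker
  have h6 : v 6 = 0 := by simpa [φ] using congrFun (LinearMap.mem_ker.1 hv0) 0
  have h7 : v 7 = 0 := by simpa [φ] using congrFun (LinearMap.mem_ker.1 hv0) 1
  have hv1 : v ≠ 0 := by simpa using hvne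
  have := hW0 v hv
  have h2 : Iso3 c a (-e) := by
    refine ⟨v 0, v 1, v 2, v 3, v 4, v 5, ?_, ?_⟩
    · rintro ⟨h0, h1, h2, h3, h4, h5⟩
      apply hv1
      ext i
      fin_cases i <;> assumption
    · rw [← this]; simp [pfister3Form, qN, h6, h7]
  simpa using (iso3_iff_rep ha hc).1 h2

/-- Quadratic étale field extensions. -/
structure QExt (F K : Type) [Field F] [Field K] [Algebra F K] (c : F) where
  ω : K
  conj : K ≃ₐ[F] K
  sq : ω * ω = ω - algebraMap F K c
  conj_ω : conj ω = 1 - ω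
  repr : ∀ x : K, ∃ a b : F, x = algebraMap F K a + algebraMap F K b * ω
  ind : ∀ a b : F, algebraMap F K a + algebraMap F K b * ω = 0 → a = 0 ∧ b = 0

end Forms

section Exts

open QuadraticAlgebra in
theorem exists_qext {F : Type} [Field F] (c : F) (hc : ∀ x : F, x * x - x + c ≠ 0) :
    ∃ (K : Type) (_ : Field K) (_ : Algebra F K), Nonempty (QExt F K c) := by
  have : Fact (∀ r : F, r ^ 2 ≠ -c + 1 * r) := ⟨fun r hr => hc r (by linear_combination hr)⟩
  refine ⟨QuadraticAlgebra F (-c) 1, inferInstance, inferInstance, ⟨⟨ω,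
    AlgEquiv.ofAlgHom (QuadraticAlgebra.lift ⟨1 - ω, ?_⟩) (QuadraticAlgebra.lift ⟨1 - ω, ?_⟩) ?_ ?_,
      ?_, ?_, ?_, ?_⟩⟩⟩
  · ext <;> simp <;> ring
  · ext <;> simp <;> ring
  · apply QuadraticAlgebra.algHom_ext; simp
  · apply QuadraticAlgebra.algHom_ext; simp
  · ext <;> simp
  · simp
  · intro x; exact ⟨x.re, x.im, by ext <;> simp⟩
  · intro a b h
    rw [QuadraticAlgebra.ext_iff] at h
    simpa using h

variable {F K : Type} [Field F] [Field K] [Algebra F K] {c0 : F}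

theorem QExt.conj_conj (E : QExt F K c0) (x : K) : E.conj (E.conj x) = x := by
  obtain ⟨a, b, rfl⟩ := E.repr x
  simp [E.conj_ω]

theorem QExt.fixed (E : QExt F K c0) {x : K} (h : E.conj x = x) : ∃ a : F, x = algebraMap F K a := by
  obtain ⟨a, b, rfl⟩ := E.repr x
  have : algebraMap F K b + algebraMap F K (-2 * b) * E.ω = 0 := by
    simp only [map_add, map_mul, AlgEquiv.commutes, E.conj_ω, map_neg, map_ofNat] at h ⊢
    linear_combination h
  have h2 := E.ind _ _ this
  exact ⟨a, by simp [h2.1]⟩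

theorem QExt.irred (E : QExt F K c0) (x : F) : x * x - x + c0 ≠ 0 := by
  intro h
  have h1 : (E.ω - algebraMap F K x) * (E.ω - (1 - algebraMap F K x)) = 0 := by
    have := congrArg (algebraMap F K) h
    simp at this
    linear_combination E.sq - this
  rcases mul_eq_zero.1 h1 with h | h
  · have := (E.ind (-x) 1 (by simp; linear_combination h)).2
    exact one_ne_zero this
  · have := (E.ind (-(1 - x)) 1 (by simp; linear_combination h)).2
    exact one_ne_zero this

theorem QExt.disc_ne_zero (E : QExt F K c0) : 1 - 4 * c0 ≠ 0 := by
  intro h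
  by_cases h2 : (2 : F) = 0
  · have : (1 : F) = 0 := by linear_combination h + 2 * c0 * h2
    exact one_ne_zero this
  · refine E.irred (1 / 2) ?_
    field_simp
    linear_combination -h

theorem QExt.trace (E : QExt F K c0) (x : K) : ∃ t : F, x + E.conj x = algebraMap F K t := by
  obtain ⟨a, b, rfl⟩ := E.repr x
  exact ⟨2 * a + b, by simp only [map_add, map_mul, AlgEquiv.commutes, E.conj_ω, map_ofNat]; ring⟩

theorem QExt.norm (E : QExt F K c0) (x : K) : ∃ t : F, x * E.conj x = algebraMap F K t := by
  obtain ⟨a, b, rfl⟩ := E.repr x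
  exact ⟨a * a + a * b + c0 * (b * b), by
    simp [E.conj_ω]; linear_combination (-(algebraMap F K b * algebraMap F K b)) * E.sq⟩

end Exts

section Ascent

variable {F K : Type} [Field F] [Field K] [Algebra F K] {c0 : F}

local notation "ι" => algebraMap F K

theorem QExt.rep_base (E : QExt F K c0) (hF : RepAll F) {c a : F} (ha : a ≠ 0)
    (hc : 1 - 4 * c ≠ 0) {e : K} (he : e ≠ 0) : Rep (ι c) (ι a) e := by
  obtain ⟨t, ht⟩ := E.trace e
  obtain ⟨n, hn⟩ := E.norm e
  have hn0 : n ≠ 0 := by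
    rintro rfl
    rw [map_zero, mul_eq_zero] at hn
    rcases hn with h | h
    · exact he h
    · exact he (by simpa using h)
  have hcK : (1 : K) - 4 * ι c ≠ 0 := by
    have := (map_ne_zero (ι)).2 hc
    simpa [map_ofNat] using this
  obtain ⟨x, y, z, u, hr⟩ := hF c a n ha hn0 hc
  have hr' : rho (ι c) (ι a) (ι x) (ι y) (ι z) (ι u) = ι n := by
    rw [← hr]; simp [rho, qN]
  have key : rho (ι c) (ι a) (ι x + e) (ι y) (ι z) (ι u) = e * ι (t + 2 * x + y) := by
    have : rho (ι c) (ι a) (ι x + e) (ι y) (ι z) (ι u) =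
      rho (ι c) (ι a) (ι x) (ι y) (ι z) (ι u) + e * (2 * ι x + ι y) + e * e := by
      unfold rho qN; ring
    rw [this, hr', ← hn]
    simp only [map_add, ← ht, map_mul, map_ofNat]
    ring
  by_cases hτ : t + 2 * x + y = 0
  · rw [hτ, map_zero, mul_zero] at key
    by_cases hz : ι x + e = 0 ∧ ι y = 0 ∧ ι z = 0 ∧ ι u = 0
    · have he' : e = ι (-x) := by rw [map_neg]; linear_combination hz.1
      rw [he']
      apply Rep.map
      apply hF _ _ _ ha _ hc
      rintro h
      rw [h, map_zero] at he'
      exact he he'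
    · exact Rep.of_isotropic ((map_ne_zero _).2 ha) hcK key hz _
  · have hτ' : ι (t + 2 * x + y) ≠ 0 := (map_ne_zero _).2 hτ
    have : e = rho (ι c) (ι a) (ι x + e) (ι y) (ι z) (ι u) / ι (t + 2 * x + y) := by
      rw [key]; field_simp
    rw [this]
    exact Rep.div ⟨_, _, _, _, rfl⟩ (Rep.map (algebraMap F K) (hF _ _ _ ha hτ hc))

theorem QExt.rep_of_base (E : QExt F K c0) {c : K} (hc : 1 - 4 * c ≠ 0)
    (H : ∀ (m : F) (b : K), m ≠ 0 → b ≠ 0 → Rep c (ι m) b) {a e : K} (ha : a ≠ 0)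
    (he : e ≠ 0) : Rep c a e := by
  suffices h : Rep c a (-(-e)) by simpa using h
  set e' := -e with he'
  have he0 : e' ≠ 0 := neg_ne_zero.2 he
  clear_value e'
  clear he' he e
  by_cases haF : ∃ m, a = ι m
  · obtain ⟨m, rfl⟩ := haF
    exact H _ _ (by rintro rfl; simp at ha) (neg_ne_zero.2 he0)
  by_cases heF : ∃ m, e' = ι m
  · obtain ⟨m, rfl⟩ := heF
    exact Rep.symm he0 ha hc (H _ _ (by rintro rfl; simp at he0) (neg_ne_zero.2 ha))
  obtain ⟨a1, a2, haa⟩ := E.repr a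
  obtain ⟨e1, e2, hee⟩ := E.repr e'
  have ha2 : a2 ≠ 0 := by rintro rfl; exact haF ⟨a1, by simpa using haa⟩
  have he2 : e2 ≠ 0 := by rintro rfl; exact heF ⟨e1, by simpa using hee⟩
  set d := e2 / a2 with hd
  set g := e1 - d * a1 with hg
  have hd0 : d ≠ 0 := div_ne_zero he2 ha2
  have hed : e' = ι g + ι d * a := by
    have h2 : e2 = d * a2 := by rw [hd]; field_simp
    rw [hee, haa, hg, h2]; simp; ring
  have hdK : ι d ≠ 0 := (map_ne_zero _).2 hd0
  by_cases hg0 : g = 0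
  · rw [hg0, map_zero, zero_add] at hed
    have h1 : Rep c a (-(ι d)) :=
      Rep.symm hdK ha hc (H _ _ hd0 (neg_ne_zero.2 ha))
    have := (rep_self c a).mul h1
    rw [hed]
    convert this using 1
    ring
  have hgK : ι g ≠ 0 := (map_ne_zero _).2 hg0
  set k := d / g with hk
  have hk0 : k ≠ 0 := div_ne_zero hd0 hg0
  have hkK : ι k ≠ 0 := (map_ne_zero _).2 hk0
  set k' := -1 / g with hk'
  have hk'0 : k' ≠ 0 := div_ne_zero (by simp) hg0
  have hk'K : ι k' ≠ 0 := (map_ne_zero _).2 hk'0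
  have h0 : Iso3 c (ι k * a) (ι k' * e') := by
    refine ⟨1, 0, 1, 0, 1, 0, by simp, ?_⟩
    rw [hed, hk, hk']
    simp [qN]
    field_simp
    ring
  have h1 : Rep c (ι k' * e') (-(ι k * a)) :=
    (iso3_iff_rep (mul_ne_zero hk'K he0) hc).1 h0.symm
  have h2 : Rep c (ι k' * e') (ι k)⁻¹ := by
    have : Rep c (ι (-k⁻¹)) (-(ι k' * e')) :=
      H _ _ (by simpa using hk0) (neg_ne_zero.2 (mul_ne_zero hk'K he0))
    have := Rep.symm (by simpa using hk0) (mul_ne_zero hk'K he0) hc this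
    simpa using this
  have h3 : Rep c (ι k' * e') (-a) := by
    convert h1.mul h2 using 1
    field_simp
  have h4 : Rep c a (-(ι k' * e')) := Rep.symm (mul_ne_zero hk'K he0) ha hc h3
  have h5 : Rep c a (ι k')⁻¹ := by
    have : Rep c (ι (-k'⁻¹)) (-a) := H _ _ (by simpa using hk'0) (neg_ne_zero.2 ha)
    have := Rep.symm (by simpa using hk'0) ha hc this
    simpa using this
  convert h4.mul h5 using 1
  field_simp

theorem rep_swap (h2 : (2 : K) ≠ 0) {c a e : K} :
    Rep c a e ↔ Rep ((1 + a) / 4) (-(1 - 4 * c)) e := by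
  have h4 : (4 : K) ≠ 0 := by
    have : (4 : K) = 2 * 2 := by norm_num
    rw [this]; exact mul_ne_zero h2 h2
  have key : ∀ c a x y z t : K, rho ((1 + a) / 4) (-(1 - 4 * c)) (x + y / 2 - z - t / 2)
      (2 * z + t) (y / 2 - t / 2) t = rho c a x y z t := by
    intro c a x y z t
    unfold rho qN
    field_simp
    ring
  constructor
  · rintro ⟨x, y, z, t, rfl⟩
    exact ⟨_, _, _, _, key c a x y z t⟩
  · rintro ⟨x, y, z, t, rfl⟩
    refine ⟨x + y / 2 - z - t / 2, 2 * z + t, y / 2 - t / 2, t, ?_⟩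
    rw [← key]
    unfold rho qN
    field_simp
    ring

/-- The "square" of a quadruple over a field of characteristic two. -/
def sq4 (m n x y z t : K) : K := x ^ 2 + m * y ^ 2 + n * z ^ 2 + m * n * t ^ 2

/-- The constant coefficient of the product of two quadruples. -/
def pr4 (m n x y z t x' y' z' t' : K) : K := x * x' + m * y * y' + n * z * z' + m * n * t * t'

/-- The 3-fold Pfister form in characteristic two, in purely inseparable coordinates. -/
def P8 (c m n x y z t x' y' z' t' : K) : K :=
  sq4 m n x y z t + pr4 m n x y z t x' y' z' t' + c * sq4 m n x' y' z' t'

theorem P8_eq (c m n x y z t x' y' z' t' : K) : P8 c m n x y z t x' y' z' t' =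
    rho c m x x' y y' + n * rho c m z z' t t' := by
  unfold P8 sq4 pr4 rho qN; ring

theorem rep_of_P8 (h2 : (2 : K) = 0) {c m n : K} (hm : m ≠ 0) {x y z t x' y' z' t' : K}
    (h : P8 c m n x y z t x' y' z' t' = 0)
    (hne : ¬ (x = 0 ∧ y = 0 ∧ z = 0 ∧ t = 0 ∧ x' = 0 ∧ y' = 0 ∧ z' = 0 ∧ t' = 0)) :
    Rep c m n := by
  rw [P8_eq] at h
  have hc : 1 - 4 * c ≠ 0 := by
    have : 1 - 4 * c = 1 := by linear_combination (-2 * c) * h2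
    rw [this]; exact one_ne_zero
  have := Rep.of_isotropic4 hm hc (by tauto) h
  have hn : -n = n := by linear_combination (-n) * h2
  rwa [hn] at this

theorem P8_of_repAll (hF : RepAll F) (h2 : (2 : F) = 0) (c : F) {m : F} (hm : m ≠ 0) {n : F}
    (hn : n ≠ 0) : ∃ x y z t x' y' z' t' : F, P8 c m n x y z t x' y' z' t' = 0 ∧
      ¬ (x = 0 ∧ y = 0 ∧ z = 0 ∧ t = 0 ∧ x' = 0 ∧ y' = 0 ∧ z' = 0 ∧ t' = 0) := by
  have hc : 1 - 4 * c ≠ 0 := by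
    have : 1 - 4 * c = 1 := by linear_combination (-2 * c) * h2
    rw [this]; exact one_ne_zero
  obtain ⟨x, x', y, y', h⟩ := hF c m n hm hn hc
  refine ⟨x, y, 1, 0, x', y', 0, 0, ?_, by simp⟩
  rw [P8_eq, h]
  simp [rho, qN]
  linear_combination n * h2

theorem QExt.rep_char_two (E : QExt F K c0) (hF : RepAll F) (h2 : (2 : F) = 0) (c : K) {m n : F}
    (hm : m ≠ 0) (hn : n ≠ 0) : Rep c (ι m) (ι n) := by
  have h2K : (2 : K) = 0 := by
    have := congrArg (ι) h2
    simpa only [map_ofNat, map_zero] using this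
  have hmK : ι m ≠ 0 := (map_ne_zero _).2 hm
  have aux : ∀ x y z t : F, sq4 m n x y z t = 0 → ¬ (x = 0 ∧ y = 0 ∧ z = 0 ∧ t = 0) →
      Rep c (ι m) (ι n) := by
    intro x y z t h hne
    refine rep_of_P8 h2K hmK (x := ι x) (y := ι y) (z := ι z) (t := ι t) (x' := 0) (y' := 0)
      (z' := 0) (t' := 0) ?_ (by simpa using hne)
    have := congrArg (ι) h
    simp [sq4] at this
    simp [P8, sq4, pr4, this]
  obtain ⟨al, be, hc⟩ := E.repr c
  obtain ⟨x, y, z, t, x', y', z', t', hP, hne⟩ := P8_of_repAll hF h2 be hm hn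
  by_cases hY : sq4 m n x' y' z' t' = 0
  · by_cases hY0 : x' = 0 ∧ y' = 0 ∧ z' = 0 ∧ t' = 0
    · obtain ⟨rfl, rfl, rfl, rfl⟩ := hY0
      exact aux x y z t (by simpa [P8, pr4, sq4] using hP) (by tauto)
    · exact aux _ _ _ _ hY hY0
  set s := sq4 m n x' y' z' t' with hs
  obtain ⟨Z0, Z1, Z2, Z3, hZ⟩ : ∃ Z0 Z1 Z2 Z3 : F, be + Z0 + sq4 m n Z0 Z1 Z2 Z3 = 0 := by
    refine ⟨(x * x' + m * y * y' + n * z * z' + m * n * t * t') / s,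
      (x * y' + y * x' + n * (z * t' + t * z')) / s,
      (x * z' + z * x' + m * (y * t' + t * y')) / s,
      (x * t' + t * x' + y * z' + z * y') / s, ?_⟩
    have hP' : be = - (sq4 m n x y z t + pr4 m n x y z t x' y' z' t') / s := by
      rw [P8, ← hs] at hP
      field_simp
      linear_combination hP
    have hsq : (x * x' + m * y * y' + n * z * z' + m * n * t * t') ^ 2 +
      m * (x * y' + y * x' + n * (z * t' + t * z')) ^ 2 +
      n * (x * z' + z * x' + m * (y * t' + t * y')) ^ 2 +
      m * n * (x * t' + t * x' + y * z' + z * y') ^ 2 = sq4 m n x y z t * s := by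
      rw [hs]; unfold sq4
      have : CharP F 2 := CharTwo.of_one_ne_zero_of_two_eq_zero one_ne_zero h2
      grind
    have hp : pr4 m n x y z t x' y' z' t' = x * x' + m * y * y' + n * z * z' + m * n * t * t' := rfl
    rw [hP', hp]
    set p := x * x' + m * y * y' + n * z * z' + m * n * t * t'
    have : sq4 m n (p / s) ((x * y' + y * x' + n * (z * t' + t * z')) / s)
      ((x * z' + z * x' + m * (y * t' + t * y')) / s)
      ((x * t' + t * x' + y * z' + z * y') / s) = (sq4 m n x y z t * s) / s ^ 2 := by
      rw [← hsq]; unfold sq4; ring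
    rw [this]
    field_simp
    ring
  set g := al + c0 * sq4 m n Z0 Z1 Z2 Z3 with hg
  obtain ⟨p0, p1, p2, p3, r0, r1, r2, r3, hQ, hne'⟩ := P8_of_repAll hF h2 g hm hn
  have hZK := congrArg (ι) hZ
  have hQK := congrArg (ι) hQ
  simp only [map_add, map_mul, map_zero, P8, sq4, pr4, map_pow, hg] at hZK hQK
  have hZK : ι be + ι Z0 = -(ι Z0 ^ 2 + ι m * ι Z1 ^ 2 + ι n * ι Z2 ^ 2 + ι m * ι n * ι Z3 ^ 2) := by
    linear_combination hZK
  have : CharP K 2 := CharTwo.of_one_ne_zero_of_two_eq_zero one_ne_zero h2K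
  have hsq := E.sq
  refine rep_of_P8 h2K hmK
    (x := ι p0 + E.ω * (ι Z0 * ι r0 + ι m * ι Z1 * ι r1 + ι n * ι Z2 * ι r2
      + ι m * ι n * ι Z3 * ι r3))
    (y := ι p1 + E.ω * (ι Z0 * ι r1 + ι Z1 * ι r0 + ι n * (ι Z2 * ι r3 + ι Z3 * ι r2)))
    (z := ι p2 + E.ω * (ι Z0 * ι r2 + ι Z2 * ι r0 + ι m * (ι Z1 * ι r3 + ι Z3 * ι r1)))
    (t := ι p3 + E.ω * (ι Z0 * ι r3 + ι Z3 * ι r0 + ι Z1 * ι r2 + ι Z2 * ι r1))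
    (x' := ι r0) (y' := ι r1) (z' := ι r2) (t' := ι r3) ?_ ?_
  · rw [hc]
    unfold P8 sq4 pr4
    generalize ι Z0 = Z0, ι Z1 = Z1, ι Z2 = Z2, ι Z3 = Z3, ι r0 = r0, ι r1 = r1, ι r2 = r2,
      ι r3 = r3, ι p0 = p0, ι p1 = p1, ι p2 = p2, ι p3 = p3, ι m = m, ι n = n, ι be = be,
      ι al = al, ι c0 = c0, E.ω = w at *
    have e1 : be = Z0 + (Z0 ^ 2 + m * Z1 ^ 2 + n * Z2 ^ 2 + m * n * Z3 ^ 2) := by grind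
    subst e1
    clear hZK
    grind
  · intro h
    apply hne'
    obtain ⟨h1, h2, h3, h4, h5, h6, h7, h8⟩ := h
    simp only [h5, h6, h7, h8, mul_zero, add_zero] at h1 h2 h3 h4
    simp only [map_eq_zero] at *
    exact ⟨h1, h2, h3, h4, h5, h6, h7, h8⟩

theorem QExt.rep_char_two' (E : QExt F K c0) (hF : RepAll F) (h2 : (2 : F) = 0) (c : K) {m : F}
    (hm : m ≠ 0) {b : K} (hb : b ≠ 0) : Rep c (ι m) b := by
  have h2K : (2 : K) = 0 := by
    have := congrArg (ι) h2
    simpa only [map_ofNat, map_zero] using this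
  have hmK : ι m ≠ 0 := (map_ne_zero _).2 hm
  have hcc : ∀ c : F, 1 - 4 * c ≠ 0 := fun c => by
    have : 1 - 4 * c = 1 := by linear_combination (-2 * c) * h2
    rw [this]; exact one_ne_zero
  have hccK : 1 - 4 * c ≠ 0 := by
    have : 1 - 4 * c = 1 := by linear_combination (-2 * c) * h2K
    rw [this]; exact one_ne_zero
  by_cases hbF : ∃ n, b = ι n
  · obtain ⟨n, rfl⟩ := hbF
    exact E.rep_char_two hF h2 c hm (by rintro rfl; simp at hb)
  by_cases hcF : ∃ n, c = ι n
  · obtain ⟨n, rfl⟩ := hcF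
    exact E.rep_base hF hm (hcc _) hb
  obtain ⟨a1, a2, haa⟩ := E.repr c
  obtain ⟨e1, e2, hee⟩ := E.repr b
  have ha2 : a2 ≠ 0 := by rintro rfl; exact hcF ⟨a1, by simpa using haa⟩
  have he2 : e2 ≠ 0 := by rintro rfl; exact hbF ⟨e1, by simpa using hee⟩
  set d := e2 / a2 with hd
  set g := e1 / d - a1 with hg
  have hd0 : d ≠ 0 := div_ne_zero he2 ha2
  have hdK : ι d ≠ 0 := (map_ne_zero _).2 hd0
  have hed : b = ι d * (c + ι g) := by
    have h2 : e2 = d * a2 := by rw [hd]; field_simp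
    rw [hee, haa, hg, h2]; simp; field_simp; ring
  have hb' : c + ι g ≠ 0 := by
    intro h; rw [h, mul_zero] at hed; exact hb hed
  rw [hed]
  refine Rep.mul (E.rep_char_two hF h2 c hm hd0) ?_
  obtain ⟨x, y, z, t, h⟩ := E.rep_base hF hm (hcc g) hb'
  have key : rho c (ι m) x y z t = (c + ι g) * rho c (ι m) (1 + y) 0 t 0 := by
    have h3 : rho c (ι m) x y z t = rho (ι g) (ι m) x y z t +
      (c - ι g) * (y * y + ι m * (t * t)) := by unfold rho qN; ring
    rw [h3, h]
    unfold rho qN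
    linear_combination (-ι g * (y * y + ι m * (t * t)) - (c + ι g) * y) * h2K
  by_cases h0 : rho c (ι m) (1 + y) 0 t 0 = 0
  · by_cases h1 : 1 + y = 0 ∧ t = 0
    · rw [h0, mul_zero] at key
      refine Rep.of_isotropic hmK hccK key ?_ _
      rintro ⟨-, h, -⟩
      rw [h] at h1
      simp at h1
    · exact Rep.of_isotropic hmK hccK h0 (by tauto) _
  · have : c + ι g = rho c (ι m) x y z t / rho c (ι m) (1 + y) 0 t 0 := by
      rw [key]; field_simp
    rw [this]
    exact Rep.div ⟨_, _, _, _, rfl⟩ ⟨_, _, _, _, rfl⟩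

/-- The property `I_q³ = 0` is preserved under separable quadratic extensions. -/
theorem QExt.repAll (E : QExt F K c0) (hF : RepAll F) : RepAll K := by
  have base : ∀ (c : F) (a e : K), a ≠ 0 → e ≠ 0 → 1 - 4 * c ≠ 0 → Rep (ι c) a e := by
    intro c a e ha he hc
    have hcK : (1 : K) - 4 * ι c ≠ 0 := by
      have := (map_ne_zero (ι)).2 hc
      simpa [map_ofNat] using this
    exact E.rep_of_base hcK (fun m b hm hb => E.rep_base hF hm hc hb) ha he
  intro c a e ha he hc
  refine E.rep_of_base hc (fun m b hm hb => ?_) ha he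
  by_cases h2 : (2 : F) = 0
  · exact E.rep_char_two' hF h2 c hm hb
  · have h2K : (2 : K) ≠ 0 := by
      have := (map_ne_zero (ι)).2 h2
      simpa only [map_ofNat] using this
    have h4 : (4 : F) ≠ 0 := by
      have : (4 : F) = 2 * 2 := by norm_num
      rw [this]; exact mul_ne_zero h2 h2
    rw [rep_swap h2K]
    have := base ((1 + m) / 4) (-(1 - 4 * c)) b (neg_ne_zero.2 hc) hb (by
      field_simp; simpa using hm)
    simpa [map_ofNat] using this

end Ascent

section Herm

variable {F K : Type} [Field F] [Field K] [Algebra F K] {c0 : F}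

theorem QExt.norm_eq (E : QExt F K c0) (a b : F) :
    (algebraMap F K a + algebraMap F K b * E.ω) * E.conj (algebraMap F K a + algebraMap F K b * E.ω)
      = algebraMap F K (qN c0 a b) := by
  simp only [map_add, map_mul, AlgEquiv.commutes, E.conj_ω, qN]
  linear_combination (-(algebraMap F K b * algebraMap F K b)) * E.sq

/-- A hermitian form of rank at least three over a separable quadratic extension is isotropic
when `I_q³ = 0`. -/
theorem QExt.herm (E : QExt F K c0) (hF : RepAll F) {U : Type} [AddCommGroup U] [Module K U]
    [Module.Finite K U] (hdim : 3 ≤ finrank K U) (h : U → U →ₗ[K] K) (ε : K)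
    (hε : ε ≠ 0) (hherm : ∀ u w, h u w = ε * E.conj (h w u)) : ∃ u, u ≠ 0 ∧ h u u = 0 := by
  by_contra! H
  have hsmul : ∀ (k : K) u w, h (k • u) w = E.conj k * h u w := by
    intro k u w
    rw [hherm, map_smul, smul_eq_mul, map_mul, hherm u w]; ring
  have hadd : ∀ u u' w, h (u + u') w = h u w + h u' w := by
    intro u u' w
    rw [hherm, map_add, map_add, hherm u w, hherm u' w]; ring
  have orth : ∀ u w, h u w = 0 → h w u = 0 := by
    intro u w h0; rw [hherm, h0]; simp
  have : Nontrivial U := Module.nontrivial_of_finrank_pos (R := K) (by omega)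
  obtain ⟨u1, hu1⟩ := exists_ne (0 : U)
  obtain ⟨u2, hu2, h12⟩ : ∃ u2, u2 ≠ 0 ∧ h u1 u2 = 0 := by
    have hk : LinearMap.ker (h u1) ≠ ⊥ := by
      intro hbot
      have := LinearMap.finrank_le_finrank_of_injective (LinearMap.ker_eq_bot.1 hbot)
      simp at this
      omega
    obtain ⟨v, hv, hne⟩ := Submodule.exists_mem_ne_zero_of_ne_bot hk
    exact ⟨v, hne, hv⟩
  obtain ⟨u3, hu3, h13, h23⟩ : ∃ u3, u3 ≠ 0 ∧ h u1 u3 = 0 ∧ h u2 u3 = 0 := by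
    have hk : LinearMap.ker ((h u1).prod (h u2)) ≠ ⊥ := by
      intro hbot
      have := LinearMap.finrank_le_finrank_of_injective (LinearMap.ker_eq_bot.1 hbot)
      simp at this
      omega
    obtain ⟨v, hv, hne⟩ := Submodule.exists_mem_ne_zero_of_ne_bot hk
    rw [LinearMap.mem_ker, LinearMap.prod_apply, Function.prod_apply, Prod.mk_eq_zero] at hv
    exact ⟨v, hne, hv⟩
  have ratio : ∀ u, ∃ a : F, h u u = algebraMap F K a * h u1 u1 := by
    intro u
    have : E.conj (h u u / h u1 u1) = h u u / h u1 u1 := by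
      have e1 := hherm u u
      have e2 := hherm u1 u1
      have n1 := H u1 hu1
      rw [map_div₀]
      have n2 : E.conj (h u1 u1) ≠ 0 := by simpa using n1
      rw [div_eq_div_iff n2 n1]
      apply mul_left_cancel₀ hε
      linear_combination h u u * e2 - h u1 u1 * e1
    obtain ⟨a, ha⟩ := E.fixed this
    exact ⟨a, by rw [← ha]; have := H u1 hu1; field_simp⟩
  obtain ⟨a, ha⟩ := ratio u2
  obtain ⟨e, he⟩ := ratio u3
  have ha0 : a ≠ 0 := by
    rintro rfl; exact H u2 hu2 (by simpa using ha)
  have he0 : e ≠ 0 := by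
    rintro rfl; exact H u3 hu3 (by simpa using he)
  obtain ⟨x, y, z, t, p, r, hne, h0⟩ := hF.iso3 ha0 he0 E.disc_ne_zero
  set X := algebraMap F K x + algebraMap F K y * E.ω with hX
  set Y := algebraMap F K z + algebraMap F K t * E.ω with hY
  set Z := algebraMap F K p + algebraMap F K r * E.ω with hZ
  have h21 := orth _ _ h12
  have h31 := orth _ _ h13
  have h32 := orth _ _ h23
  refine H (X • u1 + Y • u2 + Z • u3) ?_ ?_
  · intro hz
    have e1 : X * h u1 u1 = 0 := by
      have := congrArg (h u1) hz; simpa [h12, h13] using this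
    have e2 : Y * h u2 u2 = 0 := by
      have := congrArg (h u2) hz; simpa [h21, h23] using this
    have e3 : Z * h u3 u3 = 0 := by
      have := congrArg (h u3) hz; simpa [h31, h32] using this
    have f1 := E.ind _ _ ((mul_eq_zero.1 e1).resolve_right (H _ hu1))
    have f2 := E.ind _ _ ((mul_eq_zero.1 e2).resolve_right (H _ hu2))
    have f3 := E.ind _ _ ((mul_eq_zero.1 e3).resolve_right (H _ hu3))
    tauto
  · simp only [hadd, hsmul, map_add, map_smul, smul_eq_mul, h12, h13, h21, h23, h31, h32, ha, he,
      mul_zero, add_zero, zero_add]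
    have n1 := E.norm_eq x y
    have n2 := E.norm_eq z t
    have n3 := E.norm_eq p r
    rw [← hX] at n1
    rw [← hY] at n2
    rw [← hZ] at n3
    have h0' := congrArg (algebraMap F K) h0
    simp only [map_add, map_mul, map_zero, ← n1, ← n2, ← n3] at h0'
    linear_combination h u1 u1 * h0'

end Herm

section EvenClifford

/-- The polar form of the quadratic form `v ↦ β v v`. -/
def pol {K V : Type} [Field K] [AddCommGroup V] [Module K V] (β : V →ₗ[K] V →ₗ[K] K) :
    V →ₗ[K] V →ₗ[K] K := β + β.flip

theorem pol_apply {K V : Type} [Field K] [AddCommGroup V] [Module K V] (β : V →ₗ[K] V →ₗ[K] K)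
    (v w : V) : pol β v w = β v w + β w v := rfl

theorem pol_comm {K V : Type} [Field K] [AddCommGroup V] [Module K V] (β : V →ₗ[K] V →ₗ[K] K)
    (v w : V) : pol β v w = pol β w v := by rw [pol_apply, pol_apply, add_comm]

/-- Nondegeneracy of a quadratic form, via its polar form. -/
def Nondeg {K V : Type} [Field K] [AddCommGroup V] [Module K V] (β : V →ₗ[K] V →ₗ[K] K) : Prop :=
  ∀ v, (∀ w, pol β v w = 0) → v = 0

/-- The bilinear map `m` makes `S` into a module over the even Clifford algebra
of the quadratic form `v ↦ β v v`. -/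
def IsECM {K V S : Type} [Field K] [AddCommGroup V] [Module K V] [AddCommGroup S] [Module K S]
    (β : V →ₗ[K] V →ₗ[K] K) (m : V →ₗ[K] V →ₗ[K] Module.End K S) : Prop :=
  (∀ v, m v v = β v v • 1) ∧ ∀ u v w, m u v * m v w = β v v • m u w

section

variable {K V S : Type} [Field K] [AddCommGroup V] [Module K V] [AddCommGroup S] [Module K S]
  {β : V →ₗ[K] V →ₗ[K] K} {m : V →ₗ[K] V →ₗ[K] Module.End K S}

theorem IsECM.add_swap (h : IsECM β m) (v w : V) : m v w + m w v = pol β v w • 1 := by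
  have h1 := h.1 (v + w)
  simp only [map_add, LinearMap.add_apply, h.1, add_smul] at h1
  rw [pol_apply, add_smul]
  linear_combination (norm := abel) h1

theorem IsECM.mul_add (h : IsECM β m) (u v v' w : V) :
    m u v * m v' w + m u v' * m v w = pol β v v' • m u w := by
  have h1 := h.2 u (v + v') w
  simp only [map_add, LinearMap.add_apply, add_mul, _root_.mul_add, h.2, add_smul] at h1
  rw [pol_apply, add_smul]
  linear_combination (norm := abel) h1

theorem IsECM.swap (h : IsECM β m) {v w : V} (h0 : pol β v w = 0) : m w v = - m v w := by
  have := h.add_swap v w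
  rw [h0, zero_smul] at this
  exact eq_neg_of_add_eq_zero_right this

theorem IsECM.mul_swap (h : IsECM β m) (u : V) {v v' : V} (w : V) (h0 : pol β v v' = 0) :
    m u v * m v' w = - (m u v' * m v w) := by
  have := h.mul_add u v v' w
  rw [h0, zero_smul] at this
  exact eq_neg_of_add_eq_zero_left this

theorem Nondeg.exists_anisotropic (hb : Nondeg β) [Nontrivial V] : ∃ v, β v v ≠ 0 := by
  by_contra! H
  obtain ⟨v, hv⟩ := exists_ne (0 : V)
  apply hv
  apply hb
  intro w
  have := H (v + w)
  simpa [H, pol_apply, add_comm] using this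

theorem Nondeg.exists_pol_eq_one (hb : Nondeg β) {v : V} (hv : v ≠ 0) : ∃ w, pol β v w = 1 := by
  by_contra! H
  apply hv
  apply hb
  intro w
  by_contra hw
  apply H ((pol β v w)⁻¹ • w)
  rw [map_smul, smul_eq_mul, inv_mul_cancel₀ hw]

end

/-- Every faithful-size even Clifford module forces a totally isotropic subspace of half the
dimension. -/
def LagProp (n : ℕ) (K : Type) [Field K] : Prop :=
  ∀ (V S : Type) [AddCommGroup V] [Module K V] [AddCommGroup S] [Module K S]
    [Module.Finite K V] [Module.Finite K S]
    (β : V →ₗ[K] V →ₗ[K] K) (m : V →ₗ[K] V →ₗ[K] Module.End K S),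
    IsECM β m → Nondeg β → finrank K V = 2 * n → Nontrivial S → finrank K S ≤ 2 ^ (n - 1) →
    ∃ U : Submodule K V, finrank K U = n ∧ ∀ u ∈ U, β u u = 0

variable {K V S : Type} [Field K] [AddCommGroup V] [Module K V] [AddCommGroup S] [Module K S]
    [Module.Finite K V] [Module.Finite K S]
    {β : V →ₗ[K] V →ₗ[K] K} {m : V →ₗ[K] V →ₗ[K] Module.End K S}

omit [Module.Finite K V] in
theorem Nondeg.exists_hyperbolic (hb : Nondeg β) {e : V} (he : e ≠ 0) (hq : β e e = 0) :
    ∃ f, pol β e f = 1 ∧ β f f = 0 := by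
  obtain ⟨f, hf⟩ := hb.exists_pol_eq_one he
  refine ⟨f - β f f • e, ?_, ?_⟩
  · rw [map_sub, map_smul, hf, pol_apply, hq]; simp
  · have : β e f + β f e = 1 := hf
    simp only [map_sub, map_smul, LinearMap.sub_apply, LinearMap.smul_apply, smul_eq_mul, hq]
    linear_combination (-β f f) * this

/-- The orthogonal complement of a pair of vectors. -/
def orth2 (β : V →ₗ[K] V →ₗ[K] K) (e f : V) : Submodule K V :=
  LinearMap.ker ((pol β e).prod (pol β f))

omit [Module.Finite K V] in
theorem mem_orth2 {e f v : V} : v ∈ orth2 β e f ↔ pol β e v = 0 ∧ pol β f v = 0 := by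
  rw [orth2, LinearMap.mem_ker, LinearMap.prod_apply, Function.prod_apply, Prod.mk_eq_zero]

theorem finrank_orth2 {e f : V} (hef : pol β e f = 1) (he : β e e = 0) (hf : β f f = 0) :
    finrank K (orth2 β e f) + 2 = finrank K V := by
  have hs : Function.Surjective ((pol β e).prod (pol β f)) := by
    rintro ⟨x, y⟩
    refine ⟨x • f + y • e, ?_⟩
    have h1 : pol β e e = 0 := by rw [pol_apply, he, add_zero]
    have h2 : pol β f f = 0 := by rw [pol_apply, hf, add_zero]
    have h3 : pol β f e = 1 := by rw [pol_comm, hef]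
    simp [h1, h2, h3, hef]
  have := LinearMap.finrank_range_add_finrank_ker ((pol β e).prod (pol β f))
  rw [LinearMap.range_eq_top.2 hs, finrank_top, Module.finrank_prod, Module.finrank_self] at this
  rw [orth2]; omega

omit [Module.Finite K V] in
theorem nondeg_orth2 (hb : Nondeg β) {e f : V} (hef : pol β e f = 1) (he : β e e = 0)
    (hf : β f f = 0) : Nondeg (β.domRestrict₁₂ (orth2 β e f) (orth2 β e f)) := by
  rintro ⟨v, hv⟩ H
  rw [mem_orth2] at hv
  have h1 : pol β e e = 0 := by rw [pol_apply, he, add_zero]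
  have h2 : pol β f f = 0 := by rw [pol_apply, hf, add_zero]
  have h3 : pol β f e = 1 := by rw [pol_comm, hef]
  suffices v = 0 by simpa using this
  apply hb
  intro w
  have hw : w - pol β e w • f - pol β f w • e ∈ orth2 β e f := by
    rw [mem_orth2]; simp [h1, h2, h3, hef]
  have := H ⟨_, hw⟩
  have h4 : pol β v (w - pol β e w • f - pol β f w • e) = 0 := this
  have h5 : pol β v e = 0 := by rw [pol_comm, hv.1]
  have h6 : pol β v f = 0 := by rw [pol_comm, hv.2]
  simpa [h5, h6] using h4

/-- The even Clifford module of the complement of a hyperbolic plane. -/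
def compM (m : V →ₗ[K] V →ₗ[K] Module.End K S) (W : Submodule K V) (P : Module.End K S) :
    W →ₗ[K] W →ₗ[K] Module.End K (LinearMap.range P) :=
  LinearMap.mk₂ K (fun v w => P.rangeRestrict ∘ₗ m v w ∘ₗ (LinearMap.range P).subtype)
    (fun a b c => by ext; simp) (fun a b c => by ext; simp)
    (fun a b c => by ext; simp) (fun a b c => by ext; simp)

theorem lagrangian_of_isotropic {n : ℕ} (IH : LagProp n K) (hm : IsECM β m) (hb : Nondeg β)
    (hV : finrank K V = 2 * (n + 1)) (hS : Nontrivial S) (hSd : finrank K S ≤ 2 ^ n) {e : V}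
    (he0 : e ≠ 0) (he : β e e = 0) :
    ∃ U : Submodule K V, finrank K U = n + 1 ∧ ∀ u ∈ U, β u u = 0 := by
  obtain ⟨f, hef, hf⟩ := hb.exists_hyperbolic he0 he
  rcases Nat.eq_zero_or_pos n with rfl | hn
  · refine ⟨K ∙ e, by simpa using finrank_span_singleton he0, ?_⟩
    intro u hu
    obtain ⟨k, rfl⟩ := Submodule.mem_span_singleton.1 hu
    simp [he]
  set W := orth2 β e f with hW
  have hWr := finrank_orth2 hef he hf
  have hWn := nondeg_orth2 hb hef he hf
  rw [← hW] at hWr hWn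
  set P := m e f with hP
  have hPP : P * P = P := by
    have := hm.mul_add e f e f
    rw [hm.1, he, zero_smul, zero_mul, add_zero, pol_comm, hef, one_smul] at this
    exact this
  have hcomm : ∀ v ∈ W, ∀ w ∈ W, P * m v w = m v w * P := by
    intro v hv w hw
    rw [hW, mem_orth2] at hv hw
    rw [hP, hm.mul_swap e w hv.2, hm.mul_swap v (v := w) (v' := e) f (by rw [pol_comm]; exact hw.1),
      hm.swap hv.1, hm.swap hw.2]
    simp
  have : Nontrivial W := Module.nontrivial_of_finrank_pos (R := K) (by omega)
  obtain ⟨⟨v1, hv1⟩, hq1⟩ := hWn.exists_anisotropic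
  have hq1 : β v1 v1 ≠ 0 := hq1
  have hv1' := mem_orth2.1 hv1
  have key1 : P * m e v1 = m e v1 := by
    have := hm.mul_add e f e v1
    rw [hm.1, he, zero_smul, zero_mul, add_zero, pol_comm, hef, one_smul] at this
    exact this
  have key2 : P * m v1 f = 0 := by
    have := hm.mul_swap e (v := f) (v' := v1) f hv1'.2
    rw [hm.1, hf, zero_smul, mul_zero, neg_zero] at this
    exact this
  have key3 : m e v1 * m v1 f = β v1 v1 • P := hm.2 e v1 f
  have key4 : m f v1 * m v1 e = β v1 v1 • m f e := hm.2 f v1 e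
  have hPne : P ≠ 0 := by
    intro h0
    rw [h0, zero_mul] at key1
    have h1 : m v1 e = 0 := by rw [hm.swap hv1'.1, ← key1, neg_zero]
    rw [h1, mul_zero] at key4
    have h2 : m f e = 0 := ((smul_eq_zero.1 key4.symm).resolve_left hq1)
    have h3 := hm.add_swap e f
    rw [← hP, h0, h2, hef, one_smul, add_zero] at h3
    exact zero_ne_one h3
  have hdim : 2 * finrank K (LinearMap.range P) ≤ finrank K S := by
    have h1 := LinearMap.finrank_range_add_finrank_ker P
    suffices finrank K (LinearMap.range P) ≤ finrank K (LinearMap.ker P) by omega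
    refine LinearMap.finrank_le_finrank_of_injective
      (f := ((m v1 f).comp (LinearMap.range P).subtype).codRestrict (LinearMap.ker P) ?_) ?_
    · intro s
      exact LinearMap.congr_fun key2 s
    · rw [← LinearMap.ker_eq_bot, LinearMap.ker_eq_bot']
      rintro ⟨s, t, rfl⟩ hs
      have h2 : m v1 f (P t) = 0 := congrArg Subtype.val hs
      have h3 : (m e v1 * m v1 f) (P t) = 0 := by
        rw [Module.End.mul_apply, h2, map_zero]
      rw [key3, LinearMap.smul_apply, ← Module.End.mul_apply, hPP] at h3
      have h4 := (smul_eq_zero.1 h3).resolve_left hq1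
      exact Subtype.ext h4
  have hPfix : ∀ s : LinearMap.range P, P s = s := by
    rintro ⟨s, t, rfl⟩
    exact LinearMap.congr_fun hPP t
  have hmem : ∀ (v w : W) (s : LinearMap.range P), P (m v w s) = m v w s := by
    intro v w s
    have := LinearMap.congr_fun (hcomm v v.2 w w.2) s
    simpa [hPfix] using this
  have hm' : IsECM (β.domRestrict₁₂ W W) (compM m W P) := by
    constructor
    · intro v
      ext s
      have := LinearMap.congr_fun (hm.1 v) s
      simp [compM, this, hPfix]
      rfl
    · intro u v w
      ext s
      have := LinearMap.congr_fun (hm.2 u v w) s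
      simp only [Module.End.mul_apply, LinearMap.smul_apply] at this
      simp [compM, this, hmem]
      rfl
  obtain ⟨U', hU', hUq⟩ := IH W (LinearMap.range P) _ _ hm' hWn (by omega)
    (Submodule.nontrivial_iff_ne_bot.2 (by rwa [Ne, LinearMap.range_eq_bot]))
    (by obtain ⟨k, rfl⟩ : ∃ k, n = k + 1 := ⟨n - 1, by omega⟩
        rw [pow_succ] at hSd; simp; omega)
  refine ⟨U'.map W.subtype ⊔ K ∙ e, ?_, ?_⟩
  · have hd : Disjoint (U'.map W.subtype) (K ∙ e) := by
      rw [Submodule.disjoint_def]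
      rintro x ⟨⟨y, hy⟩, -, rfl⟩ hx
      obtain ⟨k, hk⟩ := Submodule.mem_span_singleton.1 hx
      have := (mem_orth2.1 hy).2
      simp only [Submodule.subtype_apply] at hk
      rw [← hk, map_smul, pol_comm, hef, smul_eq_mul, mul_one] at this
      simp only [Submodule.subtype_apply]
      rw [← hk, this, zero_smul]
    have := Submodule.finrank_sup_add_finrank_inf_eq (U'.map W.subtype) (K ∙ e)
    rw [hd.eq_bot, finrank_bot, finrank_span_singleton he0,
      Submodule.finrank_map_subtype_eq] at this
    omega
  · intro u hu
    obtain ⟨x, ⟨y, hy, rfl⟩, z, hz, rfl⟩ := Submodule.mem_sup.1 hu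
    obtain ⟨k, rfl⟩ := Submodule.mem_span_singleton.1 hz
    have h1 : β y y = 0 := hUq y hy
    have h2 : β e y + β y e = 0 := (mem_orth2.1 y.2).1
    simp only [Submodule.subtype_apply, map_add, map_smul, LinearMap.add_apply,
      LinearMap.smul_apply, smul_eq_mul, h1, he]
    linear_combination k * h2

end EvenClifford

section BaseChange

variable {K E V N : Type} [Field K] [Field E] [Algebra K E] [AddCommGroup V] [Module K V]
  [AddCommMonoid N] [Module K N] [Module E N] [IsScalarTower K E N]

/-- Scalar extension of a bilinear map. -/
noncomputable def ext2 (E : Type) [Field E] [Algebra K E] [Module E N] [IsScalarTower K E N]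
    (g : V →ₗ[K] V →ₗ[K] N) :
    E ⊗[K] V →ₗ[E] E ⊗[K] V →ₗ[E] N :=
  LinearMap.liftBaseChange E
    (((LinearMap.liftBaseChangeEquiv (R := K) (M := V) (N := N) E).toLinearMap.restrictScalars K) ∘ₗ
      g)

theorem ext2_tmul (g : V →ₗ[K] V →ₗ[K] N) (a b : E) (v w : V) :
    ext2 E g (a ⊗ₜ v) (b ⊗ₜ w) = a • b • g v w := by
  simp [ext2]

theorem QExt.tensor_repr {c0 : K} (Q : QExt K E c0) (x : E ⊗[K] V) :
    ∃ v w : V, x = 1 ⊗ₜ v + Q.ω ⊗ₜ w := by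
  induction x with
  | zero => exact ⟨0, 0, by simp⟩
  | tmul a v =>
    obtain ⟨p, r, rfl⟩ := Q.repr a
    refine ⟨p • v, r • v, ?_⟩
    rw [TensorProduct.add_tmul, ← TensorProduct.smul_tmul, ← TensorProduct.smul_tmul,
      Algebra.smul_def, Algebra.smul_def, mul_one]
  | add x y hx hy =>
    obtain ⟨v, w, rfl⟩ := hx
    obtain ⟨v', w', rfl⟩ := hy
    exact ⟨v + v', w + w', by simp only [TensorProduct.tmul_add]; abel⟩

/-- The semilinear conjugation on a scalar extension. -/
noncomputable def QExt.J (Q : QExt K E c0) (V : Type) [AddCommGroup V] [Module K V] :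
    E ⊗[K] V →ₗ[K] E ⊗[K] V :=
  LinearMap.rTensor V Q.conj.toLinearMap

theorem QExt.J_tmul {c0 : K} (Q : QExt K E c0) (a : E) (v : V) :
    Q.J V (a ⊗ₜ v) = Q.conj a ⊗ₜ v := rfl

end BaseChange

section Lagrangian

variable {K V S : Type} [Field K] [AddCommGroup V] [Module K V] [AddCommGroup S] [Module K S]
    [Module.Finite K V] [Module.Finite K S]
    {β : V →ₗ[K] V →ₗ[K] K} {m : V →ₗ[K] V →ₗ[K] Module.End K S}

omit [Module.Finite K V] in
theorem IsECM.isotropic_of_small (hm : IsECM β m) (hb : Nondeg β) [Nontrivial V] [Nontrivial S]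
    (h : finrank K S < finrank K V) : ∃ e, e ≠ 0 ∧ β e e = 0 := by
  obtain ⟨v0, hv0⟩ := hb.exists_anisotropic
  obtain ⟨s, hs⟩ := exists_ne (0 : S)
  let φ : V →ₗ[K] S := (LinearMap.applyₗ s) ∘ₗ (m v0)
  have hk : LinearMap.ker φ ≠ ⊥ := by
    intro hbot
    have := LinearMap.finrank_le_finrank_of_injective (LinearMap.ker_eq_bot.1 hbot)
    omega
  obtain ⟨v, hv, hne⟩ := Submodule.exists_mem_ne_zero_of_ne_bot hk
  have hv : m v0 v s = 0 := hv
  refine ⟨v, hne, ?_⟩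
  have h1 : (m v0 v * m v v0) = β v v • m v0 v0 := hm.2 v0 v v0
  have h2 : (m v v0 * m v0 v) = β v0 v0 • m v v := hm.2 v v0 v
  have h3 := LinearMap.congr_fun h2 s
  rw [Module.End.mul_apply, hv, map_zero, hm.1] at h3
  simpa [hv0, hs] using h3.symm

variable {E : Type} [Field E] [Algebra K E]

/-- Scalar extension of a bilinear form. -/
noncomputable def extB (E : Type) [Field E] [Algebra K E] (β : V →ₗ[K] V →ₗ[K] K) :
    E ⊗[K] V →ₗ[E] E ⊗[K] V →ₗ[E] E :=
  ext2 E (β.compr₂ (Algebra.linearMap K E))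

/-- Scalar extension of an even Clifford module. -/
noncomputable def extM (E : Type) [Field E] [Algebra K E] (m : V →ₗ[K] V →ₗ[K] Module.End K S) :
    E ⊗[K] V →ₗ[E] E ⊗[K] V →ₗ[E] Module.End E (E ⊗[K] S) :=
  ext2 (N := Module.End E (E ⊗[K] S)) E (m.compr₂ (LinearMap.baseChangeHom K E S S))

omit [Module.Finite K V] in
theorem extB_tmul (a b : E) (v w : V) :
    extB E β (a ⊗ₜ v) (b ⊗ₜ w) = a * b * algebraMap K E (β v w) := by
  simp [extB, ext2_tmul, mul_assoc]

omit [Module.Finite K V] [Module.Finite K S] in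
theorem extM_tmul (a b : E) (v w : V) :
    extM E m (a ⊗ₜ v) (b ⊗ₜ w) = (a * b) • (m v w).baseChange E := by
  simp [extM, ext2_tmul, mul_smul]

omit [Module.Finite K V] [Module.Finite K S] in
theorem extM_ecm {c0 : K} (Q : QExt K E c0) (hm : IsECM β m) : IsECM (extB E β) (extM E m) := by
  obtain ⟨bc, bc_def⟩ : ∃ bc : Module.End K S → (E ⊗[K] S →ₗ[E] E ⊗[K] S),
      ∀ f, f.baseChange E = bc f := ⟨_, fun _ => rfl⟩
  have bc_add : ∀ f g, bc (f + g) = bc f + bc g := fun f g => by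
    rw [← bc_def, ← bc_def, ← bc_def]; exact LinearMap.baseChange_add f g
  have bc_mul : ∀ f g, bc (f * g) = bc f * bc g := fun f g => by
    rw [← bc_def, ← bc_def, ← bc_def]; exact LinearMap.baseChange_mul f g
  have bc_one : bc 1 = 1 := by
    rw [← bc_def, Module.End.one_eq_id, LinearMap.baseChange_id]; rfl
  have hbc : ∀ (a : K) (f : Module.End K S), bc (a • f) = algebraMap K E a • bc f := by
    intro a f; rw [← bc_def, ← bc_def, LinearMap.baseChange_smul, algebraMap_smul]
  have h1 : ∀ v w : V, bc (m v w) + bc (m w v) =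
      algebraMap K E (β v w + β w v) • bc 1 := by
    intro v w
    rw [← bc_add, hm.add_swap, hbc, pol_apply]
  have h2 : ∀ u v v' w : V, bc (m u v) * bc (m v' w) + bc (m u v') * bc (m v w) =
      algebraMap K E (β v v' + β v' v) • bc (m u w) := by
    intro u v v' w
    rw [← bc_mul, ← bc_mul, ← bc_add, hm.mul_add, hbc, pol_apply]
  have h3 : ∀ v : V, bc (m v v) = algebraMap K E (β v v) • bc 1 := by
    intro v
    rw [hm.1, hbc]
  have h4 : ∀ u v w : V, bc (m u v) * bc (m v w) = algebraMap K E (β v v) • bc (m u w) := by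
    intro u v w
    rw [← bc_mul, hm.2, hbc]
  constructor
  · intro x
    obtain ⟨v, w, rfl⟩ := Q.tensor_repr x
    simp only [map_add, LinearMap.add_apply, extM_tmul, extB_tmul, bc_def, h3]
    rw [← bc_one]
    refine LinearMap.ext fun z => ?_
    have := LinearMap.congr_fun (h1 v w) z
    simp only [map_add, LinearMap.add_apply, LinearMap.smul_apply] at this ⊢
    linear_combination (norm := module) (Q.ω : E) • this
  · intro x y z
    induction x with
    | zero => simp
    | add x x' hx hx' =>
      rw [map_add, LinearMap.add_apply, LinearMap.add_apply, add_mul, hx, hx', smul_add]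
    | tmul a u =>
    induction z with
    | zero => simp
    | add z z' hz hz' =>
      rw [map_add, map_add, mul_add, hz, hz', smul_add]
    | tmul b t =>
      obtain ⟨v, w, rfl⟩ := Q.tensor_repr y
      simp only [map_add, LinearMap.add_apply, extM_tmul, extB_tmul, bc_def, add_mul, mul_add,
        smul_mul_smul_comm, h4]
      refine LinearMap.ext fun z => ?_
      have := LinearMap.congr_fun (h2 u v w t) z
      simp only [map_add, LinearMap.add_apply, LinearMap.smul_apply] at this ⊢
      linear_combination (norm := module) (a * b * Q.ω : E) • this

omit [Module.Finite K V] in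
theorem extB_nondeg {c0 : K} (Q : QExt K E c0) (hb : Nondeg β) : Nondeg (extB E β) := by
  intro x hx
  obtain ⟨v, w, rfl⟩ := Q.tensor_repr x
  have : ∀ u, pol β v u = 0 ∧ pol β w u = 0 := by
    intro u
    apply Q.ind
    have := hx (1 ⊗ₜ u)
    simp only [pol_apply, map_add, LinearMap.add_apply, extB_tmul] at this ⊢
    linear_combination this
  rw [hb v fun u => (this u).1, hb w fun u => (this u).2]
  simp

omit [Module.Finite K V] in
theorem extB_conj {c0 : K} (Q : QExt K E c0) (x y : E ⊗[K] V) :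
    extB E β (Q.J V x) (Q.J V y) = Q.conj (extB E β x y) := by
  induction x with
  | zero => simp
  | add x x' hx hx' => simp only [map_add, LinearMap.add_apply, hx, hx']
  | tmul a u =>
  induction y with
  | zero => simp
  | add z z' hz hz' => simp only [map_add, hz, hz']
  | tmul b t => simp [Q.J_tmul, extB_tmul]

omit [Module.Finite K V] in
theorem QExt.J_smul {c0 : K} (Q : QExt K E c0) (a : E) (x : E ⊗[K] V) :
    Q.J V (a • x) = Q.conj a • Q.J V x := by
  induction x with
  | zero => simp
  | add x x' hx hx' => simp only [map_add, smul_add, hx, hx']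
  | tmul b u => simp [Q.J_tmul, TensorProduct.smul_tmul']

omit [Module.Finite K V] in
theorem QExt.J_J {c0 : K} (Q : QExt K E c0) (x : E ⊗[K] V) : Q.J V (Q.J V x) = x := by
  induction x with
  | zero => simp
  | add x x' hx hx' => simp only [map_add, hx, hx']
  | tmul b u => simp [Q.J_tmul, Q.conj_conj]

omit [Module.Finite K V] in
/-- A vector that is totally isotropic together with its conjugate descends. -/
theorem descend_isotropic {c0 : K} (Q : QExt K E c0) {x : E ⊗[K] V} (hx : x ≠ 0)
    (h1 : extB E β x x = 0) (h2 : pol (extB E β) (Q.J V x) x = 0) :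
    ∃ v, v ≠ 0 ∧ β v v = 0 := by
  obtain ⟨v, w, rfl⟩ := Q.tensor_repr x
  simp only [map_add, LinearMap.add_apply, extB_tmul, Q.J_tmul, pol_apply, Q.conj_ω, map_one]
    at h1 h2
  have e1 : β v v - c0 * β w w = 0 ∧ (β v w + β w v) + β w w = 0 := by
    apply Q.ind
    simp only [map_add, map_sub, map_mul]
    linear_combination h1 - algebraMap K E (β w w) * Q.sq
  have e2 : (1 - 4 * c0) * β w w = 0 := by
    have : 2 * β v v + (β v w + β w v) + 2 * c0 * β w w = 0 := by
      apply (algebraMap K E).injective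
      simp only [map_add, map_mul, map_ofNat, map_zero]
      linear_combination h2 + 2 * algebraMap K E (β w w) * Q.sq
    linear_combination e1.2 + 2 * e1.1 - this
  have hw : β w w = 0 := (mul_eq_zero.1 e2).resolve_left Q.disc_ne_zero
  have hv : β v v = 0 := by simpa [hw] using e1.1
  by_cases h0 : v = 0
  · by_cases h0' : w = 0
    · simp [h0, h0'] at hx
    · exact ⟨w, h0', hw⟩
  · exact ⟨v, h0, hv⟩

omit [Module.Finite K V] in
theorem exists_pair (hb : Nondeg β) (hV : 3 ≤ finrank K V) : ∃ e f, pol β e f = 1 ∧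
    β e e ≠ 0 ∧ ∀ k : K, f ≠ k • e := by
  have : Nontrivial V := Module.nontrivial_of_finrank_pos (R := K) (by omega)
  have : Module.Finite K V := Module.finite_of_finrank_pos (by omega)
  obtain ⟨e, he⟩ := hb.exists_anisotropic
  have he0 : e ≠ 0 := by rintro rfl; simp at he
  obtain ⟨f, hf⟩ := hb.exists_pol_eq_one he0
  by_cases hfe : ∃ k : K, f = k • e
  · obtain ⟨k, rfl⟩ := hfe
    have hk : LinearMap.ker (pol β e) ≠ ⊥ := by
      intro hbot
      have := LinearMap.finrank_le_finrank_of_injective (LinearMap.ker_eq_bot.1 hbot)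
      simp at this
      omega
    obtain ⟨g, hg, hg0⟩ := Submodule.exists_mem_ne_zero_of_ne_bot hk
    have hg : pol β e g = 0 := hg
    refine ⟨e, k • e + g, by rw [map_add, hf, hg, add_zero], he, ?_⟩
    intro k' hk'
    have hgg : g = (k' - k) • e := by rw [sub_smul, ← hk']; abel
    rw [hgg, map_smul, smul_eq_mul] at hg
    rcases mul_eq_zero.1 hg with h | h
    · rw [h, zero_smul] at hgg; exact hg0 hgg
    · rw [map_smul, h, smul_zero] at hf
      exact zero_ne_one hf
  · exact ⟨e, f, hf, he, fun k hk => hfe ⟨k, hk⟩⟩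

theorem lagProp (n : ℕ) (hn : 1 ≤ n) : ∀ (K : Type) [Field K], RepAll K → LagProp n K := by
  induction n, hn using Nat.le_induction with
  | base =>
    intro K _ _ V S _ _ _ _ _ _ β m hm hb hV hS hSd
    have : Nontrivial V := Module.nontrivial_of_finrank_pos (R := K) (by omega)
    obtain ⟨e, he0, he⟩ := hm.isotropic_of_small hb (by simp at hSd; omega)
    refine ⟨K ∙ e, finrank_span_singleton he0, ?_⟩
    intro u hu
    obtain ⟨k, rfl⟩ := Submodule.mem_span_singleton.1 hu
    simp [he]
  | succ n hn IH =>
    intro K _ hK V S _ _ _ _ _ _ β m hm hb hV hS hSd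
    have : Nontrivial V := Module.nontrivial_of_finrank_pos (R := K) (by omega)
    simp only [Nat.add_sub_cancel] at hSd
    suffices ∃ e, e ≠ 0 ∧ β e e = 0 by
      obtain ⟨e, he0, he⟩ := this
      exact lagrangian_of_isotropic (IH K hK) hm hb hV hS hSd he0 he
    by_cases hn4 : n < 3
    · apply hm.isotropic_of_small hb
      interval_cases n <;> simp at hSd <;> omega
    obtain ⟨e, f, hef, he, hfe⟩ := exists_pair hb (by omega)
    by_cases hroot : ∃ x : K, x * x - x + β e e * β f f = 0
    · obtain ⟨x, hx⟩ := hroot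
      refine ⟨f + (-x / β e e) • e, ?_, ?_⟩
      · intro h
        apply hfe (x / β e e)
        rw [eq_neg_of_add_eq_zero_left h, ← neg_smul]; congr 1; ring
      · have h1 : β e f + β f e = 1 := hef
        simp only [map_add, map_smul, LinearMap.add_apply, LinearMap.smul_apply, smul_eq_mul]
        have : β f f = (x - x * x) / β e e := by field_simp; linear_combination hx
        rw [this]
        field_simp
        linear_combination (-x) * h1
    push Not at hroot
    obtain ⟨E, _, _, ⟨Q⟩⟩ := exists_qext _ hroot
    have hfr : finrank E (E ⊗[K] V) = 2 * (n + 1) := by rw [Module.finrank_baseChange, hV]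
    have hE := Q.repAll hK
    have hiso : ∃ x, x ≠ 0 ∧ extB E β x x = 0 := by
      have h1 : β e f + β f e = 1 := hef
      have h1' := congrArg (algebraMap K E) h1
      simp only [map_add, map_one] at h1'
      have heE : algebraMap K E (β e e) ≠ 0 := (map_ne_zero _).2 he
      refine ⟨1 ⊗ₜ f + (-Q.ω / algebraMap K E (β e e)) ⊗ₜ e, ?_, ?_⟩
      · intro h
        have h2 := congrArg (pol (extB E β) (1 ⊗ₜ e)) h
        simp only [map_add, pol_apply, extB_tmul, map_zero] at h2
        field_simp at h2
        have := Q.ind 1 (-2) (by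
          simp only [map_one, map_neg, map_ofNat]
          linear_combination h2 - h1')
        exact one_ne_zero this.1
      · have hs := Q.sq
        simp only [map_add, LinearMap.add_apply, extB_tmul]
        rw [map_mul] at hs
        field_simp
        linear_combination (-Q.ω) * h1' + hs
    obtain ⟨x, hx0, hx⟩ := hiso
    have hS' : finrank E (E ⊗[K] S) ≤ 2 ^ n := by rw [Module.finrank_baseChange]; exact hSd
    obtain ⟨U, hU, hUq⟩ := lagrangian_of_isotropic (IH E hE) (extM_ecm Q hm) (extB_nondeg Q hb) hfr
      (Module.nontrivial_of_finrank_pos (R := E)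
        (by rw [Module.finrank_baseChange]; exact Module.finrank_pos)) hS' hx0 hx
    let h : U → U →ₗ[E] E := fun u => (pol (extB E β) (Q.J V u)) ∘ₗ U.subtype
    obtain ⟨u, hu0, hu⟩ := Q.herm hK (U := U) (by omega) h 1 one_ne_zero (by
      intro u w
      simp only [h, LinearMap.comp_apply, Submodule.subtype_apply, one_mul, pol_apply, map_add]
      rw [← extB_conj, ← extB_conj, Q.J_J, add_comm])
    exact descend_isotropic Q (x := u) (by simpa using hu0) (hUq _ u.2) hu

end Lagrangian

section CSA

variable {F K A B : Type} [Field F] [Field K] [Algebra F K] [Ring A] [Algebra F A]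
  [Ring B] [Algebra K B] [Algebra F B] [IsScalarTower F K B] [Nontrivial B]

theorem IsCSA.eq_zero_of_sum (hA : IsCSA F A) (τ : A →ₐ[F] B) {ι : Type} {k : ι → K}
    (hk : LinearIndependent F k) (s : Finset ι) :
    ∀ a : ι → A, ∑ i ∈ s, k i • τ (a i) = 0 → ∀ i ∈ s, a i = 0 := by
  classical
  obtain ⟨hc, hs, -⟩ := hA
  induction s using Finset.induction_on with
  | empty => simp
  | insert j s hj IH =>
    intro a ha
    have hj0 : a j = 0 := by
      by_contra hne
      let I : TwoSidedIdeal A := TwoSidedIdeal.mk'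
        {x | ∃ a : ι → A, k j • τ x + ∑ i ∈ s, k i • τ (a i) = 0}
        ⟨0, by simp⟩
        (by
          rintro x y ⟨a, ha⟩ ⟨b, hb⟩
          refine ⟨a + b, ?_⟩
          simp only [map_add, smul_add, Pi.add_apply, Finset.sum_add_distrib]
          linear_combination (norm := abel) ha + hb)
        (by
          rintro x ⟨a, ha⟩
          refine ⟨-a, ?_⟩
          simp only [map_neg, smul_neg, Pi.neg_apply, Finset.sum_neg_distrib]
          linear_combination (norm := abel) -ha)
        (by
          rintro x y ⟨a, ha⟩
          refine ⟨fun i => x * a i, ?_⟩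
          have := congrArg (τ x * ·) ha
          simpa [mul_add, Finset.mul_sum] using this)
        (by
          rintro x y ⟨a, ha⟩
          refine ⟨fun i => a i * y, ?_⟩
          have := congrArg (· * τ y) ha
          simpa [add_mul, Finset.sum_mul] using this)
      have h1 : (1 : A) ∈ I := by
        refine IsSimpleRing.one_mem_of_ne_zero_mem I hne ?_
        rw [TwoSidedIdeal.mem_mk']
        exact ⟨a, by rwa [Finset.sum_insert hj] at ha⟩
      rw [TwoSidedIdeal.mem_mk'] at h1
      obtain ⟨c, hc1⟩ := h1
      have hcen : ∀ i ∈ s, ∃ f : F, algebraMap F A f = c i := by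
        intro i hi
        have : c i ∈ Subalgebra.center F A := by
          rw [Subalgebra.mem_center_iff]
          intro x
          have e1 := congrArg (τ x * ·) hc1
          have e2 := congrArg (· * τ x) hc1
          have := IH (fun i => x * c i - c i * x) (by
            simp only [map_sub, map_mul, smul_sub, Finset.sum_sub_distrib]
            simp only [map_one, mul_add, add_mul, Finset.mul_sum, Finset.sum_mul,
              mul_smul_comm, smul_mul_assoc, mul_one, one_mul, mul_zero, zero_mul] at e1 e2
            linear_combination (norm := abel) e1 - e2) i hi
          exact sub_eq_zero.1 this
        exact Algebra.mem_bot.1 (hc.out this)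
      choose! f hf using hcen
      have : (k j + ∑ i ∈ s, f i • k i) • (1 : B) = 0 := by
        rw [← hc1, add_smul, Finset.sum_smul, map_one]
        congr 1
        refine Finset.sum_congr rfl fun i hi => ?_
        rw [← hf i hi, AlgHom.commutes, smul_assoc, Algebra.algebraMap_eq_smul_one,
          smul_comm]
      have h0 : k j + ∑ i ∈ s, f i • k i = 0 := by
        rw [smul_eq_zero] at this
        exact this.resolve_right one_ne_zero
      have h2 := linearIndependent_iff'.1 hk (insert j s) (fun i => if i = j then 1 else f i) (by
        rw [Finset.sum_insert hj, if_pos rfl, one_smul, ← h0]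
        congr 1
        refine Finset.sum_congr rfl fun i hi => ?_
        rw [if_neg (fun h : i = j => hj (h ▸ hi))]) j (Finset.mem_insert_self _ _)
      simp at h2
    intro i hi
    rcases Finset.mem_insert.1 hi with rfl | hi
    · exact hj0
    · rw [Finset.sum_insert hj, hj0, map_zero, smul_zero, zero_add] at ha
      exact IH a ha i hi

omit [Algebra F K] [IsScalarTower F K B] [Nontrivial B] in
theorem ofId_commute (τ : A →ₐ[F] B) (x : K) (y : A) : Commute (Algebra.ofId K B x) (τ y) :=
  Algebra.commutes x (τ y)

/-- The `K`-linear extension of a homomorphism of algebras. -/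
noncomputable def csaLift (τ : A →ₐ[F] B) : K ⊗[F] A →ₐ[K] B :=
  Algebra.TensorProduct.lift (Algebra.ofId K B) τ
    (ofId_commute τ)

omit [Nontrivial B] in
theorem csaLift_tmul (τ : A →ₐ[F] B) (k : K) (a : A) : csaLift τ (k ⊗ₜ a) = k • τ a := by
  rw [csaLift, Algebra.TensorProduct.lift_tmul, Algebra.ofId_apply, Algebra.smul_def]

theorem exists_basis_sum (x : K ⊗[F] A) : ∃ (ι : Type) (k : ι → K) (s : Finset ι) (a : ι → A),
    LinearIndependent F k ∧ x = ∑ i ∈ s, k i ⊗ₜ a i := by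
  classical
  obtain ⟨a, rfl⟩ := (TensorProduct.equivFinsuppOfBasisLeft (N := A)
    (Basis.ofVectorSpace F K)).symm.surjective x
  exact ⟨_, _, a.support, a, (Basis.ofVectorSpace F K).linearIndependent,
    TensorProduct.equivFinsuppOfBasisLeft_symm_apply _ _⟩

theorem IsCSA.lift_injective (hA : IsCSA F A) (τ : A →ₐ[F] B) :
    Function.Injective (csaLift (K := K) τ) := by
  rw [injective_iff_map_eq_zero]
  intro x hx
  obtain ⟨ι, k, s, a, hk, rfl⟩ := exists_basis_sum x
  rw [map_sum] at hx
  simp only [csaLift_tmul] at hx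
  have := hA.eq_zero_of_sum τ hk s a hx
  exact Finset.sum_eq_zero fun i hi => by rw [this i hi, TensorProduct.tmul_zero]

theorem IsCSA.finrank_le [Module.Finite K B] (hA : IsCSA F A) (τ : A →ₐ[F] B)
    (P : Submodule F A) (Q : Submodule K B) (h : ∀ a ∈ P, τ a ∈ Q) :
    finrank F P ≤ finrank K Q := by
  rw [← Module.finrank_baseChange (R := K)]
  have h1 : Function.Injective (P.subtype.baseChange K) :=
    Module.Flat.lTensor_preserves_injective_linearMap _ P.injective_subtype
  have h2 : ∀ x, (csaLift (K := K) τ).toLinearMap (P.subtype.baseChange K x) ∈ Q := by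
    intro x
    induction x with
    | zero => simp
    | add x y hx hy => rw [map_add, map_add]; exact Q.add_mem hx hy
    | tmul k a =>
      simp only [LinearMap.baseChange_tmul, AlgHom.toLinearMap_apply, csaLift_tmul]
      exact Q.smul_mem _ (h _ a.2)
  refine LinearMap.finrank_le_finrank_of_injective
    (f := ((csaLift (K := K) τ).toLinearMap ∘ₗ P.subtype.baseChange K).codRestrict Q h2) ?_
  intro x y hxy
  exact h1 (hA.lift_injective τ (congrArg Subtype.val hxy))

/-- A dimension count turns a representation into a splitting. -/
theorem IsCSA.lift_bijective [Module.Finite K B] (hA : IsCSA F A) (τ : A →ₐ[F] B)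
    (hd : finrank F A = finrank K B) : Function.Bijective (csaLift (K := K) τ) :=
  have := hA.2.2
  ⟨hA.lift_injective τ, (LinearMap.injective_iff_surjective_of_finrank_eq_finrank
    (f := (csaLift (K := K) τ).toLinearMap)
    (by rw [Module.finrank_baseChange, hd])).1 (hA.lift_injective τ)⟩

end CSA

section Adjoint

variable {F K A V : Type} [Field F] [Field K] [Algebra F K] [Ring A] [Algebra F A]
  [AddCommGroup V] [Module K V] [Module F V] [IsScalarTower F K V] [Module.Finite K V]
  [Nontrivial V] {σ : A →ₗ[F] A} {τ : A →ₐ[F] Module.End K V}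

/-- `b` is adjoint to the involution `σ` through `τ`. -/
def IsAdj (σ : A →ₗ[F] A) (τ : A →ₐ[F] Module.End K V) (b : V →ₗ[K] V →ₗ[K] K) : Prop :=
  ∀ a v w, b (τ a v) w = b v (τ (σ a) w)

/-- The endomorphisms `τ a` span. -/
abbrev Spans (τ : A →ₐ[F] Module.End K V) : Prop := Function.Bijective (csaLift (K := K) τ)

omit [Module.Finite K V] [Nontrivial V] in
theorem Spans.induction (hτ : Spans τ) {P : Module.End K V → Prop} (X : Module.End K V)
    (h0 : P 0) (h1 : ∀ (k : K) (a : A), P (k • τ a)) (h2 : ∀ X Y, P X → P Y → P (X + Y)) : P X := by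
  obtain ⟨x, rfl⟩ := hτ.2 X
  induction x with
  | zero => simpa using h0
  | tmul k a => rw [csaLift_tmul]; exact h1 k a
  | add x y hx hy => rw [map_add]; exact h2 _ _ hx hy

omit [Module.Finite K V] [Nontrivial V] in
theorem Spans.exists_sum (hτ : Spans τ) (X : Module.End K V) :
    ∃ (ι : Type) (k : ι → K) (s : Finset ι) (a : ι → A),
      LinearIndependent F k ∧ X = ∑ i ∈ s, k i • τ (a i) := by
  obtain ⟨x, rfl⟩ := hτ.2 X
  obtain ⟨ι, k, s, a, hk, rfl⟩ := exists_basis_sum x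
  exact ⟨ι, k, s, a, hk, by simp [csaLift_tmul]⟩

/-- The transposed representation. -/
noncomputable def dualRep (hσ : IsInvolution F σ) (h1 : σ 1 = 1) (τ : A →ₐ[F] Module.End K V) :
    A →ₐ[F] Module.End K (Module.Dual K V) where
  toFun a := (τ (σ a)).dualMap
  map_one' := by ext; simp [h1]
  map_mul' a b := by ext; simp [hσ.1]
  map_zero' := by ext; simp
  map_add' a b := by ext; simp
  commutes' r := by
    ext f v
    simp [Algebra.algebraMap_eq_smul_one, h1]

theorem exists_form (hA : IsCSA F A) (hσ : IsInvolution F σ)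
    (hd : finrank F A = finrank K V * finrank K V) (τ : A →ₐ[F] Module.End K V) :
    ∃ b : V →ₗ[K] V →ₗ[K] K, (∀ v, (∀ w, b v w = 0) → v = 0) ∧ IsAdj σ τ b := by
  have h1 : σ 1 = 1 := by
    have := hσ.1 (σ 1) 1
    rw [hσ.2, mul_one, hσ.2] at this
    exact this.symm
  have b1 := hA.lift_bijective (K := K) τ (by rw [hd, Module.finrank_linearMap])
  have : Nontrivial (Module.Dual K V) := Module.nontrivial_of_finrank_pos (R := K)
    (by rw [Subspace.dual_finrank_eq]; exact Module.finrank_pos)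
  have b2 := hA.lift_bijective (K := K) (B := Module.End K (Module.Dual K V)) (dualRep hσ h1 τ)
    (by rw [hd, Module.finrank_linearMap, Subspace.dual_finrank_eq])
  let f := (AlgEquiv.ofBijective _ b1).symm.trans (AlgEquiv.ofBijective _ b2)
  obtain ⟨T, hT⟩ := f.eq_linearEquivConjAlgEquiv
  have hf : ∀ a, f (τ a) = dualRep hσ h1 τ a := by
    intro a
    have : τ a = AlgEquiv.ofBijective _ b1 (1 ⊗ₜ a) := by
      rw [AlgEquiv.coe_ofBijective, csaLift_tmul, one_smul]
    rw [AlgEquiv.trans_apply, this, AlgEquiv.symm_apply_apply, AlgEquiv.coe_ofBijective,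
      csaLift_tmul, one_smul]
  refine ⟨T.toLinearMap, ?_, ?_⟩
  · intro v hv
    apply T.injective
    ext w
    simpa using hv w
  · intro a v w
    have := hf a
    rw [hT] at this
    have := LinearMap.congr_fun (LinearMap.congr_fun this (T v)) w
    simpa [LinearEquiv.conjAlgEquiv_apply, dualRep] using this

theorem form_unique (hτ : Spans τ) {b b' : V →ₗ[K] V →ₗ[K] K}
    (nd : ∀ v, (∀ w, b v w = 0) → v = 0) (h : IsAdj σ τ b) (h' : IsAdj σ τ b') :
    ∃ κ : K, ∀ v w, b' v w = κ * b v w := by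
  have hinj : Function.Injective b := by
    rw [injective_iff_map_eq_zero]
    intro v hv
    exact nd v fun w => by rw [hv]; rfl
  have hsur := (LinearMap.injective_iff_surjective_of_finrank_eq_finrank
    (f := b) (Subspace.dual_finrank_eq (K := K) (V := V)).symm).1 hinj
  let T := LinearEquiv.ofBijective b ⟨hinj, hsur⟩
  let g : Module.End K V := T.symm.toLinearMap ∘ₗ b'
  have hg : ∀ v w, b (g v) w = b' v w := by
    intro v w
    have : b (g v) = b' v := T.apply_symm_apply (b' v)
    rw [this]
  have hcomm : ∀ X : Module.End K V, ∀ v, g (X v) = X (g v) := by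
    intro X
    induction X using hτ.induction with
    | h0 => simp
    | h1 k a =>
      intro v
      apply hinj
      ext w
      simp only [LinearMap.smul_apply, map_smul]
      rw [hg, h', h, hg]
    | h2 X Y hX hY => intro v; simp [hX, hY]
  obtain ⟨v0, hv0⟩ := exists_ne (0 : V)
  obtain ⟨φ, hφ⟩ := Module.Projective.exists_dual_ne_zero K hv0
  refine ⟨φ (g v0) / φ v0, fun v w => ?_⟩
  have := hcomm (φ.smulRight v) v0
  simp only [LinearMap.smulRight_apply, map_smul] at this
  rw [← hg]
  have h2 : g v = (φ (g v0) / φ v0) • v := by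
    rw [div_eq_inv_mul, mul_smul, ← this, smul_smul, inv_mul_cancel₀ hφ, one_smul]
  rw [h2]; simp

end Adjoint

section Adjoint2

variable {F K A V : Type} [Field F] [Field K] [Algebra F K] [Ring A] [Algebra F A]
  [AddCommGroup V] [Module K V] [Module F V] [IsScalarTower F K V]
  {σ : A →ₗ[F] A} {τ : A →ₐ[F] Module.End K V}

theorem alternating_finrank_le [Module.Finite K V] {b : V →ₗ[K] V →ₗ[K] K}
    (nd : ∀ v, (∀ w, b v w = 0) → v = 0) (h2 : (2 : K) ≠ 0) (hb : ∀ v w, b v w = - b w v)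
    (Q : Submodule K (Module.End K V)) (hQ : ∀ X ∈ Q, ∀ v w, b (X v) w = b v (X w)) :
    2 * finrank K Q ≤ finrank K V * finrank K V := by
  let e := Module.finBasis K V
  have key : ∀ X ∈ Q, ∀ v w, b v (X w) = - b w (X v) := by
    intro X hX v w
    rw [← hQ X hX, hb]
  have hdiag : ∀ X ∈ Q, ∀ v, b v (X v) = 0 := by
    intro X hX v
    have := key X hX v v
    have h3 : (2 : K) * b v (X v) = 0 := by linear_combination this
    exact (mul_eq_zero.1 h3).resolve_left h2
  have hzero : ∀ X ∈ Q, (∀ i j, i < j → b (e i) (X (e j)) = 0) → X = 0 := by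
    intro X hX h
    apply e.ext
    intro j
    apply nd
    intro w
    have : b (X (e j)) = 0 := by
      apply e.ext
      intro i
      rw [hQ X hX]
      rcases lt_trichotomy i j with hij | rfl | hij
      · rw [key X hX, h _ _ hij, neg_zero]; rfl
      · rw [hdiag X hX]; rfl
      · rw [h _ _ hij]; rfl
    rw [this]; rfl
  let f : (Q × Q) →ₗ[K] (Fin (finrank K V) × Fin (finrank K V) → K) :=
    { toFun := fun p ij => if ij.1 < ij.2 then b (e ij.1) (p.1.1 (e ij.2))
        else b (e ij.2) (p.2.1 (e ij.1))
      map_add' := by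
        intro p q; ext ij
        by_cases h : ij.1 < ij.2 <;> simp [h]
      map_smul' := by
        intro p q; ext ij
        by_cases h : ij.1 < ij.2 <;> simp [h] }
  have hf : Function.Injective f := by
    rw [injective_iff_map_eq_zero]
    rintro ⟨X, Y⟩ h
    have hX : X.1 = 0 := hzero _ X.2 fun i j hij => by
      have := congrFun h (i, j)
      simpa [f, hij] using this
    have hY : Y.1 = 0 := hzero _ Y.2 fun i j hij => by
      have := congrFun h (j, i)
      simpa [f, hij.not_gt] using this
    exact Prod.ext (Subtype.ext hX) (Subtype.ext hY)
  have := LinearMap.finrank_le_finrank_of_injective hf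
  rw [Module.finrank_prod, Module.finrank_fintype_fun_eq_card, Fintype.card_prod,
    Fintype.card_fin] at this
  omega

theorem form_symm [Module.Finite K V] [Nontrivial V] (hA : IsCSA F A) (hσ : IsInvolution F σ)
    (hτ : Spans τ)
    (hsym : 2 * finrank F (symSet F σ) = finrank K V * (finrank K V + 1))
    {b : V →ₗ[K] V →ₗ[K] K}
    (nd : ∀ v, (∀ w, b v w = 0) → v = 0) (h : IsAdj σ τ b) : ∀ v w, b v w = b w v := by
  obtain ⟨ε, hε⟩ := form_unique hτ nd h (b' := b.flip) (by
    intro a v w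
    rw [LinearMap.flip_apply, LinearMap.flip_apply, h, hσ.2])
  simp only [LinearMap.flip_apply] at hε
  obtain ⟨v0, hv0⟩ := exists_ne (0 : V)
  have : ∃ w, b v0 w ≠ 0 := by
    by_contra hc
    push Not at hc
    exact hv0 (nd _ hc)
  obtain ⟨w0, hw0⟩ := this
  have hε2 : (ε - 1) * (ε + 1) = 0 := by
    have h1 := hε v0 w0
    rw [hε w0 v0] at h1
    apply mul_right_cancel₀ hw0
    have h2 := hε w0 v0
    rw [h2] at hw0
    have h3 := hε v0 w0
    rw [h2] at h3 ⊢
    linear_combination -ε * h3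
  rcases mul_eq_zero.1 hε2 with h1 | h1
  · intro v w
    rw [hε w v, sub_eq_zero.1 h1, one_mul]
  · have hε1 : ε = -1 := by linear_combination h1
    have hb : ∀ v w, b v w = - b w v := by
      intro v w; rw [hε w v, hε1]; ring
    by_cases h2 : (2 : K) = 0
    · intro v w; rw [hb]; linear_combination (-b w v) * h2
    · exfalso
      let Q : Submodule K (Module.End K V) :=
        { carrier := {X | ∀ v w, b (X v) w = b v (X w)}
          add_mem' := by intro X Y hX hY v w; simp [hX v w, hY v w]
          zero_mem' := by intro v w; simp
          smul_mem' := by intro c X hX v w; simp [hX v w] }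
      have h3 := alternating_finrank_le nd h2 hb Q (fun X hX => hX)
      have h4 := hA.finrank_le τ (symSet F σ) Q (by
        intro a ha v w
        have : σ a = a := by
          simpa [symSet, sub_eq_zero] using ha
        rw [h, this])
      have h5 : 0 < finrank K V := Module.finrank_pos
      have h6 : finrank K V * (finrank K V + 1) ≤ finrank K V * finrank K V := by omega
      rw [mul_add] at h6
      omega

/-- Extension of linear maps along a splitting. -/
noncomputable def Spans.ext (hτ : Spans τ) {N : Type} [AddCommGroup N] [Module K N] [Module F N]
    [IsScalarTower F K N] (g : A →ₗ[F] N) : Module.End K V →ₗ[K] N :=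
  g.liftBaseChange K ∘ₗ (AlgEquiv.ofBijective _ hτ).symm.toLinearMap

theorem Spans.ext_apply (hτ : Spans τ) {N : Type} [AddCommGroup N] [Module K N] [Module F N]
    [IsScalarTower F K N] (g : A →ₗ[F] N) (a : A) : hτ.ext g (τ a) = g a := by
  have : τ a = AlgEquiv.ofBijective _ hτ (1 ⊗ₜ a) := by
    rw [AlgEquiv.coe_ofBijective, csaLift_tmul, one_smul]
  rw [this, Spans.ext, LinearMap.comp_apply, AlgEquiv.toLinearMap_apply,
    AlgEquiv.symm_apply_apply, LinearMap.liftBaseChange_tmul, one_smul]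

/-- Rank one endomorphisms attached to a bilinear form. -/
def psi (b : V →ₗ[K] V →ₗ[K] K) (v w : V) : Module.End K V := (b w).smulRight v

omit [Module F V] [IsScalarTower F K V] in
@[simp] theorem psi_apply (b : V →ₗ[K] V →ₗ[K] K) (v w x : V) : psi b v w x = b w x • v := rfl

omit [Module F V] [IsScalarTower F K V] in
theorem psi_mul_psi (b : V →ₗ[K] V →ₗ[K] K) (u v v' w : V) :
    psi b u v * psi b v' w = b v v' • psi b u w := by
  ext x; simp [smul_comm (b v v')]

end Adjoint2

section PsiForm

variable {K V N : Type} [Field K] [AddCommGroup V] [Module K V] [AddCommGroup N] [Module K N]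
  {b : V →ₗ[K] V →ₗ[K] K}

theorem psi_add_left (v v' w : V) : psi b (v + v') w = psi b v w + psi b v' w := by
  ext x; simp

theorem psi_add_right (v w w' : V) : psi b v (w + w') = psi b v w + psi b v w' := by
  ext x; simp [add_smul]

theorem psi_smul_left (c : K) (v w : V) : psi b (c • v) w = c • psi b v w := by
  ext x; simp [smul_comm c]

theorem psi_smul_right (c : K) (v w : V) : psi b v (c • w) = c • psi b v w := by
  ext x; simp [mul_smul]

/-- The bilinear map `psi`. -/
def psiB (b : V →ₗ[K] V →ₗ[K] K) : V →ₗ[K] V →ₗ[K] Module.End K V :=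
  LinearMap.mk₂ K (psi b) psi_add_left psi_smul_left psi_add_right psi_smul_right

@[simp] theorem psiB_apply (v w : V) : psiB b v w = psi b v w := rfl

theorem mul_psi (X : Module.End K V) (v w : V) : X * psi b v w = psi b (X v) w := by
  ext x; simp

/-- A pair of bases which are dual to each other. -/
def DualBases (b : V →ₗ[K] V →ₗ[K] K) {n : ℕ} (e e' : Fin n → V) : Prop :=
  (∀ y, ∑ i, b (e' i) y • e i = y) ∧ ∀ y, ∑ i, b (e i) y • e' i = y

theorem exists_dualBases [Module.Finite K V] (nd : ∀ v, (∀ w, b v w = 0) → v = 0)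
    (symm : ∀ v w, b v w = b w v) :
    ∃ e e' : Fin (finrank K V) → V, DualBases b e e' := by
  have hB : LinearMap.BilinForm.Nondegenerate (b : LinearMap.BilinForm K V) :=
    ⟨nd, fun v hv => nd v fun w => by rw [symm]; exact hv w⟩
  let e := Module.finBasis K V
  let e' := LinearMap.BilinForm.dualBasis b hB e
  have h : ∀ i j, b (e' i) (e j) = if j = i then 1 else 0 := fun i j =>
    LinearMap.BilinForm.apply_dualBasis_left hB e i j
  refine ⟨e, e', fun y => ?_, fun y => ?_⟩
  · refine Eq.trans (Finset.sum_congr rfl fun i _ => ?_) (e.sum_repr y)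
    have := congrArg (b (e' i)) (e.sum_repr y)
    simp only [map_sum, map_smul, h, smul_eq_mul, mul_ite, mul_one, mul_zero,
      Finset.sum_ite_eq', Finset.mem_univ, if_true] at this
    rw [this]
  · refine Eq.trans (Finset.sum_congr rfl fun i _ => ?_) (e'.sum_repr y)
    have := congrArg (b (e i)) (e'.sum_repr y)
    simp only [map_sum, map_smul, LinearMap.sum_apply, LinearMap.smul_apply, symm (e i), h, smul_eq_mul, mul_ite, mul_one, mul_zero,
      Finset.sum_ite_eq, Finset.mem_univ, if_true] at this
    rw [symm (e i) y, this]

variable {n : ℕ} {e e' : Fin n → V}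

theorem DualBases.eq_sum (h : DualBases b e e') (X : Module.End K V) :
    X = ∑ i, psi b (X (e i)) (e' i) := by
  ext y
  conv_lhs => rw [← h.1 y]
  simp

/-- The linear map on endomorphisms with given values on rank one endomorphisms. -/
noncomputable def psiLift (e e' : Fin n → V) (Λ : V →ₗ[K] V →ₗ[K] N) : Module.End K V →ₗ[K] N :=
  ∑ i, (Λ.flip (e' i)) ∘ₗ (LinearMap.applyₗ (e i))

theorem psiLift_apply (Λ : V →ₗ[K] V →ₗ[K] N) (X : Module.End K V) :
    psiLift e e' Λ X = ∑ i, Λ (X (e i)) (e' i) := by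
  simp [psiLift]

theorem DualBases.psiLift_psi (h : DualBases b e e') (symm : ∀ v w, b v w = b w v)
    (Λ : V →ₗ[K] V →ₗ[K] N) (v w : V) : psiLift e e' Λ (psi b v w) = Λ v w := by
  conv_rhs => rw [← h.2 w]
  simp [psiLift_apply, symm w]

/-- A linear map killing all `psi b v v` kills all self-adjoint endomorphisms. -/
theorem DualBases.apply_eq_zero (h : DualBases b e e') 
    (L : Module.End K V →ₗ[K] N) (hL : ∀ v, L (psi b v v) = 0) (X : Module.End K V)
    (symm : ∀ v w, b v w = b w v)
    (hX : ∀ v w, b (X v) w = b v (X w)) : L X = 0 := by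
  have hL2 : ∀ v w, L (psi b v w) = - L (psi b w v) := by
    intro v w
    have := hL (v + w)
    simp only [psi_add_left, psi_add_right, map_add, hL] at this
    linear_combination (norm := abel) this
  have : X = ∑ i, ∑ j, b (e j) (X (e i)) • psi b (e' j) (e' i) := by
    conv_lhs => rw [h.eq_sum X]
    refine Finset.sum_congr rfl fun i _ => ?_
    conv_lhs => rw [← h.2 (X (e i))]
    rw [← psiB_apply, map_sum, LinearMap.sum_apply]
    simp
  rw [this, ← Finset.sum_product', map_sum]
  refine Finset.sum_involution (fun p _ => (p.2, p.1)) ?_ ?_ ?_ ?_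
  · rintro ⟨i, j⟩ -
    simp only [map_smul]
    rw [← hX (e i), symm, hL2 (e' j), smul_neg]
    abel
  · rintro ⟨i, j⟩ - hne heq
    simp only [Prod.mk.injEq] at heq
    obtain ⟨rfl, -⟩ := heq
    simp [hL] at hne
  · simp
  · simp

end PsiForm

section Clifford

variable {F A : Type} [Field F] [Ring A] [Algebra F A] {T : A →ₗ[F] F} {σ : A →ₗ[F] A} {ℓ : A}

/-- The generators as a linear map. -/
noncomputable def genL (T : A →ₗ[F] F) (σ : A →ₗ[F] A) (ℓ : A) : A →ₗ[F] CliffordAlg F A T σ ℓ :=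
  (RingQuot.mkAlgHom F (CliffordRel F A T σ ℓ)).toLinearMap ∘ₗ TensorAlgebra.ι F

theorem genL_sym {s : A} (hs : σ s = s) :
    genL T σ ℓ s = algebraMap F (CliffordAlg F A T σ ℓ) (T (ℓ * s)) := by
  have := RingQuot.mkAlgHom_rel F (CliffordRel.sym (F := F) (T := T) (σ := σ) (ℓ := ℓ) s hs)
  rw [AlgHom.commutes] at this
  exact this

theorem genL_deg2 {ι : Type} (s : Finset ι) (c : ι → F) (a a' : ι → A)
    (h : ∀ x, ∑ i ∈ s, c i • (a i * σ x * a' i) = ∑ i ∈ s, c i • (a i * x * a' i)) :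
    ∑ i ∈ s, c i • (genL T σ ℓ (a i) * genL T σ ℓ (a' i)) =
      genL T σ ℓ (∑ i ∈ s, c i • (a i * ℓ * a' i)) := by
  have h1 : ∀ x, sand F A (∑ i ∈ s, c i • a i ⊗ₜ[F] a' i) x =
      ∑ i ∈ s, c i • (a i * x * a' i) := by
    intro x; simp [sand]
  have := RingQuot.mkAlgHom_rel F (CliffordRel.deg2 (F := F) (T := T) (σ := σ) (ℓ := ℓ)
    (∑ i ∈ s, c i • a i ⊗ₜ[F] a' i) (by intro x; rw [h1, h1, h]))
  rw [h1] at this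
  refine Eq.trans ?_ this
  rw [map_sum, map_sum]
  refine Finset.sum_congr rfl fun i _ => ?_
  rw [map_smul, map_smul]
  congr 1
  have : mu2 F A (a i ⊗ₜ[F] a' i) = TensorAlgebra.ι F (a i) * TensorAlgebra.ι F (a' i) := by
    simp [mu2]
  rw [this, map_mul]
  rfl

/-- The universal property of the Clifford algebra. -/
theorem exists_cliffLift {B : Type} [Ring B] [Algebra F B] (g : A →ₗ[F] B)
    (h1 : ∀ s, σ s = s → g s = algebraMap F B (T (ℓ * s)))
    (h2 : ∀ (r : ℕ) (a a' : Fin r → A),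
      (∀ x, ∑ i, a i * σ x * a' i = ∑ i, a i * x * a' i) →
      ∑ i, g (a i) * g (a' i) = g (∑ i, a i * ℓ * a' i)) :
    ∃ ρ : CliffordAlg F A T σ ℓ →ₐ[F] B, ∀ a, ρ (genL T σ ℓ a) = g a := by
  have hrel : ∀ ⦃x y⦄, CliffordRel F A T σ ℓ x y →
      TensorAlgebra.lift F g x = TensorAlgebra.lift F g y := by
    rintro x y (⟨s, hs⟩ | ⟨z, hz⟩)
    · rw [TensorAlgebra.lift_ι_apply, h1 s hs, AlgHom.commutes]
    · obtain ⟨S, rfl⟩ := TensorProduct.exists_finset z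
      have key : ∃ (r : ℕ) (a a' : Fin r → A), ∑ p ∈ S, p.1 ⊗ₜ[F] p.2 = ∑ i, a i ⊗ₜ[F] a' i := by
        let E := S.equivFin
        refine ⟨S.card, fun i => (E.symm i).1.1, fun i => (E.symm i).1.2, ?_⟩
        rw [← Finset.sum_coe_sort S]
        exact (Equiv.sum_comp E.symm (fun p : S => p.1.1 ⊗ₜ[F] p.1.2)).symm
      obtain ⟨r, a, a', hr⟩ := key
      rw [hr] at hz ⊢
      have h3 : ∀ x, sand F A (∑ i, a i ⊗ₜ[F] a' i) x = ∑ i, a i * x * a' i := by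
        intro x; simp [sand]
      rw [h3, TensorAlgebra.lift_ι_apply, ← h2 r a a' (by intro x; rw [← h3, ← h3, hz])]
      simp [mu2]
  refine ⟨RingQuot.liftAlgHom F ⟨TensorAlgebra.lift F g, hrel⟩, fun a => ?_⟩
  exact (RingQuot.liftAlgHom_mkAlgHom_apply F _ hrel _).trans (TensorAlgebra.lift_ι_apply _ _)

end Clifford

section Split

variable {F K N : Type} [Field F] [Field K] [Algebra F K] [AddCommGroup N] [Module K N]
  [Module F N] [IsScalarTower F K N]

theorem exists_coeffs {ι : Type} (s : Finset ι) (k : ι → K) :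
    ∃ (κ : Type) (B : κ → K) (P : Finset κ) (c : κ → ι → F), LinearIndependent F B ∧
      ∀ i ∈ s, k i = ∑ p ∈ P, c p i • B p := by
  classical
  let B := Basis.ofVectorSpace F K
  refine ⟨_, B, s.biUnion fun i => (B.repr (k i)).support, fun p i => B.repr (k i) p,
    B.linearIndependent, fun i hi => ?_⟩
  conv_lhs => rw [← B.linearCombination_repr (k i)]
  rw [Finsupp.linearCombination_apply, Finsupp.sum]
  refine Finset.sum_subset (Finset.subset_biUnion_of_mem (fun i => (B.repr (k i)).support) hi) ?_
  intro p _ hp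
  rw [Finsupp.notMem_support_iff.1 hp, zero_smul]

theorem sum_coeffs {ι κ : Type} {s : Finset ι} {k : ι → K} {P : Finset κ} {B : κ → K}
    {c : κ → ι → F} (h : ∀ i ∈ s, k i = ∑ p ∈ P, c p i • B p) (φ : ι → N) :
    ∑ i ∈ s, k i • φ i = ∑ p ∈ P, B p • ∑ i ∈ s, c p i • φ i := by
  simp only [Finset.smul_sum]
  rw [Finset.sum_comm]
  refine Finset.sum_congr rfl fun i hi => ?_
  rw [h i hi, Finset.sum_smul]
  refine Finset.sum_congr rfl fun p _ => ?_
  rw [smul_assoc, smul_comm]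

end Split

section QS

variable {F K A V S : Type} [Field F] [Field K] [Algebra F K] [Ring A] [Algebra F A]
  [AddCommGroup V] [Module K V] [Module F V] [IsScalarTower F K V] [Module.Finite K V]
  [Nontrivial V] {T : A →ₗ[F] F} {σ : A →ₗ[F] A} {ℓ : A} {τ : A →ₐ[F] Module.End K V}
  {b : V →ₗ[K] V →ₗ[K] K} {κ : K}

/-- The reduced trace with values in an extension field. -/
noncomputable def trK (K : Type) [Field K] [Algebra F K] (T : A →ₗ[F] F) : A →ₗ[F] K :=
  Algebra.linearMap F K ∘ₗ T

/-- The form `b` is a symmetric form adjoint to `σ`, and `κ` compares the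
linear form `T` to the trace. -/
structure QS (T : A →ₗ[F] F) (σ : A →ₗ[F] A) (τ : A →ₐ[F] Module.End K V)
    (b : V →ₗ[K] V →ₗ[K] K) (κ : K) : Prop where
  symm : ∀ v w, b v w = b w v
  nd : ∀ v, (∀ w, b v w = 0) → v = 0
  adj : IsAdj σ τ b
  spans : Spans τ
  tr : ∀ v w, spans.ext (trK K T) (psi b v w) = κ * b v w

theorem IsReducedTrace.mul_comm (hT : IsReducedTrace F A T) (x y : A) : T (x * y) = T (y * x) := by
  obtain ⟨E, _, _, n, e, he⟩ := hT
  apply (algebraMap F E).injective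
  have h : ∀ x y : A, (1 : E) ⊗ₜ[F] (x * y) = (1 ⊗ₜ x) * (1 ⊗ₜ y) := by
    intro x y; rw [Algebra.TensorProduct.tmul_mul_tmul, one_mul]
  rw [he, he, h, h, map_mul, map_mul, Matrix.trace_mul_comm]

theorem IsReducedTrace.ne_zero (hA : IsCSA F A) (hT : IsReducedTrace F A T) : T ≠ 0 := by
  obtain ⟨E, _, _, n, e, he⟩ := hT
  have := hA.2.1
  rintro rfl
  have h0 : ∀ x, Matrix.trace (e x) = 0 := by
    intro x
    induction x with
    | zero => simp
    | tmul k a =>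
      have : k ⊗ₜ[F] a = k • ((1 : E) ⊗ₜ[F] a) := by
        rw [TensorProduct.smul_tmul', smul_eq_mul, mul_one]
      rw [this, map_smul, Matrix.trace_smul, ← he]
      simp
    | add x y hx hy => rw [map_add, Matrix.trace_add, hx, hy, add_zero]
  rcases Nat.eq_zero_or_pos n with rfl | hn
  · have : Subsingleton (E ⊗[F] A) := e.toEquiv.subsingleton
    exact not_subsingleton _ this
  · have := h0 (e.symm (Matrix.single ⟨0, hn⟩ ⟨0, hn⟩ 1))
    rw [AlgEquiv.apply_symm_apply, Matrix.trace_single_eq_same] at this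
    exact one_ne_zero this

omit [Module.Finite K V] [Nontrivial V] in
theorem psi_mul_adj (hσ : IsInvolution F σ) (h : IsAdj σ τ b) (v w : V) (a : A) :
    psi b v w * τ a = psi b v (τ (σ a) w) := by
  ext x
  have := h (σ a) w x
  rw [hσ.2] at this
  simp [this]

theorem exists_QS (hA : IsCSA F A) (hT : IsReducedTrace F A T)
    (hσ : IsInvolution F σ) (hd : finrank F A = finrank K V * finrank K V)
    (hsym : 2 * finrank F (symSet F σ) = finrank K V * (finrank K V + 1))
    (τ : A →ₐ[F] Module.End K V) : ∃ b κ, κ ≠ 0 ∧ QS T σ τ b κ := by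
  have hs : Spans τ := hA.lift_bijective τ (by rw [hd, Module.finrank_linearMap])
  obtain ⟨b, nd, adj⟩ := exists_form (K := K) hA hσ hd τ
  have symm := form_symm hA hσ hs hsym nd adj
  have tc : ∀ a X, hs.ext (trK K T) (τ a * X) = hs.ext (trK K T) (X * τ a) := by
    intro a X
    induction X using hs.induction with
    | h0 => simp
    | h1 k x =>
      rw [mul_smul_comm, smul_mul_assoc, ← map_mul, ← map_mul, map_smul, map_smul,
        hs.ext_apply, hs.ext_apply, trK, LinearMap.comp_apply, LinearMap.comp_apply, hT.mul_comm]
    | h2 X Y hX hY => rw [mul_add, add_mul, map_add, map_add, hX, hY]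
  obtain ⟨κ, hκ⟩ := form_unique hs nd adj (b' := (psiB b).compr₂ (hs.ext (trK K T))) (by
    intro a v w
    simp only [LinearMap.compr₂_apply, psiB_apply]
    rw [← mul_psi, tc, psi_mul_adj hσ adj])
  refine ⟨b, κ, ?_, symm, nd, adj, hs, hκ⟩
  rintro rfl
  apply hT.ne_zero hA
  obtain ⟨e, e', he⟩ := exists_dualBases nd symm
  ext a
  apply (algebraMap F K).injective
  have h1 : hs.ext (trK K T) (τ a) = algebraMap F K (T a) := hs.ext_apply _ _
  rw [← h1, he.eq_sum (τ a), map_sum]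
  simp only [LinearMap.compr₂_apply, psiB_apply, zero_mul] at hκ
  simp [hκ]

/-- The bilinear form polarizing to `b`. -/
noncomputable def beta (τ : A →ₐ[F] Module.End K V) (b : V →ₗ[K] V →ₗ[K] K) (ℓ : A) :
    V →ₗ[K] V →ₗ[K] K := b.compl₂ (τ ℓ)

omit [Module.Finite K V] [Nontrivial V] in
@[simp] theorem beta_apply (v w : V) : beta τ b ℓ v w = b v (τ ℓ w) := rfl

omit [Module.Finite K V] [Nontrivial V] in
theorem QS.pol_beta (h : QS T σ τ b κ) (hℓ : ℓ + σ ℓ = 1) : pol (beta τ b ℓ) = b := by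
  ext v w
  rw [pol_apply, beta_apply, beta_apply, h.symm w, h.adj, ← map_add, ← LinearMap.add_apply,
    ← map_add, hℓ, map_one, Module.End.one_apply]

omit [Module.Finite K V] [Nontrivial V] in
theorem QS.nondeg (h : QS T σ τ b κ) (hℓ : ℓ + σ ℓ = 1) : Nondeg (beta τ b ℓ) := by
  intro v hv
  rw [h.pol_beta hℓ] at hv
  exact h.nd v hv

variable [AddCommGroup S] [Module K S] [Module F S] [IsScalarTower F K S]

omit [Module.Finite K V] [Nontrivial V] in
theorem QS.ext_self_adjoint (hA : IsCSA F A) [Nontrivial V] (h : QS T σ τ b κ)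
    (ρ : CliffordAlg F A T σ ℓ →ₐ[F] Module.End K S)
    (X : Module.End K V) (hX : ∀ v w, b (X v) w = b v (X w)) :
    h.spans.ext (ρ.toLinearMap ∘ₗ genL T σ ℓ) X = h.spans.ext (trK K T) (τ ℓ * X) • 1 := by
  obtain ⟨ι, k, s, a, hk, rfl⟩ := h.spans.exists_sum X
  have h0 : ∑ i ∈ s, k i • τ (σ (a i) - a i) = 0 := by
    ext v
    rw [LinearMap.zero_apply]
    refine h.nd _ fun w => ?_
    rw [h.symm]
    have := hX w v
    simp only [LinearMap.sum_apply, LinearMap.smul_apply, map_sum, map_smul, smul_eq_mul] at this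
    simp only [LinearMap.sum_apply, LinearMap.smul_apply, map_sum, map_smul, smul_eq_mul, map_sub,
      LinearMap.sub_apply, mul_sub, Finset.sum_sub_distrib, ← this]
    simp [h.adj _ w]
  have h1 := hA.eq_zero_of_sum τ hk s _ h0
  simp only [map_sum, map_smul, Finset.mul_sum, mul_smul_comm, ← map_mul, h.spans.ext_apply]
  rw [Finset.sum_smul]
  refine Finset.sum_congr rfl fun i hi => ?_
  rw [LinearMap.comp_apply, genL_sym (sub_eq_zero.1 (h1 i hi)), smul_assoc]
  congr 1
  simp [trK, Algebra.algebraMap_eq_smul_one]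

omit [Module.Finite K V] in
theorem QS.ext_mul (hA : IsCSA F A) (h : QS T σ τ b κ)
    (ρ : CliffordAlg F A T σ ℓ →ₐ[F] Module.End K S) (u v w : V) :
    h.spans.ext (ρ.toLinearMap ∘ₗ genL T σ ℓ) (psi b u v) *
      h.spans.ext (ρ.toLinearMap ∘ₗ genL T σ ℓ) (psi b v w) =
    beta τ b ℓ v v • h.spans.ext (ρ.toLinearMap ∘ₗ genL T σ ℓ) (psi b u w) := by
  obtain ⟨ι, k, s, a, -, ha⟩ := h.spans.exists_sum (psi b u v)
  obtain ⟨ι', k', s', a', -, ha'⟩ := h.spans.exists_sum (psi b v w)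
  obtain ⟨ν, B, P, c, hB, hc⟩ := exists_coeffs (F := F) (s ×ˢ s') (fun i => k i.1 * k' i.2)
  have hZ : ∀ Z : Module.End K V, psi b u v * Z * psi b v w =
      ∑ i ∈ s ×ˢ s', (k i.1 * k' i.2) • (τ (a i.1) * Z * τ (a' i.2)) := by
    intro Z
    rw [ha, ha', Finset.sum_mul, Finset.sum_mul_sum, Finset.sum_product]
    simp only [smul_mul_assoc, mul_smul_comm, smul_smul]
    refine Finset.sum_congr rfl fun i _ => Finset.sum_congr rfl fun j _ => ?_
    rw [mul_comm]
  have hsym : ∀ x, psi b u v * τ (σ x) * psi b v w = psi b u v * τ x * psi b v w := by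
    intro x
    ext y
    simp only [Module.End.mul_apply, psi_apply, map_smul]
    rw [← h.adj, h.symm (τ x v)]
  have hzero : ∀ x, ∀ p ∈ P, ∑ i ∈ s ×ˢ s', c p i • (a i.1 * (σ x - x) * a' i.2) = 0 := by
    intro x
    apply hA.eq_zero_of_sum τ hB P
    have h1 := hZ (τ (σ x) - τ x)
    rw [mul_sub, sub_mul, hsym, sub_self, sum_coeffs hc] at h1
    rw [h1]
    refine Finset.sum_congr rfl fun p _ => ?_
    simp only [map_sum, map_smul, map_mul, map_sub]
  have hγ : ∀ p ∈ P, ∑ i ∈ s ×ˢ s', c p i • (genL T σ ℓ (a i.1) * genL T σ ℓ (a' i.2)) =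
      genL T σ ℓ (∑ i ∈ s ×ˢ s', c p i • (a i.1 * ℓ * a' i.2)) := by
    intro p hp
    refine genL_deg2 _ _ _ _ fun x => ?_
    have := hzero x p hp
    simp only [mul_sub, sub_mul, smul_sub, Finset.sum_sub_distrib] at this
    exact sub_eq_zero.1 this
  have hl : psi b u v * τ ℓ * psi b v w = beta τ b ℓ v v • psi b u w := by
    ext y
    simp only [Module.End.mul_apply, psi_apply, map_smul, LinearMap.smul_apply, beta_apply]
    rw [smul_comm]
  rw [← map_smul, ← hl, hZ, sum_coeffs hc]
  have e1 : ∑ p ∈ P, B p • ∑ i ∈ s ×ˢ s', c p i • (τ (a i.1) * τ ℓ * τ (a' i.2)) =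
      ∑ p ∈ P, B p • τ (∑ i ∈ s ×ˢ s', c p i • (a i.1 * ℓ * a' i.2)) := by
    refine Finset.sum_congr rfl fun p _ => ?_
    simp only [map_sum, map_smul, map_mul]
  rw [e1, ha, ha']
  simp only [map_sum, map_smul, h.spans.ext_apply]
  rw [Finset.sum_mul_sum, ← Finset.sum_product']
  trans ∑ i ∈ s ×ˢ s', (k i.1 * k' i.2) • (ρ (genL T σ ℓ (a i.1)) * ρ (genL T σ ℓ (a' i.2)))
  · refine Finset.sum_congr rfl fun i _ => ?_
    simp only [smul_mul_assoc, mul_smul_comm, smul_smul]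
    rw [mul_comm (k' i.2)]
    rfl
  rw [sum_coeffs hc]
  refine Finset.sum_congr rfl fun p hp => ?_
  congr 1
  have := congrArg ρ (hγ p hp)
  simp only [map_sum, map_smul, map_mul] at this
  rw [this]
  refine Finset.sum_congr rfl fun i _ => ?_
  rw [← map_smul τ, h.spans.ext_apply, map_smul]
  rfl

end QS

section Forward

variable {F K A V S : Type} [Field F] [Field K] [Algebra F K] [Ring A] [Algebra F A]
  [AddCommGroup V] [Module K V] [Module F V] [IsScalarTower F K V] [Nontrivial V]
  {T : A →ₗ[F] F} {σ : A →ₗ[F] A} {ℓ : A} {τ : A →ₐ[F] Module.End K V}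
  {b : V →ₗ[K] V →ₗ[K] K} {κ : K}
  [AddCommGroup S] [Module K S] [Module F S] [IsScalarTower F K S]

/-- The bilinear map attached to a representation of the Clifford algebra. -/
noncomputable def QS.fwd (h : QS T σ τ b κ) (ρ : CliffordAlg F A T σ ℓ →ₐ[F] Module.End K S) :
    V →ₗ[K] V →ₗ[K] Module.End K S :=
  (psiB b).compr₂ (h.spans.ext (ρ.toLinearMap ∘ₗ genL T σ ℓ))

omit [Nontrivial V] in
theorem QS.fwd_apply (h : QS T σ τ b κ) (ρ : CliffordAlg F A T σ ℓ →ₐ[F] Module.End K S)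
    (v w : V) : h.fwd ρ v w = h.spans.ext (ρ.toLinearMap ∘ₗ genL T σ ℓ) (psi b v w) := rfl

theorem QS.fwd_self (hA : IsCSA F A) (h : QS T σ τ b κ)
    (ρ : CliffordAlg F A T σ ℓ →ₐ[F] Module.End K S) (v : V) :
    h.fwd ρ v v = (κ * beta τ b ℓ v v) • 1 := by
  rw [h.fwd_apply, h.ext_self_adjoint hA ρ _ (fun x y => by simp [h.symm x, mul_comm]), mul_psi,
    h.tr, h.symm, beta_apply]

theorem QS.eq_one (hA : IsCSA F A) (h : QS T σ τ b κ) (hℓ : ℓ + σ ℓ = 1) (hκ : κ ≠ 0)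
    [Nontrivial S] (ρ : CliffordAlg F A T σ ℓ →ₐ[F] Module.End K S) : κ = 1 := by
  obtain ⟨v, hv⟩ := (h.nondeg hℓ).exists_anisotropic
  obtain ⟨s, hs⟩ := exists_ne (0 : S)
  have h1 : h.fwd ρ v v * h.fwd ρ v v = beta τ b ℓ v v • h.fwd ρ v v := h.ext_mul hA ρ v v v
  rw [h.fwd_self hA] at h1
  have h2 := LinearMap.congr_fun h1 s
  simp only [Module.End.mul_apply, LinearMap.smul_apply, Module.End.one_apply, smul_smul] at h2
  have h3 := smul_left_injective K hs h2
  have h4 : κ * beta τ b ℓ v v * beta τ b ℓ v v * (κ - 1) = 0 := by linear_combination h3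
  have h5 := (mul_eq_zero.1 h4).resolve_left (mul_ne_zero (mul_ne_zero hκ hv) hv)
  exact sub_eq_zero.1 h5

theorem QS.fwd_isECM (hA : IsCSA F A) (h : QS T σ τ b 1)
    (ρ : CliffordAlg F A T σ ℓ →ₐ[F] Module.End K S) : IsECM (beta τ b ℓ) (h.fwd ρ) :=
  ⟨fun v => by rw [h.fwd_self hA, one_mul], fun u v w => h.ext_mul hA ρ u v w⟩

omit [Nontrivial V] in
/-- Semilinear maps commuting with the Clifford algebra. -/
theorem QS.fwd_semilinear (h : QS T σ τ b κ) (ρ : CliffordAlg F A T σ ℓ →ₐ[F] Module.End K S)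
    (cj : K → K) (Φ : S →ₗ[F] S) (hΦ : ∀ (k : K) s, Φ (k • s) = cj k • Φ s)
    (hρ : ∀ c s, Φ (ρ c s) = ρ c (Φ s)) (J : V →ₗ[F] V) (hJs : Function.Surjective J)
    (hJ : ∀ (k : K) v, J (k • v) = cj k • J v) (hJA : ∀ a v, J (τ a v) = τ a (J v))
    (κ0 : K) (hκ0 : κ0 ≠ 0) (hb : ∀ v w, b (J v) (J w) = κ0 * cj (b v w)) (v w : V) (s : S) :
    Φ (h.fwd ρ v w s) = κ0⁻¹ • h.fwd ρ (J v) (J w) (Φ s) := by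
  obtain ⟨ι, k, t, a, -, ha⟩ := h.spans.exists_sum (psi b v w)
  have h1 : ∑ i ∈ t, cj (k i) • τ (a i) = κ0⁻¹ • psi b (J v) (J w) := by
    ext y
    obtain ⟨x, rfl⟩ := hJs y
    have := congrArg J (LinearMap.congr_fun ha x)
    rw [psi_apply, hJ] at this
    simp only [LinearMap.sum_apply, LinearMap.smul_apply, map_sum, hJ, hJA] at this
    rw [LinearMap.smul_apply, psi_apply, hb, mul_smul, smul_smul, inv_mul_cancel₀ hκ0, one_smul,
      this]
    simp
  rw [h.fwd_apply, h.fwd_apply, ← LinearMap.smul_apply, ← map_smul, ← h1, ha]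
  simp only [map_sum, map_smul, LinearMap.sum_apply, LinearMap.smul_apply, h.spans.ext_apply, hΦ]
  refine Finset.sum_congr rfl fun i _ => ?_
  congr 1
  exact hρ _ _

omit [Nontrivial V] in
theorem QS.fwd_comm (h : QS T σ τ b κ) (ρ : CliffordAlg F A T σ ℓ →ₐ[F] Module.End K S)
    (Φ : S →ₗ[F] S) (hΦ : ∀ (k : K) s, Φ (k • s) = k • Φ s)
    (hρ : ∀ c s, Φ (ρ c s) = ρ c (Φ s)) (v w : V) (s : S) :
    Φ (h.fwd ρ v w s) = h.fwd ρ v w (Φ s) := by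
  have := h.fwd_semilinear ρ id Φ hΦ hρ LinearMap.id (fun x => ⟨x, rfl⟩) (by simp) (by simp) 1
    one_ne_zero (by simp) v w s
  simpa using this

end Forward

section Backward

variable {F K A V S : Type} [Field F] [Field K] [Algebra F K] [Ring A] [Algebra F A]
  [AddCommGroup V] [Module K V] [Module F V] [IsScalarTower F K V] 
  {T : A →ₗ[F] F} {σ : A →ₗ[F] A} {ℓ : A} {τ : A →ₐ[F] Module.End K V}
  {b : V →ₗ[K] V →ₗ[K] K} {κ : K}
  [AddCommGroup S] [Module K S] [Module F S] [IsScalarTower F K S]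
  {n : ℕ} {e e' : Fin n → V} {m : V →ₗ[K] V →ₗ[K] Module.End K S}

theorem QS.sandwich_psi (h : QS T σ τ b κ) {r : ℕ} (a a' : Fin r → A)
    (hz : ∀ x, ∑ i, a i * σ x * a' i = ∑ i, a i * x * a' i) (p q : V) :
    ∑ i, τ (a i) * psi b p q * τ (a' i) = ∑ i, τ (a i) * psi b q p * τ (a' i) := by
  have h1 : ∀ (X : Module.End K V) v w,
      b (h.spans.ext (τ.toLinearMap ∘ₗ σ) X v) w = b v (X w) := by
    intro X v w
    induction X using h.spans.induction with
    | h0 => simp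
    | h1 k x =>
      rw [map_smul, h.spans.ext_apply]
      simp only [LinearMap.smul_apply, map_smul, LinearMap.comp_apply, AlgHom.toLinearMap_apply]
      rw [h.symm _ w, ← h.adj, h.symm]
    | h2 X Y hX hY => simp [hX, hY]
  have h2 : h.spans.ext (τ.toLinearMap ∘ₗ σ) (psi b p q) = psi b q p := by
    ext v
    rw [← sub_eq_zero]
    refine h.nd _ fun w => ?_
    rw [map_sub, LinearMap.sub_apply, h1]
    simp [h.symm v, mul_comm]
  have h3 : ∀ X : Module.End K V, ∑ i, τ (a i) * h.spans.ext (τ.toLinearMap ∘ₗ σ) X * τ (a' i) =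
      ∑ i, τ (a i) * X * τ (a' i) := by
    intro X
    induction X using h.spans.induction with
    | h0 => simp
    | h1 k x =>
      rw [map_smul, h.spans.ext_apply]
      have := congrArg (fun y => k • τ y) (hz x)
      simpa [Finset.smul_sum] using this
    | h2 X Y hX hY => simp only [map_add, mul_add, add_mul, Finset.sum_add_distrib, hX, hY]
  rw [← h2, h3]

theorem QS.exists_back (hσ : IsInvolution F σ) (h : QS T σ τ b 1) (he : DualBases b e e')
    (hm : IsECM (beta τ b ℓ) m) :
    ∃ ρ : CliffordAlg F A T σ ℓ →ₐ[F] Module.End K S,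
      ∀ a, ρ (genL T σ ℓ a) = psiLift e e' m (τ a) := by
  have hG : ∀ p q, psiLift e e' m (psi b p q) = m p q := he.psiLift_psi h.symm m
  refine exists_cliffLift ((psiLift e e' m).restrictScalars F ∘ₗ τ.toLinearMap) ?_ ?_
  · intro s hs
    have := he.apply_eq_zero (psiLift e e' m -
      ((h.spans.ext (trK K T)) ∘ₗ LinearMap.mulLeft K (τ ℓ)).smulRight 1) (fun v => by
        simp only [LinearMap.sub_apply, LinearMap.smulRight_apply, LinearMap.comp_apply,
          LinearMap.mulLeft_apply]
        rw [hG, mul_psi, h.tr, hm.1, beta_apply, h.symm, one_mul, sub_self]) (τ s) h.symm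
      (fun v w => by rw [h.adj, hs])
    simp only [LinearMap.sub_apply, LinearMap.smulRight_apply, LinearMap.comp_apply,
          LinearMap.mulLeft_apply] at this
    rw [← map_mul, h.spans.ext_apply] at this
    refine (sub_eq_zero.1 this).trans ?_
    simp [trK, Algebra.algebraMap_eq_smul_one]
  · intro r a a' hz
    have e1 : ∀ x : A, τ x = ∑ i, psi b (e i) (τ (σ x) (e' i)) := by
      intro x
      conv_lhs => rw [← one_mul (τ x), he.eq_sum 1, Finset.sum_mul]
      refine Finset.sum_congr rfl fun i _ => ?_
      rw [psi_mul_adj hσ h.adj, Module.End.one_apply]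
    have g1 : ∀ x : A, psiLift e e' m (τ x) = ∑ i, m (e i) (τ (σ x) (e' i)) := by
      intro x
      conv_lhs => rw [e1 x, map_sum]
      simp only [hG]
    have g2 : ∀ x y : A, psiLift e e' m (τ (x * ℓ * y)) =
        ∑ i, ∑ j, beta τ b ℓ (τ (σ x) (e' i)) (τ y (e j)) • m (e i) (e' j) := by
      intro x y
      have : τ (x * ℓ * y) = ∑ i, ∑ j,
          beta τ b ℓ (τ (σ x) (e' i)) (τ y (e j)) • psi b (e i) (e' j) := by
        conv_lhs => rw [map_mul, map_mul, e1 x, he.eq_sum (τ y), Finset.sum_mul, Finset.sum_mul_sum]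
        refine Finset.sum_congr rfl fun i _ => Finset.sum_congr rfl fun j _ => ?_
        rw [mul_assoc, mul_psi, psi_mul_psi, beta_apply]
      rw [this]
      simp only [map_sum, map_smul, hG]
    simp only [LinearMap.comp_apply, AlgHom.toLinearMap_apply, LinearMap.restrictScalars_apply]
    rw [map_sum, map_sum, ← sub_eq_zero, ← Finset.sum_sub_distrib]
    simp only [g2]
    have g3 : ∀ x y : A, psiLift e e' m (τ x) * psiLift e e' m (τ y) =
        ∑ i, ∑ j, m (e i) (τ (σ x) (e' i)) * m (τ y (e j)) (e' j) := by
      intro x y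
      rw [g1, psiLift_apply, Finset.sum_mul_sum]
    simp only [g3, ← Finset.sum_sub_distrib]
    rw [Finset.sum_comm]
    refine Finset.sum_eq_zero fun i _ => ?_
    rw [Finset.sum_comm]
    refine Finset.sum_eq_zero fun j _ => ?_
    let Λ : V →ₗ[K] V →ₗ[K] Module.End K S :=
      (LinearMap.mul K (Module.End K S)).compl₁₂ (m (e i)) (m.flip (e' j)) -
        (beta τ b ℓ).compr₂ (LinearMap.toSpanSingleton K _ (m (e i) (e' j)))
    have hΛ : ∀ v w, Λ v w = m (e i) v * m w (e' j) - beta τ b ℓ v w • m (e i) (e' j) := by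
      intro v w; rfl
    have := he.apply_eq_zero (psiLift e e' Λ) (fun v => by
      rw [he.psiLift_psi h.symm, hΛ, hm.2, sub_self])
      (∑ k, psi b (τ (σ (a k)) (e' i)) (τ (a' k) (e j))) h.symm ?_
    · rw [map_sum] at this
      simpa only [he.psiLift_psi h.symm, hΛ] using this
    · have key : ∀ x y, b ((∑ k, psi b (τ (σ (a k)) (e' i)) (τ (a' k) (e j))) x) y =
          b (e' i) ((∑ k, τ (a k) * psi b y x * τ (a' k)) (e j)) := by
        intro x y
        simp only [LinearMap.sum_apply, map_sum, psi_apply, map_smul, LinearMap.smul_apply,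
          Module.End.mul_apply, h.adj (σ _), hσ.2, h.symm x]
      intro x y
      rw [key, h.symm x, key, h.sandwich_psi _ _ hz]

omit [Algebra F K] [IsScalarTower F K V] [IsScalarTower F K S] in
theorem DualBases.psiLift_semilinear (he : DualBases b e e') (symm : ∀ v w, b v w = b w v)
    (cj : K → K) (Φ : S →ₗ[F] S) (J : V →ₗ[F] V) (hJs : Function.Surjective J)
    (hJ : ∀ (k : K) v, J (k • v) = cj k • J v)
    (κ0 : K) (hκ0 : κ0 ≠ 0) (hb : ∀ v w, b (J v) (J w) = κ0 * cj (b v w))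
    (hΦ : ∀ v w s, Φ (m v w s) = κ0⁻¹ • m (J v) (J w) (Φ s))
    (X : Module.End K V) (hX : ∀ v, J (X v) = X (J v)) (s : S) :
    Φ (psiLift e e' m X s) = psiLift e e' m X (Φ s) := by
  have h1 : X = κ0⁻¹ • ∑ i, psi b (X (J (e i))) (J (e' i)) := by
    ext y
    obtain ⟨x, rfl⟩ := hJs y
    have := congrArg (fun z => X (J z)) (he.1 x)
    simp only [map_sum, hJ, map_smul] at this
    simp only [LinearMap.smul_apply, LinearMap.sum_apply, psi_apply, hb, mul_smul,
      ← Finset.smul_sum, this, inv_smul_smul₀ hκ0]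
  conv_rhs => rw [h1]
  rw [psiLift_apply]
  simp only [LinearMap.sum_apply, map_sum, map_smul, LinearMap.smul_apply, he.psiLift_psi symm,
    hΦ, hX, Finset.smul_sum]

end Backward

section Spin

theorem isotropic_of_isAlgClosed {K V : Type} [Field K] [IsAlgClosed K] [AddCommGroup V] [Module K V]
    [Module.Finite K V] (β : V →ₗ[K] V →ₗ[K] K) (hV : 2 ≤ finrank K V) :
    ∃ e, e ≠ 0 ∧ β e e = 0 := by
  have : Nontrivial V := Module.nontrivial_of_finrank_pos (R := K) (by omega)
  obtain ⟨e, he⟩ := exists_ne (0 : V)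
  by_cases hq : β e e = 0
  · exact ⟨e, he, hq⟩
  obtain ⟨f, hf⟩ : ∃ f, f ∉ K ∙ e := by
    by_contra! H
    have h1 : (K ∙ e) = ⊤ := eq_top_iff.2 fun x _ => H x
    have := finrank_span_singleton (K := K) he
    rw [h1, finrank_top] at this
    omega
  obtain ⟨x, hx⟩ := IsAlgClosed.exists_root
    (Polynomial.C (β e e) * Polynomial.X ^ 2 + Polynomial.C (β e f + β f e) * Polynomial.X +
      Polynomial.C (β f f)) (by rw [Polynomial.degree_quadratic hq]; decide)
  refine ⟨f + x • e, ?_, ?_⟩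
  · intro h
    apply hf
    rw [eq_neg_of_add_eq_zero_left h]
    exact Submodule.neg_mem _ (Submodule.smul_mem _ _ (Submodule.mem_span_singleton_self e))
  · simp only [Polynomial.IsRoot.def, Polynomial.eval_add, Polynomial.eval_mul, Polynomial.eval_C,
      Polynomial.eval_pow, Polynomial.eval_X] at hx
    simp only [map_add, map_smul, LinearMap.add_apply, LinearMap.smul_apply, smul_eq_mul]
    linear_combination hx

theorem exists_spin (K : Type) [Field K] [IsAlgClosed K] (n : ℕ) :
    ∀ (V : Type) [AddCommGroup V] [Module K V] [Module.Finite K V] (β : V →ₗ[K] V →ₗ[K] K),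
    Nondeg β → finrank K V = 2 * n →
    ∃ (S0 S1 : Type) (_ : AddCommGroup S0) (_ : Module K S0) (_ : AddCommGroup S1) (_ : Module K S1)
      (p : V →ₗ[K] S0 →ₗ[K] S1) (r : V →ₗ[K] S1 →ₗ[K] S0), Module.Finite K S0 ∧
      Module.Finite K S1 ∧ finrank K S0 + finrank K S1 = 2 ^ n ∧
      (1 ≤ n → finrank K S0 = finrank K S1) ∧
      (∀ v x, r v (p v x) = β v v • x) ∧ ∀ v x, p v (r v x) = β v v • x := by
  induction n with
  | zero =>
    intro V _ _ _ β _ hV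
    have : Subsingleton V := Module.finrank_zero_iff.1 hV
    refine ⟨K, PUnit, inferInstance, inferInstance, inferInstance, inferInstance, 0, 0,
      inferInstance, inferInstance, by simp [Module.finrank_zero_of_subsingleton], by simp, ?_, fun _ _ => Subsingleton.elim _ _⟩
    intro v x
    rw [Subsingleton.elim v 0]; simp
  | succ n IH =>
    intro V _ _ _ β hb hV
    obtain ⟨e, he0, he⟩ := isotropic_of_isAlgClosed β (by omega)
    obtain ⟨f, hef, hf⟩ := hb.exists_hyperbolic he0 he
    have hWr := finrank_orth2 hef he hf
    obtain ⟨S0, S1, _, _, _, _, p, r, h0, h1, hd, -, hrp, hpr⟩ :=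
      IH (orth2 β e f) _ (nondeg_orth2 hb hef he hf) (by omega)
    have e1 : pol β e e = 0 := by rw [pol_apply, he, add_zero]
    have e2 : pol β f f = 0 := by rw [pol_apply, hf, add_zero]
    have e3 : pol β f e = 1 := by rw [pol_comm, hef]
    let P : V →ₗ[K] orth2 β e f := LinearMap.codRestrict _
      (LinearMap.id - (pol β e).smulRight f - (pol β f).smulRight e) (fun v => by
        rw [mem_orth2]
        simp [e1, e2, e3, hef])
    have hP : ∀ v, β v v = pol β e v * pol β f v + β (P v) (P v) := by
      intro v
      have h4 : β e f + β f e = 1 := hef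
      simp only [P, LinearMap.codRestrict_apply, LinearMap.sub_apply, LinearMap.id_apply,
        LinearMap.smulRight_apply, map_sub, map_smul, LinearMap.smul_apply, smul_eq_mul, he, hf]
      rw [pol_apply, pol_apply]
      linear_combination (-(β e v + β v e) * (β f v + β v f)) * h4
    refine ⟨S0 × S1, S1 × S0, inferInstance, inferInstance, inferInstance, inferInstance,
      LinearMap.mk₂ K (fun v x => (p (P v) x.1 + pol β e v • x.2, pol β f v • x.1 - r (P v) x.2))
        ?_ ?_ ?_ ?_,
      LinearMap.mk₂ K (fun v x => (r (P v) x.1 + pol β e v • x.2, pol β f v • x.1 - p (P v) x.2))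
        ?_ ?_ ?_ ?_, inferInstance, inferInstance, ?_, ?_, ?_, ?_⟩
    · intro v w x
      simp only [map_add, LinearMap.add_apply, Prod.mk_add_mk, Prod.mk.injEq]
      constructor <;> module
    · intro c v x
      simp only [map_smul, LinearMap.smul_apply, Prod.smul_mk, Prod.mk.injEq, smul_eq_mul]
      constructor <;> module
    · intro v x y
      simp only [map_add, Prod.mk_add_mk, Prod.mk.injEq, Prod.fst_add, Prod.snd_add]
      constructor <;> module
    · intro c v x
      simp only [map_smul, Prod.smul_mk, Prod.mk.injEq, Prod.smul_fst, Prod.smul_snd]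
      constructor <;> module
    · intro v w x
      simp only [map_add, LinearMap.add_apply, Prod.mk_add_mk, Prod.mk.injEq]
      constructor <;> module
    · intro c v x
      simp only [map_smul, LinearMap.smul_apply, Prod.smul_mk, Prod.mk.injEq, smul_eq_mul]
      constructor <;> module
    · intro v x y
      simp only [map_add, Prod.mk_add_mk, Prod.mk.injEq, Prod.fst_add, Prod.snd_add]
      constructor <;> module
    · intro c v x
      simp only [map_smul, Prod.smul_mk, Prod.mk.injEq, Prod.smul_fst, Prod.smul_snd]
      constructor <;> module
    · rw [Module.finrank_prod, Module.finrank_prod, pow_succ]; omega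
    · intro _
      rw [Module.finrank_prod, Module.finrank_prod, add_comm]
    · rintro v ⟨x, y⟩
      have h5 := hrp (P v) x
      have h6 := hpr (P v) y
      rw [LinearMap.domRestrict₁₂_apply] at h5 h6
      rw [hP v]
      simp only [LinearMap.mk₂_apply, map_add, map_sub, map_smul, h5, h6, Prod.smul_mk,
        Prod.mk.injEq]
      constructor <;> module
    · rintro v ⟨x, y⟩
      have h5 := hpr (P v) x
      have h6 := hrp (P v) y
      rw [LinearMap.domRestrict₁₂_apply] at h5 h6
      rw [hP v]
      simp only [LinearMap.mk₂_apply, map_add, map_sub, map_smul, h5, h6, Prod.smul_mk,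
        Prod.mk.injEq]
      constructor <;> module

end Spin

section Restrict

variable {F K D S Cp Cm : Type} [Field F] [Field K] [Algebra F K] [Ring D] [Algebra F D]
  [AddCommGroup S] [Module K S] [Module F S] [IsScalarTower F K S]
  [Ring Cp] [Algebra F Cp] [Ring Cm] [Algebra F Cm]

/-- Restriction of a representation to a stable subspace on which `e` acts as the identity. -/
noncomputable def restrictRep (g : D →ₙₐ[F] Module.End K S) (X : Submodule K S)
    (h : ∀ d, ∀ x ∈ X, g d x ∈ X) (h1 : ∀ x ∈ X, g 1 x = x) : D →ₐ[F] Module.End K X where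
  toFun d := (g d).restrict (h d)
  map_one' := by ext x; exact h1 x x.2
  map_mul' a b := by ext x; simp
  map_zero' := by ext x; simp
  map_add' a b := by ext x; simp
  commutes' r := by
    ext x
    rw [Algebra.algebraMap_eq_smul_one]
    simp [h1]

/-- A module over a product has a nonzero component. -/
theorem exists_component [Nontrivial S] (φ : Cp × Cm →ₐ[F] Module.End K S) :
    (Nontrivial (LinearMap.range (φ (1, 0))) ∧
      ∃ ψ : Cp →ₐ[F] Module.End K (LinearMap.range (φ (1, 0))),
        ∀ c x, (ψ c x : S) = φ (c, 0) x) ∨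
    (Nontrivial (LinearMap.range (φ (0, 1))) ∧
      ∃ ψ : Cm →ₐ[F] Module.End K (LinearMap.range (φ (0, 1))),
        ∀ c x, (ψ c x : S) = φ (0, c) x) := by
  by_cases h : φ (1, 0) = 0
  · right
    have h1 : φ (0, 1) = 1 := by
      have : ((1, 0) : Cp × Cm) + (0, 1) = 1 := by ext <;> simp
      rw [← map_one φ, ← this, map_add, h, zero_add]
    constructor
    · rw [Submodule.nontrivial_iff_ne_bot, Ne, LinearMap.range_eq_bot, h1]
      exact one_ne_zero
    · refine ⟨restrictRep ((φ : Cp × Cm →ₙₐ[F] Module.End K S).comp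
        (NonUnitalAlgHom.inr F Cp Cm)) _ ?_ ?_, fun c x => rfl⟩
      · rintro d _ ⟨y, rfl⟩
        rw [h1]; exact ⟨_, rfl⟩
      · rintro _ ⟨y, rfl⟩
        change φ (0, 1) _ = _
        rw [h1]; rfl
  · left
    constructor
    · rwa [Submodule.nontrivial_iff_ne_bot, Ne, LinearMap.range_eq_bot]
    · refine ⟨restrictRep ((φ : Cp × Cm →ₙₐ[F] Module.End K S).comp
        (NonUnitalAlgHom.inl F Cp Cm)) _ ?_ ?_, fun c x => rfl⟩
      · rintro d _ ⟨y, rfl⟩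
        refine ⟨φ (d, 0) y, ?_⟩
        change φ (1, 0) (φ (d, 0) y) = φ (d, 0) (φ (1, 0) y)
        rw [← Module.End.mul_apply, ← Module.End.mul_apply, ← map_mul, ← map_mul]
        simp
      · rintro _ ⟨y, rfl⟩
        change φ (1, 0) (φ (1, 0) y) = φ (1, 0) y
        rw [← Module.End.mul_apply, ← map_mul]
        simp

end Restrict

section Bound

variable {F A : Type} [Field F] [Ring A] [Algebra F A] {T : A →ₗ[F] F} {σ : A →ₗ[F] A} {ℓ : A}

theorem IsReducedTrace.finrank_eq (hT : IsReducedTrace F A T) :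
    finrank F A = deg F A * deg F A := by
  obtain ⟨E, _, _, n, e, -⟩ := hT
  have h := e.toLinearEquiv.finrank_eq
  rw [Module.finrank_baseChange, Module.finrank_matrix, Fintype.card_fin, Module.finrank_self,
    mul_one] at h
  rw [deg, h, Nat.sqrt_eq]

theorem exists_QS_one {K V C : Type} [Field K] [Algebra F K] [AddCommGroup V] [Module K V]
    [Module F V] [IsScalarTower F K V] [Module.Finite K V] [Nontrivial V] [Ring C] [Algebra F C]
    [Nontrivial C] (hA : IsCSA F A) (hT : IsReducedTrace F A T) (hqp : IsQuadraticPair F A T σ ℓ)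
    (hn : finrank K V = deg F A) (τ : A →ₐ[F] Module.End K V)
    (ρ : CliffordAlg F A T σ ℓ →ₐ[F] C) : ∃ b, QS T σ τ b 1 := by
  obtain ⟨b, κ, hκ, hb⟩ := exists_QS hA hT hqp.1 (by rw [hT.finrank_eq, hn])
    (by rw [hn]; exact hqp.2.1) τ
  have h1 := hb.eq_one hA hqp.2.2.2 hκ
    ((Module.End.baseChangeHom F K C).comp ((Algebra.lmul F C).comp ρ))
  exact ⟨b, h1 ▸ hb⟩

theorem finrank_le_of_component {K X : Type} [Field K] [Algebra F K]
    [AddCommGroup X] [Module K X] [Module F X] [IsScalarTower F K X] [Module.Finite K X]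
    {C : Type} [Ring C] [Algebra F C] (hC : IsCSA F C) [Nontrivial X] (ψ : C →ₐ[F] Module.End K X) :
    finrank F C ≤ finrank K X * finrank K X := by
  have := hC.finrank_le ψ ⊤ (⊤ : Submodule K (Module.End K X)) (fun _ _ => trivial)
  rwa [finrank_top, finrank_top, Module.finrank_linearMap] at this

/-- One of the components of the Clifford algebra has at most the expected dimension. -/
theorem exists_small_component {Cp Cm : Type} [Ring Cp] [Algebra F Cp] [Ring Cm] [Algebra F Cm]
    (hA : IsCSA F A) (hT : IsReducedTrace F A T) (hqp : IsQuadraticPair F A T σ ℓ)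
    (hCp : IsCSA F Cp) (hCm : IsCSA F Cm) (φ : CliffordAlg F A T σ ℓ ≃ₐ[F] Cp × Cm)
    {m : ℕ} (hm : 1 ≤ m) (hdeg : deg F A = 2 * m) :
    finrank F Cp ≤ 4 ^ (m - 1) ∨ finrank F Cm ≤ 4 ^ (m - 1) := by
  have hfr := hT.finrank_eq
  have hT' := hT
  obtain ⟨E, _, _, n, e, -⟩ := hT
  have h := e.toLinearEquiv.finrank_eq
  rw [Module.finrank_baseChange, Module.finrank_matrix, Fintype.card_fin, Module.finrank_self,
    mul_one, hfr] at h
  have hn : n = 2 * m := by rw [← hdeg]; exact (Nat.mul_self_inj.1 h).symm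
  let K := AlgebraicClosure E
  let V := Fin n → K
  have hV : finrank K V = 2 * m := by rw [← hn]; simp [V]
  have : Nontrivial V := Module.nontrivial_of_finrank_pos (R := K) (by omega)
  let τ : A →ₐ[F] Module.End K V :=
    ((Matrix.toLinAlgEquiv' : Matrix (Fin n) (Fin n) K ≃ₐ[K] _).toAlgHom.restrictScalars F).comp
    (((IsScalarTower.toAlgHom F E K).mapMatrix (m := Fin n)).comp
      ((e.toAlgHom.restrictScalars F).comp Algebra.TensorProduct.includeRight))
  have := hCp.2.1
  obtain ⟨b, hb⟩ := exists_QS_one hA hT' hqp (hV.trans hdeg.symm) τ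
    ((AlgHom.fst F Cp Cm).comp φ.toAlgHom)
  obtain ⟨S0, S1, _, _, _, _, p, r, h0, h1, hd, he, hrp, hpr⟩ :=
    exists_spin K m V (beta τ b ℓ) (hb.nondeg hqp.2.2.2) hV
  have hS0 : finrank K S0 = 2 ^ (m - 1) := by
    have := he hm
    obtain ⟨k, rfl⟩ := Nat.exists_eq_add_of_le' hm
    rw [pow_succ] at hd
    simp only [Nat.add_sub_cancel]
    omega
  have : Nontrivial S0 := Module.nontrivial_of_finrank_pos (R := K) (by rw [hS0]; positivity)
  let M : V →ₗ[K] V →ₗ[K] Module.End K S0 := LinearMap.mk₂ K (fun v w => r v ∘ₗ p w)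
    (fun a b c => by ext; simp) (fun a b c => by ext; simp)
    (fun a b c => by ext; simp) (fun a b c => by ext; simp)
  have hM : IsECM (beta τ b ℓ) M := by
    constructor
    · intro v; ext x; simp [M, hrp]
    · intro u v w; ext x; simp [M, hpr]
  obtain ⟨B, B', hB⟩ := exists_dualBases hb.nd hb.symm
  let _ : Module F S0 := Module.compHom S0 (algebraMap F K)
  have : IsScalarTower F K S0 := ⟨fun a k s => by
    rw [Algebra.smul_def, mul_smul]; rfl⟩
  obtain ⟨ρ, -⟩ := hb.exists_back (S := S0) hqp.1 hB hM
  have h4 : (4 : ℕ) ^ (m - 1) = 2 ^ (m - 1) * 2 ^ (m - 1) := by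
    rw [← mul_pow]; norm_num
  rw [h4]
  rcases exists_component (ρ.comp φ.symm.toAlgHom) with ⟨_, ψ, -⟩ | ⟨_, ψ, -⟩
  · left
    refine (finrank_le_of_component hCp ψ).trans ?_
    rw [← hS0]
    exact Nat.mul_le_mul (Submodule.finrank_le _) (Submodule.finrank_le _)
  · right
    refine (finrank_le_of_component hCm ψ).trans ?_
    rw [← hS0]
    exact Nat.mul_le_mul (Submodule.finrank_le _) (Submodule.finrank_le _)

end Bound

section Morita

variable {F C D X : Type} [Field F] [Ring C] [Algebra F C] [Ring D] [Algebra F D]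
  [AddCommGroup X] [Module F X]

/-- The action of `D`-matrices on column vectors with entries in a `D`-module. -/
noncomputable def matRep (l : ℕ) (τ : D →ₐ[F] Module.End F X) :
    Matrix (Fin l) (Fin l) D →ₐ[F] Module.End F (Fin l → X) :=
  (endVecAlgEquivMatrixEnd (Fin l) F F X).symm.toAlgHom.comp τ.mapMatrix

theorem matRep_apply (l : ℕ) (τ : D →ₐ[F] Module.End F X) (M : Matrix (Fin l) (Fin l) D)
    (x : Fin l → X) (i : Fin l) : matRep l τ M x i = ∑ j, τ (M i j) (x j) := rfl

/-- Morita transfer of modules along a Brauer equivalence, together with the commuting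
endomorphisms. -/
theorem morita {k l : ℕ} (hk : 0 < k)
    (e : Matrix (Fin k) (Fin k) C ≃ₐ[F] Matrix (Fin l) (Fin l) D)
    [Module.Finite F X] (τ : D →ₐ[F] Module.End F X) :
    ∃ (R : Type) (_ : AddCommGroup R) (_ : Module F R) (_ : Module.Finite F R)
      (τ' : C →ₐ[F] Module.End F R)
      (Θ : Subalgebra.centralizer F (Set.range τ) →ₐ[F] Module.End F R),
      (∀ c z, Commute (τ' c) (Θ z)) ∧ k * finrank F R = l * finrank F X := by
  let μ : Matrix (Fin k) (Fin k) C →ₐ[F] Module.End F (Fin l → X) :=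
    (matRep l τ).comp e.toAlgHom
  let i0 : Fin k := ⟨0, hk⟩
  let E (i j : Fin k) : Module.End F (Fin l → X) := μ (Matrix.single i j 1)
  have hE : ∀ i j p, E i j * E j p = E i p := fun i j p => by
    simp only [E]
    rw [← map_mul, Matrix.single_mul_single_same, mul_one]
  have hE0 : ∀ i j j' p, j ≠ j' → E i j * E j' p = 0 := fun i j j' p h => by
    simp only [E]
    rw [← map_mul, Matrix.single_mul_single_of_ne _ _ _ _ h, map_zero]
  have hE1 : ∑ i, E i i = 1 := by
    simp only [E]
    rw [← map_sum, ← map_one μ]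
    congr 1
    ext a b
    rw [Matrix.sum_apply, Finset.sum_eq_single a (fun i _ hi => by simp [hi]) (by simp)]
    by_cases h : a = b
    · subst h; simp
    · simp [h]
  let g : C →ₙₐ[F] Module.End F (Fin l → X) :=
    { toFun c := μ (Matrix.single i0 i0 c)
      map_smul' r c := by rw [← Matrix.smul_single, map_smul]; rfl
      map_zero' := by rw [Matrix.single_zero, map_zero]
      map_add' a b := by rw [Matrix.single_add, map_add]
      map_mul' a b := by rw [← map_mul, Matrix.single_mul_single_same] }
  have hg1 : g 1 = E i0 i0 := rfl
  let R := LinearMap.range (E i0 i0)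
  have hR : ∀ x ∈ R, E i0 i0 x = x := by
    rintro _ ⟨y, rfl⟩
    rw [← Module.End.mul_apply, hE]
  have hgR : ∀ c x, g c x ∈ R := by
    intro c x
    refine ⟨g c x, ?_⟩
    rw [← hg1, ← Module.End.mul_apply, ← map_mul, one_mul]
  let ζ (z : Module.End F X) : Module.End F (Fin l → X) := LinearMap.pi fun i => z ∘ₗ LinearMap.proj i
  have hζ : ∀ z x i, ζ z x i = z (x i) := fun _ _ _ => rfl
  have hζμ : ∀ z ∈ Subalgebra.centralizer F (Set.range τ), ∀ M x, ζ z (μ M x) = μ M (ζ z x) := by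
    intro z hz M x
    ext i
    change z (matRep l τ _ x i) = matRep l τ _ (ζ z x) i
    rw [matRep_apply, matRep_apply, map_sum]
    refine Finset.sum_congr rfl fun j _ => ?_
    have := Subalgebra.mem_centralizer_iff F |>.1 hz (τ (e M i j)) ⟨_, rfl⟩
    exact (LinearMap.congr_fun this (x j)).symm
  refine ⟨R, inferInstance, inferInstance, inferInstance,
    restrictRep g R (fun d x _ => hgR d x) hR,
    { toFun z := (ζ z).restrict (p := R) (q := R) ?_
      map_one' := ?_
      map_mul' := ?_
      map_zero' := ?_
      map_add' := ?_
      commutes' := ?_ }, ?_, ?_⟩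
  · intro x hx
    rw [← hR x hx]
    exact ⟨_, (hζμ z z.2 _ x).symm⟩
  · rfl
  · intro a b; rfl
  · rfl
  · intro a b; rfl
  · intro r; rfl
  · intro c z
    ext x : 2
    exact (hζμ z z.2 _ _).symm
  · have e1 : (Fin l → X) ≃ₗ[F] (Fin k → R) := by
      refine LinearEquiv.ofLinearMap
        (LinearMap.pi fun i => LinearMap.codRestrict R (E i0 i) fun y => ⟨E i0 i y, by
          rw [← Module.End.mul_apply, hE]⟩)
        (∑ i, E i i0 ∘ₗ R.subtype ∘ₗ LinearMap.proj i) ?_ ?_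
      · apply LinearMap.ext
        intro r
        funext i
        apply Subtype.ext
        change E i0 i ((∑ i, E i i0 ∘ₗ R.subtype ∘ₗ LinearMap.proj i) r) = r i
        rw [LinearMap.sum_apply, map_sum, Finset.sum_eq_single i]
        · change E i0 i (E i i0 (r i)) = _
          rw [← Module.End.mul_apply, hE, hR _ (r i).2]
        · intro j _ hj
          change E i0 i (E j i0 (r j)) = _
          rw [← Module.End.mul_apply, hE0 _ _ _ _ hj.symm]; rfl
        · simp
      · apply LinearMap.ext
        intro y
        change (∑ i, E i i0 ∘ₗ R.subtype ∘ₗ LinearMap.proj i) _ = y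
        rw [LinearMap.sum_apply]
        change ∑ i, E i i0 (E i0 i y) = y
        simp only [← Module.End.mul_apply, hE]
        rw [← LinearMap.sum_apply, hE1]; rfl
    have := e1.finrank_eq
    rw [Module.finrank_pi_fintype, Module.finrank_pi_fintype] at this
    simpa using this.symm

end Morita

section Degree

variable {F A : Type} [Field F] [Ring A] [Algebra F A]

theorem IsCSA.isSimpleRing_baseChange (hA : IsCSA F A) (K : Type) [Field K] [Algebra F K] :
    IsSimpleRing (K ⊗[F] A) := by
  have := hA.2.1
  have : Nontrivial (K ⊗[F] A) := by
    have : Nontrivial A := inferInstance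
    infer_instance
  refine ⟨⟨fun I => ?_⟩⟩
  by_cases hI : I = ⊤
  · exact Or.inr hI
  left
  have hQ : Nontrivial I.ringCon.Quotient := by
    refine ⟨0, 1, fun h => hI ?_⟩
    rw [← TwoSidedIdeal.one_mem_iff]
    have := (RingCon.eq _).1 h.symm
    exact this
  let q : K ⊗[F] A →ₐ[K] I.ringCon.Quotient :=
    { I.ringCon.mk' with commutes' := fun r => rfl }
  let τ : A →ₐ[F] I.ringCon.Quotient :=
    (q.restrictScalars F).comp Algebra.TensorProduct.includeRight
  have h1 := hA.lift_injective (K := K) τ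
  have h2 : csaLift (K := K) τ = q := by
    ext a
    simp [csaLift_tmul, τ]
  rw [h2] at h1
  rw [eq_bot_iff]
  intro x hx
  rw [TwoSidedIdeal.mem_bot]
  apply h1
  rw [map_zero]
  exact (RingCon.eq _).2 hx

theorem IsCSA.finrank_eq (hA : IsCSA F A) : finrank F A = deg F A * deg F A := by
  have := hA.2.2
  have := hA.isSimpleRing_baseChange (AlgebraicClosure F)
  obtain ⟨n, _, ⟨e⟩⟩ := IsSimpleRing.exists_algEquiv_matrix_of_isAlgClosed (AlgebraicClosure F)
    (AlgebraicClosure F ⊗[F] A)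
  have h := e.toLinearEquiv.finrank_eq
  rw [Module.finrank_baseChange, Module.finrank_matrix, Fintype.card_fin, Module.finrank_self,
    mul_one] at h
  rw [deg, h, Nat.sqrt_eq]

theorem IsCSA.exists_division (hA : IsCSA F A) (hi : schurIndex F A ≤ 2) :
    ∃ (D : Type) (_ : DivisionRing D) (_ : Algebra F D) (k l : ℕ)
      (_ : Matrix (Fin k) (Fin k) A ≃ₐ[F] Matrix (Fin l) (Fin l) D), 0 < k ∧ Module.Finite F D ∧
      Algebra.IsCentral F D ∧ (finrank F D = 1 ∨ finrank F D = 4) := by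
  have hs := hA.2.1
  have hf := hA.2.2
  have hmem := Nat.sInf_mem (s := { d : ℕ | 0 < d ∧ ∃ (D : Type) (_ : Ring D) (_ : Algebra F D),
    IsCSA F D ∧ Module.finrank F D = d * d ∧ BrauerEquiv F A D }) ⟨deg F A, by
      refine Nat.pos_of_ne_zero fun h => ?_
      have h1 := hA.finrank_eq
      rw [h] at h1
      exact (Module.finrank_pos (R := F) (M := A)).ne' h1, A, _, _, hA, hA.finrank_eq,
      1, 1, one_pos, one_pos, ⟨AlgEquiv.refl⟩⟩
  obtain ⟨h0, D0, _, _, hD0, hd, k, l, hk, hl, ⟨e⟩⟩ := hmem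
  change 0 < schurIndex F A at h0
  change finrank F D0 = schurIndex F A * schurIndex F A at hd
  have := hD0.2.1
  have := hD0.2.2
  have := IsArtinianRing.of_finite F D0
  obtain ⟨n, hn, D, _, _, _, ⟨e'⟩⟩ := IsSimpleRing.exists_algEquiv_matrix_divisionRing_finite F D0
  have hdim := e'.toLinearEquiv.finrank_eq
  rw [hd, Module.finrank_matrix, Fintype.card_fin] at hdim
  refine ⟨D, inferInstance, inferInstance, k, l * n, e.trans (e'.mapMatrix.trans
    ((Matrix.compAlgEquiv (Fin l) (Fin n) D F).trans
      (Matrix.reindexAlgEquiv F D finProdFinEquiv))), hk, inferInstance, ?_, ?_⟩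
  · refine ⟨fun x hx => ?_⟩
    have := hD0.1
    have h2 : Algebra.IsCentral F (Matrix (Fin n) (Fin n) D) := Algebra.IsCentral.of_algEquiv F _ _ e'
    have h3 : Matrix.scalar (Fin n) x ∈ Subalgebra.center F (Matrix (Fin n) (Fin n) D) := by
      rw [Matrix.subalgebraCenter_eq_scalarAlgHom_map]
      exact ⟨x, hx, rfl⟩
    rw [Algebra.IsCentral.mem_center_iff] at h3
    obtain ⟨a, ha⟩ := h3
    have i0 : Fin n := ⟨0, Nat.pos_of_neZero n⟩
    refine ⟨a, ?_⟩
    have := congrFun (congrFun ha i0) i0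
    simpa [Matrix.algebraMap_matrix_apply] using this.symm
  · have hDpos := Module.finrank_pos (R := F) (M := D)
    have hn0 := Nat.pos_of_neZero n
    have h2 : schurIndex F A = 1 ∨ schurIndex F A = 2 := by omega
    have hn2 : n ≤ 2 := by
      rcases h2 with h2 | h2 <;> rw [h2] at hdim <;> nlinarith
    rcases h2 with h2 | h2 <;> rw [h2] at hdim <;> interval_cases n <;> omega

end Degree

section Quaternion

variable {F D : Type} [Field F] [DivisionRing D] [Algebra F D] [Module.Finite F D]

theorem exists_quadratic (hc : Algebra.IsCentral F D) (h4 : finrank F D = 4) (x : D)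
    (hx : ∀ a, x ≠ algebraMap F D a) : ∃ t n : F, x * x = t • x - n • (1 : D) := by
  obtain ⟨y, hy⟩ : ∃ y, x * y ≠ y * x := by
    by_contra! H
    obtain ⟨a, ha⟩ := Algebra.IsCentral.mem_center_iff F |>.1
      (Subalgebra.mem_center_iff.2 fun b => (H b).symm)
    exact hx a ha
  let g : (Fin 3 → F) →ₗ[F] D := Fintype.linearCombination F ![1, x, x * x]
  have hg : ∀ v, g v = v 0 • (1 : D) + v 1 • x + v 2 • (x * x) := fun v => by
    simp [g, Fintype.linearCombination_apply, Fin.sum_univ_three]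
  have hcomm : ∀ v, x * g v = g v * x := fun v => by
    simp only [hg, mul_add, add_mul, mul_smul_comm, smul_mul_assoc, mul_one, one_mul, mul_assoc]
  let G : (Fin 3 → F) × (Fin 3 → F) →ₗ[F] D :=
    g.coprod (LinearMap.mulRight F y ∘ₗ g)
  have hG : ∀ p, G p = g p.1 + g p.2 * y := fun _ => rfl
  have hker := LinearMap.ker_ne_bot_of_finrank_lt (f := G) (by
    rw [h4, Module.finrank_prod, Module.finrank_fin_fun]; norm_num)
  obtain ⟨p, hp, hp0⟩ := Submodule.exists_mem_ne_zero_of_ne_bot hker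
  rw [LinearMap.mem_ker, hG] at hp
  have hq : g p.2 = 0 := by
    by_contra hq
    apply hy
    have h1 : g p.2 * y = - g p.1 := eq_neg_of_add_eq_zero_right hp
    apply mul_left_cancel₀ hq
    rw [← mul_assoc, ← mul_assoc, h1, ← hcomm, mul_assoc, h1, neg_mul, ← hcomm, mul_neg]
  have key : ∀ v, v ≠ 0 → g v = 0 → ∃ t n : F, x * x = t • x - n • (1 : D) := by
    intro v hv h
    rw [hg] at h
    have h2 : v 2 ≠ 0 := by
      intro h2
      rw [h2, zero_smul, add_zero] at h
      have h1 : v 1 = 0 := by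
        by_contra h1
        refine hx (-(v 1)⁻¹ * v 0) ?_
        rw [Algebra.algebraMap_eq_smul_one, mul_smul, eq_neg_of_add_eq_zero_left h, smul_neg,
          neg_smul, neg_neg, smul_smul, inv_mul_cancel₀ h1, one_smul]
      rw [h1, zero_smul, add_zero, smul_eq_zero] at h
      have h0 := h.resolve_right one_ne_zero
      exact hv (by ext i; fin_cases i <;> simp [h0, h1, h2])
    refine ⟨-(v 2)⁻¹ * v 1, (v 2)⁻¹ * v 0, ?_⟩
    have : x * x = (v 2)⁻¹ • (v 2 • (x * x)) := by rw [smul_smul, inv_mul_cancel₀ h2, one_smul]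
    rw [this]
    linear_combination (norm := module) (v 2)⁻¹ • h
  rw [hq, zero_mul, add_zero] at hp
  by_cases h1 : p.1 = 0
  · exact key p.2 (fun h2 => hp0 (Prod.ext h1 h2)) hq
  · exact key p.1 h1 hp

theorem exists_separable (hc : Algebra.IsCentral F D) (h4 : finrank F D = 4) :
    ∃ (z : D) (c : F), (∀ a, z ≠ algebraMap F D a) ∧ z * z = z - c • (1 : D) := by
  by_contra! H
  have hsq : ∀ x : D, ∃ n : F, x * x = n • (1 : D) := by
    intro x
    by_cases hx : ∀ a, x ≠ algebraMap F D a
    · obtain ⟨t, n, h⟩ := exists_quadratic hc h4 x hx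
      by_cases ht : t = 0
      · exact ⟨-n, by rw [h, ht]; module⟩
      · exfalso
        refine H (t⁻¹ • x) (t⁻¹ * t⁻¹ * n) ?_ ?_
        · intro a ha
          refine hx (t * a) ?_
          rw [map_mul, ← ha, ← Algebra.smul_def, smul_smul, mul_inv_cancel₀ ht, one_smul]
        · rw [smul_mul_smul_comm, h, smul_sub, smul_smul, smul_smul, mul_assoc,
            inv_mul_cancel₀ ht, mul_one]
    · push Not at hx
      obtain ⟨a, rfl⟩ := hx
      exact ⟨a * a, by rw [← map_mul, Algebra.algebraMap_eq_smul_one]⟩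
  obtain ⟨x, hx⟩ : ∃ x : D, ∀ a, x ≠ algebraMap F D a := by
    by_contra! h
    have : (⊤ : Submodule F D) ≤ F ∙ (1 : D) := fun x _ => by
      obtain ⟨a, rfl⟩ := h x
      rw [Algebra.algebraMap_eq_smul_one]
      exact Submodule.smul_mem _ _ (Submodule.mem_span_singleton_self _)
    have := Submodule.finrank_mono this
    rw [finrank_top, finrank_span_singleton one_ne_zero] at this
    omega
  have hx0 : x ≠ 0 := fun h => hx 0 (by rw [h, map_zero])
  obtain ⟨n, hn⟩ := hsq x
  have h2 : (2 : F) = 0 := by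
    by_contra h2
    obtain ⟨n', hn'⟩ := hsq (x + 1)
    refine hx (2⁻¹ * (n' - n - 1)) ?_
    rw [Algebra.algebraMap_eq_smul_one, mul_smul]
    have : (n' - n - 1) • (1 : D) = (2 : F) • x := by
      rw [add_mul, mul_add, hn] at hn'
      simp only [mul_one, one_mul] at hn'
      linear_combination (norm := module) -hn'
    rw [this, smul_smul, inv_mul_cancel₀ h2, one_smul]
  have hneg : ∀ u : D, -u = u := fun u => by
    rw [neg_eq_iff_add_eq_zero, ← two_smul F, h2, zero_smul]
  obtain ⟨y, hy⟩ : ∃ y, x * y ≠ y * x := by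
    by_contra! H
    obtain ⟨a, ha⟩ := Algebra.IsCentral.mem_center_iff F |>.1
      (Subalgebra.mem_center_iff.2 fun b => (H b).symm)
    exact hx a ha
  obtain ⟨p, hp⟩ := hsq y
  obtain ⟨s, hs⟩ := hsq (x + y)
  obtain ⟨w, hw⟩ := hsq (x * y)
  have hyx : y * x = (s - n - p) • (1 : D) - x * y := by
    rw [add_mul, mul_add, mul_add, hn, hp] at hs
    linear_combination (norm := module) hs
  by_cases hr : s - n - p = 0
  · rw [hr, zero_smul, zero_sub, hneg] at hyx
    exact hy hyx.symm
  · have h5 : (s - n - p) • (x * y) = (w + n * p) • (1 : D) := by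
      have : x * y * (x * y) = x * (y * x) * y := by simp only [mul_assoc]
      rw [this, hyx, mul_sub, sub_mul, ← mul_assoc x x y, hn, mul_smul_comm, mul_one, smul_mul_assoc,
        smul_mul_assoc, one_mul, smul_mul_assoc, hp, smul_smul] at hw
      linear_combination (norm := module) hw
    have h6 : x * y = ((s - n - p)⁻¹ * (w + n * p)) • (1 : D) := by
      rw [mul_smul, ← h5, smul_smul, inv_mul_cancel₀ hr, one_smul]
    apply hy
    apply mul_left_cancel₀ hx0
    rw [← mul_assoc, ← mul_assoc]
    rw [mul_assoc x x y, h6, mul_smul_comm, mul_one, smul_mul_assoc, one_mul]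

end Quaternion

section Quaternion

/-- The quaternion algebra `[-c, b)` is a division algebra. -/
def Aniso {F : Type} [Field F] (c b : F) : Prop :=
  ∀ x : QuaternionAlgebra F (-c) 1 b, x * star x = 0 → x = 0

variable {F D : Type} [Field F] [DivisionRing D] [Algebra F D] [Module.Finite F D]

theorem exists_quaternion_basis (hc : Algebra.IsCentral F D) (h4 : finrank F D = 4) :
    ∃ (z j : D) (c b : F), Aniso c b ∧ z * z = z - c • (1 : D) ∧ j * j = b • (1 : D) ∧
      j * z = j - z * j := by
  obtain ⟨z, c, hz, hzz⟩ := exists_separable hc h4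
  obtain ⟨y, hy⟩ : ∃ y, z * y ≠ y * z := by
    by_contra! H
    obtain ⟨a, ha⟩ := Algebra.IsCentral.mem_center_iff F |>.1
      (Subalgebra.mem_center_iff.2 fun b => (H b).symm)
    exact hz a ha
  obtain ⟨j, hj⟩ : ∃ j, j = z * y - y * z := ⟨_, rfl⟩
  have hj0 : j ≠ 0 := by rw [hj]; exact sub_ne_zero.2 hy
  have hjz : j * z = j - z * j := by
    rw [hj, sub_mul, mul_sub, ← mul_assoc z z y, mul_assoc y z z, hzz, mul_sub, sub_mul,
      mul_smul_comm, smul_mul_assoc, mul_one, one_mul, mul_assoc]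
    abel
  have h2z : (1 : D) - 2 * z ≠ 0 := by
    intro h
    by_cases h2 : (2 : F) = 0
    · have : (2 : D) = 0 := by
        have := congrArg (algebraMap F D) h2
        rwa [map_ofNat, map_zero] at this
      rw [this, zero_mul, sub_zero] at h
      exact one_ne_zero h
    · refine hz 2⁻¹ ?_
      rw [Algebra.algebraMap_eq_smul_one, sub_eq_zero.1 h, two_mul, ← two_smul F, smul_smul,
        inv_mul_cancel₀ h2, one_smul]
  have hK : ∀ p q : F, p • (1 : D) + q • z = 0 → p = 0 ∧ q = 0 := by
    intro p q h
    have hq : q = 0 := by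
      by_contra hq
      refine hz (-(q⁻¹ * p)) ?_
      have : z = q⁻¹ • (q • z) := by rw [smul_smul, inv_mul_cancel₀ hq, one_smul]
      rw [Algebra.algebraMap_eq_smul_one, this, eq_neg_of_add_eq_zero_right h]
      module
    rw [hq, zero_smul, add_zero, smul_eq_zero] at h
    exact ⟨h.resolve_right one_ne_zero, hq⟩
  have hcommz : ∀ p q : F, z * (p • (1 : D) + q • z) = (p • (1 : D) + q • z) * z := fun p q => by
    simp [mul_add, add_mul]
  let g : (Fin 4 → F) →ₗ[F] D := Fintype.linearCombination F ![1, z, j, z * j]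
  have hg : ∀ v, g v = v 0 • (1 : D) + v 1 • z + (v 2 • (1 : D) + v 3 • z) * j := fun v => by
    simp [g, Fintype.linearCombination_apply, Fin.sum_univ_four, add_mul, add_assoc]
  have hbr : ∀ v, g v * z - z * g v = (v 2 • (1 : D) + v 3 • z) * ((1 - 2 * z) * j) := fun v => by
    rw [hg, add_mul, mul_add, hcommz, ← mul_assoc z _ j, hcommz, mul_assoc, hjz]
    simp only [two_mul, add_mul, mul_add, sub_mul, mul_sub, mul_assoc, one_mul]
    abel
  have hginj : Function.Injective g := by
    rw [injective_iff_map_eq_zero]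
    intro v hv
    have h1 := hbr v
    rw [hv, zero_mul, mul_zero, sub_zero] at h1
    have h2 := (mul_eq_zero.1 h1.symm).resolve_right (mul_ne_zero h2z hj0)
    rw [hg, h2, zero_mul, add_zero] at hv
    obtain ⟨h5, h6⟩ := hK _ _ hv
    obtain ⟨h7, h8⟩ := hK _ _ h2
    ext i
    fin_cases i <;> assumption
  have hgsurj : Function.Surjective g :=
    (LinearMap.injective_iff_surjective_of_finrank_eq_finrank
      (by rw [h4, Module.finrank_fin_fun])).1 hginj
  obtain ⟨b, hb⟩ : ∃ b : F, j * j = b • (1 : D) := by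
    obtain ⟨v, hv⟩ := hgsurj (j * j)
    have h1 := hbr v
    have h3 : j * j * z - z * (j * j) = 0 := by
      rw [mul_assoc, hjz, mul_sub, ← mul_assoc j z j, hjz, sub_mul, mul_assoc]
      abel
    rw [hv, h3] at h1
    have h2 := (mul_eq_zero.1 h1.symm).resolve_right (mul_ne_zero h2z hj0)
    rw [hg, h2, zero_mul, add_zero] at hv
    have h6 : j * (j * j) - (j * j) * j = 0 := by rw [mul_assoc, sub_self]
    rw [← hv] at h6
    have h7 : v 1 • ((1 - 2 * z) * j) = 0 := by
      rw [← h6, two_mul]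
      simp only [mul_add, add_mul, sub_mul, mul_smul_comm, smul_mul_assoc, mul_one, one_mul, hjz]
      module
    have h8 := (smul_eq_zero.1 h7).resolve_right (mul_ne_zero h2z hj0)
    rw [h8, zero_smul, add_zero] at hv
    exact ⟨_, hv.symm⟩
  refine ⟨z, j, c, b, ?_, hzz, hb, hjz⟩
  let q : QuaternionAlgebra.Basis D (-c) 1 b :=
    { i := z, j := j, k := z * j
      i_mul_i := by rw [hzz]; module
      j_mul_j := hb
      i_mul_j := rfl
      j_mul_i := by rw [hjz, one_smul] }
  have hq : ∀ x, q.liftHom x = g ![x.re, x.imI, x.imJ, x.imK] := by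
    intro x
    rw [hg]
    simp [QuaternionAlgebra.Basis.lift, q, Algebra.algebraMap_eq_smul_one, add_mul, add_assoc]
  have hq0 : ∀ x, q.liftHom x = 0 → x = 0 := by
    intro x hx
    rw [hq] at hx
    have := hginj (hx.trans (map_zero g).symm)
    ext
    · exact congrFun this 0
    · exact congrFun this 1
    · exact congrFun this 2
    · exact congrFun this 3
  intro x hx
  have := congrArg q.liftHom hx
  rw [map_mul, map_zero, mul_eq_zero] at this
  rcases this with h | h
  · exact hq0 _ h
  · exact star_eq_zero.1 (hq0 _ h)

end Quaternion

section Index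

variable {F A : Type} [Field F] [Ring A] [Algebra F A]

/-- `A` is split, with a faithful module of dimension `deg A`. -/
def SplitRep (F A : Type) [Field F] [Ring A] [Algebra F A] : Prop :=
  ∃ (V : Type) (_ : AddCommGroup V) (_ : Module F V) (_ : Module.Finite F V),
    finrank F V = deg F A ∧ Nonempty (A →ₐ[F] Module.End F V)

/-- `A` has a module of dimension `2 deg A` with a commuting action of the division
quaternion algebra `[-c, b)`. -/
def QuatRep (F A : Type) [Field F] [Ring A] [Algebra F A] (c b : F) : Prop :=
  Aniso c b ∧ ∃ (V : Type) (_ : AddCommGroup V) (_ : Module F V) (_ : Module.Finite F V)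
    (τ : A →ₐ[F] Module.End F V) (g : QuaternionAlgebra F (-c) 1 b →ₐ[F] Module.End F V),
    finrank F V = 2 * deg F A ∧ ∀ a x, Commute (τ a) (g x)

/-- Dimension count for Brauer equivalent algebras. -/
theorem morita_deg {D : Type} [DivisionRing D] [Algebra F D] (hA : IsCSA F A) {k l δ : ℕ}
    (hD : finrank F D = δ * δ)
    (e : Matrix (Fin k) (Fin k) A ≃ₐ[F] Matrix (Fin l) (Fin l) D) : k * deg F A = l * δ := by
  have h := e.toLinearEquiv.finrank_eq
  rw [Module.finrank_matrix, Module.finrank_matrix, Fintype.card_fin, Fintype.card_fin,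
    hA.finrank_eq, hD] at h
  exact Nat.mul_self_inj.1 (by linarith)

theorem IsCSA.rep (hA : IsCSA F A) (hi : schurIndex F A ≤ 2) :
    SplitRep F A ∨ ∃ c b, QuatRep F A c b := by
  obtain ⟨D, _, _, k, l, e, hk, hfin, hc, h1 | h4⟩ := hA.exists_division hi
  · left
    obtain ⟨R, _, _, _, τ', Θ, -, hd⟩ := morita hk e (Algebra.lmul F D)
    have := morita_deg hA (δ := 1) (by rw [h1]) e
    refine ⟨R, _, _, inferInstance, ?_, ⟨τ'⟩⟩
    rw [h1] at hd
    exact Nat.eq_of_mul_eq_mul_left hk (hd.trans this.symm)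
  · right
    obtain ⟨z, j, c, b, hab, hz, hj, hjz⟩ := exists_quaternion_basis hc h4
    obtain ⟨R, _, _, _, τ', Θ, hΘ, hd⟩ := morita hk e (Algebra.lmul F D)
    have hdeg := morita_deg hA (δ := 2) (by rw [h4]) e
    have hmem : ∀ x, LinearMap.mulRight F x ∈
        Subalgebra.centralizer F (Set.range (Algebra.lmul F D)) := by
      intro x
      rw [Subalgebra.mem_centralizer_iff]
      rintro _ ⟨y, rfl⟩
      ext w
      exact (mul_assoc y w x).symm
    let q : QuaternionAlgebra.Basis (Subalgebra.centralizer F (Set.range (Algebra.lmul F D)))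
        (-c) 1 b :=
      { i := ⟨_, hmem z⟩, j := ⟨_, hmem j⟩, k := ⟨_, hmem (j * z)⟩
        i_mul_i := by
          ext w
          change w * z * z = (-c) • w + (1 : F) • (w * z)
          rw [mul_assoc, hz, mul_sub, mul_smul_comm, mul_one]
          module
        j_mul_j := by
          ext w
          change w * j * j = b • w
          rw [mul_assoc, hj, mul_smul_comm, mul_one]
        i_mul_j := by
          ext w
          exact mul_assoc w j z
        j_mul_i := by
          ext w
          change w * z * j = (1 : F) • (w * j) - w * (j * z)
          rw [hjz, mul_sub, one_smul, mul_assoc]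
          abel }
    refine ⟨c, b, hab, R, _, _, inferInstance, τ', Θ.comp q.liftHom, ?_, fun a x => hΘ _ _⟩
    rw [h4] at hd
    apply Nat.eq_of_mul_eq_mul_left hk
    linarith

end Index

section QuaternionNorm

variable {F : Type} [Field F] {c b : F}

/-- The reduced trace of the quaternion algebra `[-c, b)`. -/
def tq (x : QuaternionAlgebra F (-c) 1 b) : F := 2 * x.re + x.imI

/-- The reduced norm of the quaternion algebra `[-c, b)`. -/
def nq (x : QuaternionAlgebra F (-c) 1 b) : F := (x * star x).re

theorem mul_star_eq_nq (x : QuaternionAlgebra F (-c) 1 b) : x * star x = nq x • 1 := by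
  rw [nq, QuaternionAlgebra.mul_star_eq_coe, QuaternionAlgebra.re_coe, ← mul_one (QuaternionAlgebra.coe _),
    QuaternionAlgebra.coe_mul_eq_smul]

theorem star_eq_tq (x : QuaternionAlgebra F (-c) 1 b) : star x = tq x • 1 - x := by
  ext <;> simp [tq]; ring

theorem star_mul_eq_nq (x : QuaternionAlgebra F (-c) 1 b) : star x * x = nq x • 1 := by
  rw [← mul_star_eq_nq, star_eq_tq]
  simp [mul_sub, sub_mul]

theorem sq_eq (x : QuaternionAlgebra F (-c) 1 b) : x * x = tq x • x - nq x • 1 := by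
  have h := mul_star_eq_nq x
  rw [star_eq_tq, mul_sub, mul_smul_comm, mul_one] at h
  rw [← h]; abel

theorem nq_add_smul (x y : QuaternionAlgebra F (-c) 1 b) (t : F) :
    nq (y + t • x) = nq y + t * tq (y * star x) + t * t * nq x := by
  simp [nq, tq]; ring

theorem tq_smul (x : QuaternionAlgebra F (-c) 1 b) (t : F) : tq (t • x) = t * tq x := by
  simp [tq]; ring

theorem tq_add (x y : QuaternionAlgebra F (-c) 1 b) : tq (x + y) = tq x + tq y := by
  simp [tq]; ring

theorem tq_mul_comm (x y : QuaternionAlgebra F (-c) 1 b) : tq (x * y) = tq (y * x) := by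
  simp [tq]; ring

theorem Aniso.nq_ne_zero (h : Aniso c b) {x : QuaternionAlgebra F (-c) 1 b} (hx : x ≠ 0) :
    nq x ≠ 0 := fun h0 => hx (h x (by rw [mul_star_eq_nq, h0, zero_smul]))

theorem Aniso.exists_inv (h : Aniso c b) {x : QuaternionAlgebra F (-c) 1 b} (hx : x ≠ 0) :
    (nq x)⁻¹ • star x * x = 1 := by
  rw [smul_mul_assoc, star_mul_eq_nq, smul_smul, inv_mul_cancel₀ (h.nq_ne_zero hx), one_smul]

theorem Aniso.mul_ne_zero (h : Aniso c b) {x y : QuaternionAlgebra F (-c) 1 b} (hx : x ≠ 0)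
    (hy : y ≠ 0) : x * y ≠ 0 := fun h0 => hy (by
  rw [← one_mul y, ← h.exists_inv hx, mul_assoc, h0, mul_zero])

theorem Aniso.disc_ne_zero (h : Aniso c b) : 1 - 4 * c ≠ 0 := by
  intro h0
  have := h ⟨-1, 2, 0, 0⟩ (by
    ext <;> simp
    · linear_combination -h0
    · ring)
  have h1 := congrArg QuaternionAlgebra.re this
  simp at h1

theorem Aniso.ne_zero (h : Aniso c b) : b ≠ 0 := by
  intro h0
  have := h ⟨0, 0, 1, 0⟩ (by ext <;> simp [h0])
  have h1 := congrArg QuaternionAlgebra.imJ this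
  simp at h1

theorem Aniso.exists_not_commute (h : Aniso c b) {x : QuaternionAlgebra F (-c) 1 b}
    (hx : ∀ a : F, x ≠ a • 1) : ∃ y, x * y ≠ y * x := by
  by_contra! H
  obtain ⟨r, p, q, s⟩ := x
  have h1 := H ⟨0, 1, 0, 0⟩
  have h2 := H ⟨0, 0, 1, 0⟩
  have e1 := congrArg QuaternionAlgebra.imJ h1
  have e2 := congrArg QuaternionAlgebra.imK h1
  have e3 := congrArg QuaternionAlgebra.imJ h2
  have e4 := congrArg QuaternionAlgebra.imK h2
  simp at e1 e2 e3 e4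
  have hq : q = 0 := by
    have : (1 - 4 * c) * q = 0 := by linear_combination e1 + 2 * c * e2
    exact (mul_eq_zero.1 this).resolve_left h.disc_ne_zero
  have hs : s = 0 := by linear_combination -e2 - 2 * hq
  have hp : p = 0 := e3
  apply hx r
  ext <;> simp [hq, hs, hp]

theorem Aniso.eq_zero_of_apply (h : Aniso c b) {R : Type} [AddCommGroup R] [Module F R]
    (g : QuaternionAlgebra F (-c) 1 b →ₐ[F] Module.End F R) {x : QuaternionAlgebra F (-c) 1 b}
    {s : R} (hs : s ≠ 0) (hx : g x s = 0) : x = 0 := by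
  by_contra h0
  apply hs
  calc s = g 1 s := by rw [map_one]; rfl
    _ = 0 := by rw [← h.exists_inv h0, map_mul, Module.End.mul_apply, hx, map_zero]

theorem Aniso.centralizer (h : Aniso c b) {u w : QuaternionAlgebra F (-c) 1 b}
    (hu : ∀ a : F, u ≠ a • 1) (huw : u * w = w * u) : ∃ γ δ : F, w = γ • 1 + δ • u := by
  let G : (F × F) × (F × F) →ₗ[F] QuaternionAlgebra F (-c) 1 b :=
    (LinearMap.coprod (LinearMap.toSpanSingleton F _ 1) (LinearMap.toSpanSingleton F _ u)).coprod
    (LinearMap.coprod (LinearMap.toSpanSingleton F _ w) (LinearMap.toSpanSingleton F _ (u * w)))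
  have hG : ∀ p, G p = p.1.1 • 1 + p.1.2 • u + (p.2.1 • 1 + p.2.2 • u) * w := fun p => by
    simp [G, add_mul]
  have hinj : ¬ Function.Injective G := by
    intro hinj
    have hsurj := (LinearMap.injective_iff_surjective_of_finrank_eq_finrank
      (by rw [QuaternionAlgebra.finrank_eq_four]; simp)).1 hinj
    obtain ⟨y, hy⟩ := h.exists_not_commute hu
    apply hy
    obtain ⟨p, rfl⟩ := hsurj y
    have h3 : u * (u * w) = u * w * u := by rw [mul_assoc, ← huw]
    rw [hG]
    simp only [mul_add, add_mul, mul_smul_comm, smul_mul_assoc, mul_one, one_mul, huw.symm ▸ h3, huw]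
  rw [injective_iff_map_eq_zero] at hinj
  push Not at hinj
  obtain ⟨p, hp, hp0⟩ := hinj
  rw [hG] at hp
  obtain ⟨q, hq⟩ : ∃ q, q = p.2.1 • 1 + p.2.2 • u := ⟨_, rfl⟩
  rw [← hq] at hp
  have hq0 : q ≠ 0 := by
    intro h0
    have key : ∀ r t : F, r • 1 + t • u = 0 → r = 0 ∧ t = 0 := by
      intro r t hrt
      have ht : t = 0 := by
        by_contra ht
        apply hu (-(t⁻¹ * r))
        have : u = t⁻¹ • (t • u) := by rw [smul_smul, inv_mul_cancel₀ ht, one_smul]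
        rw [this, eq_neg_of_add_eq_zero_right hrt]; module
      rw [ht, zero_smul, add_zero] at hrt
      have := congrArg QuaternionAlgebra.re hrt
      simp at this
      exact ⟨this, ht⟩
    rw [h0, zero_mul, add_zero] at hp
    obtain ⟨h1, h2⟩ := key _ _ hp
    obtain ⟨h5, h6⟩ := key _ _ (hq.symm.trans h0)
    exact hp0 (Prod.ext (Prod.ext h1 h2) (Prod.ext h5 h6))
  have hw : w = -((nq q)⁻¹ • star q * (p.1.1 • 1 + p.1.2 • u)) := by
    rw [eq_neg_of_add_eq_zero_left hp, mul_neg, neg_neg, ← mul_assoc, h.exists_inv hq0, one_mul]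
  have hstar : star q = (tq q - p.2.1) • 1 - p.2.2 • u := by
    rw [star_eq_tq, sub_smul]; nth_rw 2 [hq]; abel
  obtain ⟨N, hN⟩ : ∃ N, N = (nq q)⁻¹ := ⟨_, rfl⟩
  obtain ⟨S, hS⟩ : ∃ S, S = tq q - p.2.1 := ⟨_, rfl⟩
  rw [hstar, ← hN, ← hS] at hw
  refine ⟨-(N * (S * p.1.1 + p.2.2 * p.1.2 * nq u)),
    -(N * (S * p.1.2 - p.2.2 * p.1.1 - p.2.2 * p.1.2 * tq u)), ?_⟩
  rw [hw]
  simp only [mul_add, sub_mul, smul_mul_assoc, mul_smul_comm, one_mul, mul_one, sq_eq u]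
  module

end QuaternionNorm

section Albert

variable {F : Type} [Field F]

theorem exists_tq_eq_one {c b : F} (h : Aniso c b) (h2 : (2 : F) = 0)
    {x : QuaternionAlgebra F (-c) 1 b} (hx : ∀ a : F, x ≠ a • 1) (hT : tq x = 0) (t : F) :
    ∃ y : QuaternionAlgebra F (-c) 1 b, tq y = 1 ∧ tq (y * star x) = t := by
  obtain ⟨r, p, q, s⟩ := x
  have hp : p = 0 := by simpa [tq, h2] using hT
  subst hp
  have hb := h.ne_zero
  by_cases hq : q = 0
  · have hs : s ≠ 0 := by
      rintro rfl
      apply hx r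
      ext <;> simp [hq]
    refine ⟨⟨0, 1, (t - r) / (b * s), 0⟩, by simp [tq], ?_⟩
    subst hq
    simp [tq]
    field_simp
    linear_combination (r - t) * h2
  · refine ⟨⟨0, 1, 0, (t - r) / (b * q)⟩, by simp [tq], ?_⟩
    simp [tq]
    field_simp
    linear_combination (c * r * s - c * t * s - t * q + r * q) * h2

/-- Noncentral quaternions with equal trace and norm give a common separable quadratic
subalgebra. -/
theorem exists_common_of_eq {c1 b1 c2 b2 : F} (H1 : Aniso c1 b1) (H2 : Aniso c2 b2)
    {x1 : QuaternionAlgebra F (-c1) 1 b1} {x2 : QuaternionAlgebra F (-c2) 1 b2}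
    (hx1 : ∀ a : F, x1 ≠ a • 1) (hx2 : ∀ a : F, x2 ≠ a • 1) (hT : tq x1 = tq x2)
    (hN : nq x1 = nq x2) :
    ∃ (c : F) (z1 : QuaternionAlgebra F (-c1) 1 b1) (z2 : QuaternionAlgebra F (-c2) 1 b2),
      (∀ a : F, z1 ≠ a • 1) ∧ (∀ a : F, z2 ≠ a • 1) ∧ z1 * z1 = z1 - c • 1 ∧
        z2 * z2 = z2 - c • 1 := by
  by_cases h0 : tq x1 = 0
  · by_cases h2 : (2 : F) = 0
    · obtain ⟨y1, hy1, hy1'⟩ := exists_tq_eq_one H1 h2 hx1 h0 1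
      obtain ⟨y2, hy2, hy2'⟩ := exists_tq_eq_one H2 h2 hx2 (hT ▸ h0) 0
      have hns : ∀ {c b : F} {z : QuaternionAlgebra F (-c) 1 b}, tq z = 1 → ∀ a : F, z ≠ a • 1 := by
        rintro c b z hz a rfl
        simp [tq, h2] at hz
      have ht1 : tq (y1 + (nq y2 - nq y1) • x1) = 1 := by rw [tq_add, tq_smul, hy1, h0]; ring
      have ht2 : tq (y2 + (nq y2 - nq y1) • x2) = 1 := by rw [tq_add, tq_smul, hy2, ← hT, h0]; ring
      refine ⟨nq (y1 + (nq y2 - nq y1) • x1), _, _, hns ht1, hns ht2, ?_, ?_⟩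
      · rw [sq_eq, ht1, one_smul]
      · rw [sq_eq, ht2, one_smul, nq_add_smul, nq_add_smul, hy1', hy2', hN]
        congr 2
        ring
    · obtain ⟨e, he⟩ : ∃ e : F, e + e = 1 := ⟨2⁻¹, by rw [← two_mul, mul_inv_cancel₀ h2]⟩
      have key : ∀ {c b : F} {z : QuaternionAlgebra F (-c) 1 b}, (∀ a : F, z ≠ a • 1) → tq z = 0 →
          (∀ a : F, z + e • 1 ≠ a • 1) ∧ (z + e • 1) * (z + e • 1) =
            z + e • 1 - (e * e + nq z) • 1 := by
        intro c b z hz hz0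
        refine ⟨fun a ha => hz (a - e) ?_, ?_⟩
        · rw [sub_smul, ← ha]; abel
        · have h4 : e • (1 : QuaternionAlgebra F (-c) 1 b) = (e * e + e * e) • 1 := by
            rw [← mul_add, he, mul_one]
          have h5 : z = e • z + e • z := by rw [← add_smul, he, one_smul]
          simp only [mul_add, add_mul, smul_mul_assoc, mul_smul_comm, mul_one, one_mul, sq_eq z, hz0]
          linear_combination (norm := module) -h5 - h4
      obtain ⟨h3, h4⟩ := key hx1 h0
      obtain ⟨h5, h6⟩ := key hx2 (hT ▸ h0)
      exact ⟨_, _, _, h3, h5, h4, hN ▸ h6⟩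
  · have key : ∀ {c b : F} {z : QuaternionAlgebra F (-c) 1 b}, (∀ a : F, z ≠ a • 1) → tq z ≠ 0 →
        (∀ a : F, (tq z)⁻¹ • z ≠ a • 1) ∧ ((tq z)⁻¹ • z) * ((tq z)⁻¹ • z) =
          (tq z)⁻¹ • z - ((tq z)⁻¹ * (tq z)⁻¹ * nq z) • 1 := by
      intro c b z hz hz0
      refine ⟨fun a ha => hz (tq z * a) ?_, ?_⟩
      · rw [mul_smul, ← ha, smul_smul, mul_inv_cancel₀ hz0, one_smul]
      · rw [smul_mul_smul_comm, sq_eq, smul_sub, smul_smul, smul_smul, mul_assoc,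
          inv_mul_cancel₀ hz0, mul_one]
    obtain ⟨h3, h4⟩ := key hx1 h0
    obtain ⟨h5, h6⟩ := key hx2 (hT ▸ h0)
    rw [← hT, ← hN] at h6
    exact ⟨_, _, _, h3, hT ▸ h5, h4, h6⟩

variable {R : Type} [AddCommGroup R] [Module F R] [Module.Finite F R] [Nontrivial R]

theorem exists_common_value {c1 b1 c2 b2 : F} (H1 : Aniso c1 b1) (H2 : Aniso c2 b2)
    (h1 : QuaternionAlgebra F (-c1) 1 b1 →ₐ[F] Module.End F R)
    (h2 : QuaternionAlgebra F (-c2) 1 b2 →ₐ[F] Module.End F R)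
    (hcomm : ∀ x y, Commute (h1 x) (h2 y)) (hR : finrank F R ≤ 8) :
    ∃ (s : R) (x1 : QuaternionAlgebra F (-c1) 1 b1) (x2 : QuaternionAlgebra F (-c2) 1 b2), s ≠ 0 ∧
      (∀ a : F, x1 ≠ a • 1) ∧ (∀ a : F, x2 ≠ a • 1) ∧ h1 x1 s = h2 x2 s := by
  obtain ⟨s, hs⟩ := exists_ne (0 : R)
  have hc : ∀ x y r, h1 x (h2 y r) = h2 y (h1 x r) := fun x y r => LinearMap.congr_fun (hcomm x y) r
  have hsc1 : ∀ (a : F) r, h1 (a • 1) r = a • r := fun a r => by simp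
  have hsc2 : ∀ (a : F) r, h2 (a • 1) r = a • r := fun a r => by simp
  obtain ⟨θ, hθ⟩ : ∃ θ : QuaternionAlgebra F (-c1) 1 b1, θ = ⟨0, 1, 0, 0⟩ := ⟨_, rfl⟩
  obtain ⟨j, hj⟩ : ∃ j : QuaternionAlgebra F (-c1) 1 b1, j = ⟨0, 0, 1, 0⟩ := ⟨_, rfl⟩
  have hθn : ∀ a : F, θ ≠ a • 1 := fun a ha => by
    have := congrArg QuaternionAlgebra.imI ha
    simp [hθ] at this
  let L : QuaternionAlgebra F (-c2) 1 b2 × QuaternionAlgebra F (-c2) 1 b2 →ₗ[F] R :=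
    (LinearMap.applyₗ s ∘ₗ h2.toLinearMap).coprod (h1 θ ∘ₗ LinearMap.applyₗ s ∘ₗ h2.toLinearMap)
  have hL : ∀ u w, L (u, w) = h2 u s + h1 θ (h2 w s) := fun u w => by simp [L]
  by_cases hinj : Function.Injective L
  · have hsurj : Function.Surjective L := by
      refine (LinearMap.injective_iff_surjective_of_finrank_eq_finrank (le_antisymm
        (LinearMap.finrank_le_finrank_of_injective hinj) ?_)).1 hinj
      rw [Module.finrank_prod, QuaternionAlgebra.finrank_eq_four]
      exact hR
    obtain ⟨⟨u, w⟩, huw⟩ := hsurj (h1 j s)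
    rw [hL] at huw
    have hcuw : u * w = w * u := by
      have e1 : L (u * u + w * u + c1 • (w * w) - b1 • 1, u * w - w * u) = L 0 := by
        have hjj : h1 j (h1 j s) = b1 • s := by
          rw [← Module.End.mul_apply, ← map_mul, ← hsc1]
          congr 2
          rw [hj]; ext <;> simp
        have hjθ : ∀ r, h1 j (h1 θ r) = h1 j r - h1 θ (h1 j r) := fun r => by
          rw [← Module.End.mul_apply, ← Module.End.mul_apply, ← map_mul, ← map_mul,
            ← LinearMap.sub_apply, ← map_sub]
          congr 2
          rw [hj, hθ]; ext <;> simp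
        have hθθ : ∀ r, h1 θ (h1 θ r) = h1 θ r - c1 • r := fun r => by
          rw [← Module.End.mul_apply, ← map_mul, ← hsc1, ← LinearMap.sub_apply, ← map_sub]
          congr 2
          rw [hθ]; ext <;> simp
        have h3 := congrArg (h1 j) huw
        rw [map_add, hjθ, hjj, hc, hc, ← huw] at h3
        simp only [map_add, map_sub, map_smul, hc, hθθ] at h3
        rw [hL, map_zero]
        simp only [map_sub, map_add, map_smul, map_mul, map_one, LinearMap.sub_apply, hc,
          LinearMap.add_apply, LinearMap.smul_apply, Module.End.one_apply, Module.End.mul_apply]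
        linear_combination (norm := module) h3
      have := hinj e1
      exact sub_eq_zero.1 (Prod.ext_iff.1 this).2
    obtain ⟨X, P, l, hP, hl, hX⟩ : ∃ (X P : QuaternionAlgebra F (-c1) 1 b1)
        (l : QuaternionAlgebra F (-c2) 1 b2), P ≠ 0 ∧ (∀ a : F, l ≠ a • 1) ∧
          h1 X s = h1 P (h2 l s) := by
      by_cases hu : ∀ a : F, u ≠ a • 1
      · obtain ⟨γ, δ, rfl⟩ := H2.centralizer hu hcuw
        refine ⟨j - γ • θ, 1 + δ • θ, u, ?_, hu, ?_⟩
        · intro h0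
          have := congrArg QuaternionAlgebra.re h0
          simp [hθ] at this
        · simp only [map_sub, map_add, map_smul, map_one, LinearMap.sub_apply, LinearMap.add_apply,
            LinearMap.smul_apply, Module.End.one_apply] at huw ⊢
          rw [← huw]
          abel
      · push Not at hu
        obtain ⟨α, rfl⟩ := hu
        by_cases hw : ∀ a : F, w ≠ a • 1
        · refine ⟨j - α • 1, θ, w, fun h0 => hθn 0 (by rw [h0, zero_smul]), hw, ?_⟩
          rw [map_sub, LinearMap.sub_apply, hsc1, ← huw, hsc2, add_sub_cancel_left]
        · push Not at hw
          obtain ⟨γ, rfl⟩ := hw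
          have h3 : h1 (j - α • 1 - γ • θ) s = 0 := by
            rw [map_sub, map_sub, LinearMap.sub_apply, LinearMap.sub_apply, hsc1, ← huw, hsc2, hsc2,
              map_smul, map_smul, LinearMap.smul_apply]
            abel
          have := congrArg QuaternionAlgebra.imJ (H1.eq_zero_of_apply h1 hs h3)
          simp [hj, hθ] at this
    have hX' : h1 ((nq P)⁻¹ • star P * X) s = h2 l s := by
      rw [map_mul, Module.End.mul_apply, hX, ← Module.End.mul_apply, ← map_mul, H1.exists_inv hP,
        map_one, Module.End.one_apply]
    refine ⟨s, _, l, hs, fun a ha => hl a ?_, hl, hX'⟩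
    rw [ha, hsc1, ← hsc2] at hX'
    rw [← sub_eq_zero]
    exact H2.eq_zero_of_apply h2 hs (by rw [map_sub, LinearMap.sub_apply, hX', sub_self])
  · rw [injective_iff_map_eq_zero] at hinj
    push Not at hinj
    obtain ⟨⟨u, w⟩, h0, hne⟩ := hinj
    rw [hL] at h0
    have hw : w ≠ 0 := by
      rintro rfl
      rw [map_zero, LinearMap.zero_apply, map_zero, add_zero] at h0
      exact hne (by rw [H2.eq_zero_of_apply h2 hs h0]; rfl)
    have hX : h1 θ s = h2 (-((nq w)⁻¹ • star w * u)) s := by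
      rw [hc] at h0
      rw [map_neg, map_mul, LinearMap.neg_apply, Module.End.mul_apply,
        eq_neg_of_add_eq_zero_left h0, map_neg, neg_neg, ← Module.End.mul_apply, ← map_mul,
        H2.exists_inv hw, map_one, Module.End.one_apply]
    refine ⟨s, θ, _, hs, hθn, fun a ha => hθn a ?_, hX⟩
    rw [ha, hsc2, ← hsc1] at hX
    rw [← sub_eq_zero]
    exact H1.eq_zero_of_apply h1 hs (by rw [map_sub, LinearMap.sub_apply, hX, sub_self])

/-- Two commuting division quaternion algebras acting on a space of dimension at most `8`
have a common separable quadratic subfield. -/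
theorem exists_common_subfield {c1 b1 c2 b2 : F} (H1 : Aniso c1 b1) (H2 : Aniso c2 b2)
    (h1 : QuaternionAlgebra F (-c1) 1 b1 →ₐ[F] Module.End F R)
    (h2 : QuaternionAlgebra F (-c2) 1 b2 →ₐ[F] Module.End F R)
    (hcomm : ∀ x y, Commute (h1 x) (h2 y)) (hR : finrank F R ≤ 8) :
    ∃ (c : F) (z1 : QuaternionAlgebra F (-c1) 1 b1) (z2 : QuaternionAlgebra F (-c2) 1 b2),
      (∀ a : F, z1 ≠ a • 1) ∧ (∀ a : F, z2 ≠ a • 1) ∧ z1 * z1 = z1 - c • 1 ∧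
        z2 * z2 = z2 - c • 1 := by
  obtain ⟨s, x1, x2, hs, hx1, hx2, hx⟩ := exists_common_value H1 H2 h1 h2 hcomm hR
  have hc : ∀ x y r, h1 x (h2 y r) = h2 y (h1 x r) := fun x y r => LinearMap.congr_fun (hcomm x y) r
  have e1 : h1 (x1 * x1) s = h2 (x2 * x2) s := by
    rw [map_mul, map_mul, Module.End.mul_apply, Module.End.mul_apply, hx, hc, hx]
  rw [sq_eq, sq_eq] at e1
  have e2 : (tq x1 - tq x2) • x1 + (nq x2 - nq x1) • 1 = 0 := by
    apply H1.eq_zero_of_apply h1 hs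
    simp only [map_sub, map_add, map_smul, map_one, LinearMap.sub_apply, LinearMap.add_apply,
      LinearMap.smul_apply, Module.End.one_apply] at e1 ⊢
    rw [← hx] at e1
    linear_combination (norm := module) e1
  have hT : tq x1 = tq x2 := by
    by_contra hT
    have hT := sub_ne_zero.2 hT
    apply hx1 ((tq x1 - tq x2)⁻¹ * (nq x1 - nq x2))
    rw [mul_smul, ← neg_sub (nq x2), neg_smul, ← eq_neg_of_add_eq_zero_left e2, smul_smul,
      inv_mul_cancel₀ hT, one_smul]
  refine exists_common_of_eq H1 H2 hx1 hx2 hT ?_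
  rw [hT, sub_self, zero_smul, zero_add] at e2
  have := congrArg QuaternionAlgebra.re e2
  simp at this
  exact (sub_eq_zero.1 this).symm

end Albert

section Semilinear

variable {F K : Type} [Field F] [Field K] [Algebra F K] {c : F}

theorem QExt.exists_lift (E : QExt F K c) {B : Type} [Ring B] [Algebra F B] {z : B}
    (hz : z * z = z - c • 1) : ∃ f : K →ₐ[F] B, f E.ω = z := by
  let g : QuadraticAlgebra F (-c) 1 →ₐ[F] K := QuadraticAlgebra.lift ⟨E.ω, by
    rw [E.sq, Algebra.algebraMap_eq_smul_one]; module⟩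
  let f : QuadraticAlgebra F (-c) 1 →ₐ[F] B := QuadraticAlgebra.lift ⟨z, by rw [hz]; module⟩
  have hg : ∀ x, g x = algebraMap F K x.re + algebraMap F K x.im * E.ω := fun x => by
    simp [g, QuadraticAlgebra.lift, Algebra.smul_def]
  have hbij : Function.Bijective g := by
    refine ⟨(injective_iff_map_eq_zero g).2 fun x hx => ?_, fun x => ?_⟩
    · rw [hg] at hx
      obtain ⟨h1, h2⟩ := E.ind _ _ hx
      exact QuadraticAlgebra.ext h1 h2
    · obtain ⟨a, b, rfl⟩ := E.repr x
      exact ⟨⟨a, b⟩, hg _⟩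
  have hω : (AlgEquiv.ofBijective g hbij).symm E.ω = QuadraticAlgebra.omega := by
    rw [AlgEquiv.symm_apply_eq]
    simp [g, QuadraticAlgebra.lift]
  refine ⟨f.comp (AlgEquiv.ofBijective g hbij).symm.toAlgHom, ?_⟩
  simp [hω, f, QuadraticAlgebra.lift]

theorem QExt.finrank_eq (E : QExt F K c) : finrank F K = 2 := by
  let f : F × F →ₗ[F] K := (LinearMap.toSpanSingleton F K 1).coprod (LinearMap.toSpanSingleton F K E.ω)
  have hf : ∀ p, f p = algebraMap F K p.1 + algebraMap F K p.2 * E.ω := fun p => by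
    simp [f, Algebra.smul_def]
  have hbij : Function.Bijective f := by
    refine ⟨(injective_iff_map_eq_zero f).2 fun x hx => ?_, fun x => ?_⟩
    · rw [hf] at hx
      obtain ⟨h1, h2⟩ := E.ind _ _ hx
      exact Prod.ext h1 h2
    · obtain ⟨a, b, rfl⟩ := E.repr x
      exact ⟨⟨a, b⟩, hf _⟩
  rw [← (LinearEquiv.ofBijective f hbij).finrank_eq]
  simp

theorem QExt.finite (E : QExt F K c) : Module.Finite F K :=
  Module.finite_of_finrank_pos (by rw [E.finrank_eq]; norm_num)

/-- `A` has a module of dimension `d` over `K` with a commuting conjugate-linear map whose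
square is `β`. -/
def KRep (E : QExt F K c) (A : Type) [Ring A] [Algebra F A] (d : ℕ) (β : F) : Prop :=
  ∃ (V : Type) (_ : AddCommGroup V) (_ : Module K V) (_ : Module F V) (_ : IsScalarTower F K V)
    (_ : Module.Finite K V) (τ : A →ₐ[F] Module.End K V) (J : V →ₗ[F] V),
    finrank K V = d ∧ (∀ v, J (J v) = β • v) ∧ (∀ (k : K) v, J (k • v) = E.conj k • J v) ∧
      ∀ a v, J (τ a v) = τ a (J v)

variable {A : Type} [Ring A] [Algebra F A]

theorem SplitRep.kRep (h : SplitRep F A) (E : QExt F K c) : KRep E A (deg F A) 1 := by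
  obtain ⟨V, _, _, _, hd, ⟨τ⟩⟩ := h
  refine ⟨K ⊗[F] V, _, _, _, inferInstance, inferInstance,
    (Module.End.baseChangeHom F K V).comp τ, E.J V, ?_, ?_, E.J_smul, ?_⟩
  · rw [Module.finrank_baseChange, hd]
  · exact fun v => by rw [E.J_J, one_smul]
  · intro a v
    induction v with
    | zero => simp
    | add x x' hx hx' => simp only [map_add, hx, hx']
    | tmul b u => rfl

/-- A quaternion algebra acting on a space gives a conjugate-linear map. -/
theorem kRep_of_quaternion {D V : Type} [Ring D] [Algebra F D] [AddCommGroup V] [Module F V]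
    [Module.Finite F V] (E : QExt F K c) {d : ℕ} (hd : finrank F V = 2 * d)
    (τ : A →ₐ[F] Module.End F V) (g : D →ₐ[F] Module.End F V) (hc : ∀ a x, Commute (τ a) (g x))
    {z j : D} {β : F} (hz : z * z = z - c • 1) (hjz : j * z = j - z * j) (hj : j * j = β • 1) :
    KRep E A d β := by
  obtain ⟨f, hf⟩ := E.exists_lift (z := g z) (by rw [← map_mul, hz, map_sub, map_smul, map_one])
  let _ : Module K V := Module.compHom V f.toRingHom
  have hsm : ∀ (k : K) (v : V), k • v = f k v := fun _ _ => rfl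
  have : IsScalarTower F K V := ⟨fun a k v => by rw [hsm, hsm, map_smul, LinearMap.smul_apply]⟩
  have hfin := E.finite
  have : Module.Finite K V := Module.Finite.of_restrictScalars_finite F K V
  have hc' : ∀ a x v, τ a (g x v) = g x (τ a v) := fun a x v => LinearMap.congr_fun (hc a x) v
  have hform : ∀ (k : K), ∃ x y : F, k = algebraMap F K x + algebraMap F K y * E.ω ∧
      ∀ v, k • v = x • v + y • g z v := by
    intro k
    obtain ⟨x, y, rfl⟩ := E.repr k
    refine ⟨x, y, rfl, fun v => ?_⟩
    rw [hsm, map_add, map_mul, hf, f.commutes, f.commutes]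
    simp [Algebra.algebraMap_eq_smul_one]
  refine ⟨V, _, _, _, inferInstance, inferInstance,
    { toFun := fun a => { toFun := τ a, map_add' := map_add _, map_smul' := ?_ }
      map_one' := by ext; simp
      map_mul' := fun x y => by ext; simp
      map_zero' := by ext; simp
      map_add' := fun x y => by ext; simp
      commutes' := fun r => by ext v; simp [Algebra.algebraMap_eq_smul_one] }, g j, ?_, ?_, ?_, ?_⟩
  · intro k v
    obtain ⟨x, y, -, h⟩ := hform k
    simp only [h, map_add, map_smul, hc', RingHom.id_apply]
  · have := Module.finrank_mul_finrank F K V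
    rw [hd, E.finrank_eq] at this
    omega
  · intro v
    rw [← Module.End.mul_apply, ← map_mul, hj, map_smul, map_one, LinearMap.smul_apply,
      Module.End.one_apply]
  · intro k v
    obtain ⟨x, y, hk, h⟩ := hform k
    have hjz' : g j (g z v) = g j v - g z (g j v) := by
      rw [← Module.End.mul_apply, ← map_mul, hjz, map_sub, map_mul, LinearMap.sub_apply,
        Module.End.mul_apply]
    have hω : ∀ u, E.ω • u = g z u := fun u => by rw [hsm, hf]
    have h1 : E.conj k • g j v = x • g j v + y • (g j v - g z (g j v)) := by
      rw [hk, map_add, map_mul, AlgEquiv.commutes, AlgEquiv.commutes, E.conj_ω, add_smul, mul_smul,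
        sub_smul, one_smul, hω, algebraMap_smul, algebraMap_smul]
    rw [h, map_add, map_smul, map_smul, hjz', h1]
  · intro a v
    exact (hc' a j v).symm

theorem QuatRep.kRep {c' b' : F} (h : QuatRep F A c' b') (E : QExt F K c)
    {z : QuaternionAlgebra F (-c') 1 b'} (hzn : ∀ a : F, z ≠ a • 1) (hz : z * z = z - c • 1) :
    ∃ β : F, β ≠ 0 ∧ KRep E A (deg F A) β := by
  obtain ⟨H, V, _, _, _, τ, g, hd, hc⟩ := h
  obtain ⟨y, hy⟩ := H.exists_not_commute hzn
  obtain ⟨j, hj⟩ : ∃ j, j = z * y - y * z := ⟨_, rfl⟩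
  have hj0 : j ≠ 0 := by rw [hj]; exact sub_ne_zero.2 hy
  have hjz : j * z = j - z * j := by
    rw [hj, sub_mul, mul_sub, ← mul_assoc z z y, mul_assoc y z z, hz, mul_sub, sub_mul,
      mul_smul_comm, smul_mul_assoc, mul_one, one_mul, mul_assoc]
    abel
  have htj : tq j = 0 := by
    rw [hj, sub_eq_add_neg, ← neg_one_smul F (y * z), tq_add, tq_smul, tq_mul_comm y z]
    ring
  refine ⟨-nq j, neg_ne_zero.2 (H.nq_ne_zero hj0), kRep_of_quaternion E hd τ g hc hz hjz ?_⟩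
  rw [sq_eq, htj]
  module

/-- A separable quadratic subalgebra of a division quaternion algebra is a field. -/
theorem Aniso.rootless {c' b' : F} (H : Aniso c' b')
    {z : QuaternionAlgebra F (-c') 1 b'} (hzn : ∀ a : F, z ≠ a • 1) (hz : z * z = z - c • 1)
    (x : F) : x * x - x + c ≠ 0 := by
  intro h0
  have h1 : (z - x • 1) * (z - (1 - x) • 1) = 0 := by
    simp only [mul_sub, sub_mul, hz, mul_smul_comm, smul_mul_assoc, mul_one, one_mul]
    have : (x * x - x + c) • (1 : QuaternionAlgebra F (-c') 1 b') = 0 := by rw [h0, zero_smul]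
    linear_combination (norm := module) -this
  exact H.mul_ne_zero (sub_ne_zero.2 (hzn _)) (sub_ne_zero.2 (hzn _)) h1

theorem i_not_scalar {c' b' : F} (a : F) : (⟨0, 1, 0, 0⟩ : QuaternionAlgebra F (-c') 1 b') ≠ a • 1 := by
  intro ha
  have := congrArg QuaternionAlgebra.imI ha
  simp at this

theorem i_sq {c' b' : F} : (⟨0, 1, 0, 0⟩ : QuaternionAlgebra F (-c') 1 b') * ⟨0, 1, 0, 0⟩ =
    ⟨0, 1, 0, 0⟩ - c' • 1 := by
  ext <;> simp

theorem QuatRep.kRep_self {c' b' : F} (h : QuatRep F A c' b') (E : QExt F K c') :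
    KRep E A (deg F A) b' := by
  obtain ⟨H, V, _, _, _, τ, g, hd, hc⟩ := h
  refine kRep_of_quaternion E hd τ g hc (z := ⟨0, 1, 0, 0⟩) (j := ⟨0, 0, 1, 0⟩) i_sq ?_ ?_
  · ext <;> simp
  · ext <;> simp

end Semilinear

section IsotropicIdeal

variable {F K A V : Type} [Field F] [Field K] [Algebra F K] [Ring A] [Algebra F A]
  [AddCommGroup V] [Module K V] [Module F V] [IsScalarTower F K V] [Module.Finite K V]
  [Nontrivial V] {T : A →ₗ[F] F} {σ : A →ₗ[F] A} {ℓ : A} {τ : A →ₐ[F] Module.End K V}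
  {b : V →ₗ[K] V →ₗ[K] K} {c : F}

omit [Nontrivial V] in
/-- The trace form vanishes on self-adjoint endomorphisms with totally isotropic image. -/
theorem QS.trace_eq_zero (h : QS T σ τ b 1) {W : Submodule K V}
    (hW : ∀ w ∈ W, beta τ b ℓ w w = 0) {x : A} (hx : ∀ v, τ x v ∈ W) (hs : σ x = x) :
    T (ℓ * x) = 0 := by
  obtain ⟨e, e', he⟩ := exists_dualBases h.nd h.symm
  obtain ⟨p, hp⟩ := LinearMap.exists_leftInverse_of_injective W.subtype W.ker_subtype
  obtain ⟨P, hP⟩ : ∃ P : Module.End K V, P = W.subtype ∘ₗ p := ⟨_, rfl⟩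
  have hPW : ∀ w ∈ W, P w = w := fun w hw => by
    have := LinearMap.congr_fun hp ⟨w, hw⟩
    rw [hP]
    exact congrArg Subtype.val this
  have hPm : ∀ v, P v ∈ W := fun v => by rw [hP]; exact (p v).2
  have hsa : ∀ v w, b (τ x v) w = b v (τ x w) := fun v w => by rw [h.adj, hs]
  have hX : τ x = ∑ i, psi b (τ x (e i)) (P (e' i)) := by
    ext y
    rw [← sub_eq_zero]
    refine h.nd _ fun z => ?_
    have h1 : ∑ i, b (e i) (τ x z) * b (P (e' i)) y = b (P (τ x z)) y := by
      conv_rhs => rw [← he.2 (τ x z)]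
      simp
    rw [hPW _ (hx z)] at h1
    simp only [map_sub, LinearMap.sub_apply, LinearMap.sum_apply, psi_apply, map_sum, map_smul,
      LinearMap.smul_apply, hsa (e _), smul_eq_mul]
    simp only [mul_comm (b (e _) _)] at h1
    rw [h1, hsa, h.symm, sub_self]
  have hL : ∀ v w, h.spans.ext (trK K T) (τ ℓ * psi b v w) = beta τ b ℓ w v := fun v w => by
    rw [mul_psi, h.tr, one_mul, h.symm, beta_apply]
  have h2 : psiLift e e' ((beta τ b ℓ).flip.compl₁₂ P P) (τ x) = 0 :=
    he.apply_eq_zero _ (fun v => by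
      rw [he.psiLift_psi h.symm]
      exact hW _ (hPm v)) _ h.symm hsa
  rw [psiLift_apply] at h2
  apply (algebraMap F K).injective
  have h3 : h.spans.ext (trK K T) (τ (ℓ * x)) = algebraMap F K (T (ℓ * x)) := by
    rw [h.spans.ext_apply]; rfl
  rw [← h3, map_mul, map_zero, ← h2, hX, Finset.mul_sum, map_sum, ← hX]
  refine Finset.sum_congr rfl fun i _ => ?_
  rw [hL, LinearMap.compl₁₂_apply, LinearMap.flip_apply, hPW _ (hx _)]

omit [Nontrivial V] [Module.Finite K V] in
theorem Spans.injective (hτ : Spans τ) : Function.Injective τ := by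
  intro x y hxy
  have h1 : ∀ z, csaLift (K := K) τ (1 ⊗ₜ z) = τ z := fun z => by rw [csaLift_tmul, one_smul]
  have := hτ.1 ((h1 x).trans (hxy.trans (h1 y).symm))
  exact (Module.FaithfullyFlat.tensorProduct_mk_injective (A := F) (B := K) A) this

omit [Nontrivial V] in
/-- The elements of `A` mapping into a totally isotropic subspace form an isotropic ideal. -/
theorem QS.isotropic (h : QS T σ τ b 1) (hℓ : ℓ + σ ℓ = 1) {W : Submodule K V}
    (hW : ∀ w ∈ W, beta τ b ℓ w w = 0) {x : A} (hx : ∀ v, τ x v ∈ W) (hx0 : x ≠ 0) :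
    QPIsotropic F A T σ ℓ := by
  let I : Submodule F A :=
    { carrier := {a | ∀ v, τ a v ∈ W}
      zero_mem' := fun v => by simp
      add_mem' := fun {a a'} ha ha' v => by
        rw [map_add]; exact W.add_mem (ha v) (ha' v)
      smul_mem' := fun r a ha v => by
        rw [map_smul, LinearMap.smul_apply, ← algebraMap_smul K]; exact W.smul_mem _ (ha v) }
  refine ⟨I, ⟨fun x hx a v => ?_, fun x hx y hy => ?_, fun x hx hs => h.trace_eq_zero hW hx hs⟩,
    fun hI => hx0 ?_⟩
  · rw [map_mul]
    exact hx _
  · apply h.spans.injective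
    rw [map_zero]
    ext w
    refine h.nd _ fun v => ?_
    rw [h.symm, map_mul, Module.End.mul_apply, ← h.adj, ← h.pol_beta hℓ, pol_apply]
    have h1 := hW _ (W.add_mem (hx v) (hy w))
    simp only [map_add, LinearMap.add_apply, hW _ (hx v), hW _ (hy w)] at h1
    linear_combination h1
  · have : x ∈ I := hx
    rwa [hI, Submodule.mem_bot] at this

theorem QS.exists_multiplier (h : QS T σ τ b 1) (E : QExt F K c) {J : V →ₗ[F] V}
    (hJs : Function.Surjective J) (hJ : ∀ (k : K) v, J (k • v) = E.conj k • J v)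
    (hJA : ∀ a v, J (τ a v) = τ a (J v)) :
    ∃ κ : K, κ ≠ 0 ∧ ∀ v w, b (J v) (J w) = κ * E.conj (b v w) := by
  let b' : V →ₗ[K] V →ₗ[K] K := LinearMap.mk₂ K (fun v w => E.conj (b (J v) (J w)))
    (fun v v' w => by simp) (fun k v w => by simp [hJ, E.conj_conj])
    (fun v w w' => by simp) (fun k v w => by simp [hJ, E.conj_conj])
  have hb' : ∀ v w, b' v w = E.conj (b (J v) (J w)) := fun _ _ => rfl
  obtain ⟨κ, hκ⟩ := form_unique h.spans h.nd h.adj (b' := b') (fun a v w => by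
    rw [hb', hb', hJA, hJA, h.adj])
  have hb : ∀ v w, b (J v) (J w) = E.conj κ * E.conj (b v w) := fun v w => by
    rw [← map_mul, ← hκ, hb', E.conj_conj]
  refine ⟨E.conj κ, fun h0 => ?_, hb⟩
  obtain ⟨v, hv⟩ := exists_ne (0 : V)
  apply hv
  obtain ⟨u, rfl⟩ := hJs v
  refine h.nd _ fun w => ?_
  obtain ⟨w, rfl⟩ := hJs w
  rw [hb, h0, zero_mul]

omit [Nontrivial V] [Module.Finite K V] in
theorem QS.beta_semilinear (E : QExt F K c) {J : V →ₗ[F] V}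
    (hJA : ∀ a v, J (τ a v) = τ a (J v)) {κ : K} (hb : ∀ v w, b (J v) (J w) = κ * E.conj (b v w))
    (v w : V) : beta τ b ℓ (J v) (J w) = κ * E.conj (beta τ b ℓ v w) := by
  rw [beta_apply, beta_apply, ← hJA, hb]

omit [Nontrivial V] [Module.Finite K V] in
/-- Descent of endomorphisms with image in a stable subspace. -/
theorem Spans.exists_ne_zero (hτ : Spans τ) (E : QExt F K c) {J : V →ₗ[F] V}
    (hJs : Function.Surjective J) (hJ : ∀ (k : K) v, J (k • v) = E.conj k • J v)
    (hJA : ∀ a v, J (τ a v) = τ a (J v)) {W : Submodule K V} (hW : ∀ w ∈ W, J w ∈ W)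
    {X : Module.End K V} (hX0 : X ≠ 0) (hX : ∀ v, X v ∈ W) : ∃ x, x ≠ 0 ∧ ∀ v, τ x v ∈ W := by
  obtain ⟨ι, k, s, a, -, ha⟩ := hτ.exists_sum X
  choose p q hpq using fun i => E.repr (k i)
  have hX1 : ∀ v, X v = τ (∑ i ∈ s, p i • a i) v + E.ω • τ (∑ i ∈ s, q i • a i) v := by
    intro v
    rw [ha]
    simp only [map_sum, map_smul, LinearMap.sum_apply, LinearMap.smul_apply, Finset.smul_sum,
      ← Finset.sum_add_distrib]
    refine Finset.sum_congr rfl fun i _ => ?_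
    rw [hpq i, add_smul, mul_comm, mul_smul, algebraMap_smul, algebraMap_smul]
  obtain ⟨a0, ha0⟩ : ∃ a0, a0 = ∑ i ∈ s, p i • a i := ⟨_, rfl⟩
  obtain ⟨a1, ha1⟩ : ∃ a1, a1 = ∑ i ∈ s, q i • a i := ⟨_, rfl⟩
  rw [← ha0, ← ha1] at hX1
  have h2 : (1 : K) - 2 * E.ω ≠ 0 := by
    intro h0
    have h1 := E.ind 1 (-2) (by rw [← h0]; simp [map_ofNat, sub_eq_add_neg])
    exact one_ne_zero h1.1
  have hm1 : ∀ u, τ a1 u ∈ W := by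
    intro u
    obtain ⟨v, rfl⟩ := hJs u
    have e1 := hX (J v)
    have e2 := hW _ (hX v)
    rw [hX1] at e1 e2
    rw [map_add, hJ, hJA, hJA, E.conj_ω] at e2
    have e3 := W.smul_mem ((1 : K) - 2 * E.ω)⁻¹ (W.sub_mem e2 e1)
    have e4 : ((1 : K) - 2 * E.ω)⁻¹ • (τ a0 (J v) + (1 - E.ω) • τ a1 (J v) -
        (τ a0 (J v) + E.ω • τ a1 (J v))) = τ a1 (J v) := by
      rw [add_sub_add_left_eq_sub, ← sub_smul, smul_smul, show 1 - E.ω - E.ω = 1 - 2 * E.ω by ring,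
        inv_mul_cancel₀ h2, one_smul]
    rwa [e4] at e3
  have hm0 : ∀ u, τ a0 u ∈ W := by
    intro u
    have := W.sub_mem (hX u) (W.smul_mem E.ω (hm1 u))
    rwa [hX1, add_sub_cancel_right] at this
  by_cases h0 : a0 = 0
  · refine ⟨a1, ?_, hm1⟩
    rintro rfl
    apply hX0
    ext v
    rw [hX1, h0]
    simp
  · exact ⟨a0, h0, hm0⟩

end IsotropicIdeal

section Assembly

variable {F K A C : Type} [Field F] [Field K] [Algebra F K] [Ring A] [Algebra F A] [Ring C]
  [Algebra F C] {T : A →ₗ[F] F} {σ : A →ₗ[F] A} {ℓ : A} {c : F}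

theorem isotropic_of_kRep (hF : RepAll F) (E : QExt F K c) (hA : IsCSA F A)
    (hT : IsReducedTrace F A T) (hqp : IsQuadraticPair F A T σ ℓ) {m d : ℕ} (hm : 3 ≤ m)
    (hdeg : deg F A = 2 * m) (hd0 : 0 < d) (hd : d ≤ 2 ^ (m - 1))
    (φ : CliffordAlg F A T σ ℓ →ₐ[F] C) {β β' : F} (hβ : β ≠ 0)
    (hKA : KRep E A (deg F A) β) (hKC : KRep E C d β') : QPIsotropic F A T σ ℓ := by
  obtain ⟨V, _, _, _, _, _, τ, J, hV, hJJ, hJ, hJA⟩ := hKA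
  obtain ⟨S, _, _, _, _, _, ρ, -, hS, -⟩ := hKC
  have : Nontrivial V := Module.nontrivial_of_finrank_pos (R := K) (by omega)
  have : Nontrivial S := Module.nontrivial_of_finrank_pos (R := K) (by omega)
  have hℓ := hqp.2.2.2
  obtain ⟨b, h⟩ := exists_QS_one hA hT hqp hV τ (ρ.comp φ)
  have hJs : Function.Surjective J := fun v => ⟨β⁻¹ • J v, by
    rw [map_smul, hJJ, smul_smul, inv_mul_cancel₀ hβ, one_smul]⟩
  obtain ⟨κ, hκ, hb⟩ := h.exists_multiplier E hJs hJ hJA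
  obtain ⟨U, hU, hU0⟩ := lagProp m (by omega) K (E.repAll hF) V S _ _
    (h.fwd_isECM hA (ρ.comp φ)) (h.nondeg hℓ) (hV.trans hdeg) inferInstance (hS ▸ hd)
  obtain ⟨u, hu0, hu⟩ := E.herm hF (U := U) (by omega)
    (fun u => (b (J u)).domRestrict U) (κ * algebraMap F K β⁻¹)
    (mul_ne_zero hκ (by simpa using hβ)) (fun u w => by
      have h1 := hb (J w) u
      rw [hJJ, ← algebraMap_smul K β, map_smul, LinearMap.smul_apply, smul_eq_mul, h.symm] at h1
      change b (J u) w = κ * algebraMap F K β⁻¹ * E.conj (b (J w) u)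
      rw [mul_right_comm, ← h1, mul_comm, ← mul_assoc, ← map_mul, inv_mul_cancel₀ hβ, map_one,
        one_mul])
  change b (J u) u = 0 at hu
  have hu0' : (u : V) ≠ 0 := fun h0 => hu0 (Subtype.ext h0)
  have hq := hU0 u u.2
  have hqJ : beta τ b ℓ (J u) (J u) = 0 := by
    rw [QS.beta_semilinear E hJA hb, hq, map_zero, mul_zero]
  have hW : ∀ w ∈ Submodule.span K {(u : V), J u}, beta τ b ℓ w w = 0 := by
    intro w hw
    obtain ⟨x, y, rfl⟩ := Submodule.mem_span_pair.1 hw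
    have h1 : beta τ b ℓ u (J u) + beta τ b ℓ (J u) u = 0 := by
      rw [← pol_apply, h.pol_beta hℓ, h.symm, hu]
    simp only [map_add, map_smul, LinearMap.add_apply, LinearMap.smul_apply, smul_eq_mul, hq, hqJ]
    linear_combination x * y * h1
  obtain ⟨v, hv⟩ : ∃ v, b v u ≠ 0 := by
    by_contra! H
    exact hu0' (h.nd _ fun w => by rw [h.symm, H])
  obtain ⟨x, hx0, hx⟩ := h.spans.exists_ne_zero E hJs hJ hJA
    (W := Submodule.span K {(u : V), J u}) (fun w hw => by
      obtain ⟨x, y, rfl⟩ := Submodule.mem_span_pair.1 hw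
      rw [map_add, hJ, hJ, hJJ, ← algebraMap_smul K β, smul_smul]
      exact Submodule.mem_span_pair.2 ⟨E.conj y * algebraMap F K β, E.conj x, by abel⟩)
    (X := psi b (u : V) v) (fun h0 => by
      have := LinearMap.congr_fun h0 (u : V)
      rw [psi_apply] at this
      exact (smul_ne_zero hv hu0') this)
    (fun w => by
      rw [psi_apply]
      exact Submodule.smul_mem _ _ (Submodule.subset_span (by simp)))
  exact h.isotropic hℓ hW hx hx0

/-- The split case over a field without separable quadratic extensions. -/
theorem isotropic_of_forall_root [Nontrivial C] (hA : IsCSA F A)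
    (hT : IsReducedTrace F A T) (hqp : IsQuadraticPair F A T σ ℓ) (hdeg : 3 ≤ deg F A)
    (φ : CliffordAlg F A T σ ℓ →ₐ[F] C) (hsp : SplitRep F A)
    (hroot : ∀ c : F, ∃ x : F, x * x - x + c = 0) : QPIsotropic F A T σ ℓ := by
  obtain ⟨V, _, _, _, hV, ⟨τ⟩⟩ := hsp
  have : Nontrivial V := Module.nontrivial_of_finrank_pos (R := F) (by omega)
  have hℓ := hqp.2.2.2
  obtain ⟨b, h⟩ := exists_QS_one hA hT hqp hV τ φ
  obtain ⟨e, f, hef, he, hf⟩ := exists_pair (h.nondeg hℓ) (hV ▸ hdeg)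
  obtain ⟨x, hx⟩ := hroot (beta τ b ℓ e e * beta τ b ℓ f f)
  obtain ⟨q, hq⟩ : ∃ q, q = beta τ b ℓ e e := ⟨_, rfl⟩
  obtain ⟨u, hu⟩ : ∃ u, u = f + (-x / q) • e := ⟨_, rfl⟩
  have hu0 : u ≠ 0 := by
    intro h0
    apply hf (x / q)
    have h1 : f + (-x / q) • e = 0 := by rw [← hu, h0]
    rw [eq_neg_of_add_eq_zero_left h1, neg_div, neg_smul, neg_neg]
  have hqu : beta τ b ℓ u u = 0 := by
    rw [pol_apply] at hef
    rw [← hq] at hx he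
    rw [hu]
    simp only [map_add, map_smul, LinearMap.add_apply, LinearMap.smul_apply, smul_eq_mul, ← hq]
    have h4 : beta τ b ℓ f f = (x - x * x) / q := by
      rw [eq_div_iff he]; linear_combination hx
    rw [h4]
    field_simp
    linear_combination -x * hef
  obtain ⟨v, hv⟩ : ∃ v, b v u ≠ 0 := by
    by_contra! H
    exact hu0 (h.nd _ fun w => by rw [h.symm, H])
  obtain ⟨ι, k, s, a, -, ha⟩ := h.spans.exists_sum (psi b u v)
  have hx : τ (∑ i ∈ s, k i • a i) = psi b u v := by
    rw [ha]; simp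
  refine h.isotropic hℓ (W := Submodule.span F {u}) (x := ∑ i ∈ s, k i • a i) ?_ ?_ ?_
  · intro w hw
    obtain ⟨y, rfl⟩ := Submodule.mem_span_singleton.1 hw
    simp [hqu]
  · intro w
    rw [hx, psi_apply]
    exact Submodule.smul_mem _ _ (Submodule.mem_span_singleton_self u)
  · intro h0
    rw [h0, map_zero] at hx
    have := LinearMap.congr_fun hx u
    rw [psi_apply] at this
    exact (smul_ne_zero hv hu0) this.symm

end Assembly

section Generation

variable {F K A S : Type} [Field F] [Field K] [Algebra F K] [Ring A] [Algebra F A]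
  {T : A →ₗ[F] F} {σ : A →ₗ[F] A} {ℓ : A} [AddCommGroup S] [Module K S] [Module F S]
  [IsScalarTower F K S]

theorem cliff_commute (ρ : CliffordAlg F A T σ ℓ →ₐ[F] Module.End K S) (Φ : S →ₗ[F] S)
    (h : ∀ a s, Φ (ρ (genL T σ ℓ a) s) = ρ (genL T σ ℓ a) (Φ s)) (x : CliffordAlg F A T σ ℓ)
    (s : S) : Φ (ρ x s) = ρ x (Φ s) := by
  obtain ⟨t, rfl⟩ := RingQuot.mkAlgHom_surjective F (CliffordRel F A T σ ℓ) x
  change Φ ((ρ.comp (RingQuot.mkAlgHom F (CliffordRel F A T σ ℓ))) t s) =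
    (ρ.comp (RingQuot.mkAlgHom F (CliffordRel F A T σ ℓ))) t (Φ s)
  induction t using TensorAlgebra.induction generalizing s with
  | algebraMap r => rw [AlgHom.commutes]; exact map_smul Φ r s
  | ι a => exact h a s
  | mul x y hx hy => simp only [map_mul, Module.End.mul_apply, hx, hy]
  | add x y hx hy => simp only [map_add, LinearMap.add_apply, hx, hy]

/-- Restriction of scalars for endomorphisms. -/
def endRestrict (F K S : Type) [Field F] [Field K] [Algebra F K] [AddCommGroup S] [Module K S]
    [Module F S] [IsScalarTower F K S] : Module.End K S →ₐ[F] Module.End F S where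
  toFun f := f.restrictScalars F
  map_one' := rfl
  map_mul' _ _ := rfl
  map_zero' := rfl
  map_add' _ _ := rfl
  commutes' _ := rfl

theorem endRestrict_apply (f : Module.End K S) (s : S) : endRestrict F K S f s = f s := rfl

end Generation

section Twist

variable {K V S : Type} [Field K] [AddCommGroup V] [Module K V] [AddCommGroup S] [Module K S]
  {β : V →ₗ[K] V →ₗ[K] K} {m : V →ₗ[K] V →ₗ[K] Module.End K S}

/-- Conjugation of an even Clifford map by an anisotropic vector. -/
noncomputable def twist (β : V →ₗ[K] V →ₗ[K] K) (m : V →ₗ[K] V →ₗ[K] Module.End K S) (v0 : V) :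
    V →ₗ[K] V →ₗ[K] Module.End K S :=
  (β v0 v0)⁻¹ • (LinearMap.mul K (Module.End K S)).compl₁₂ (m v0) (m.flip v0)

theorem twist_apply (v0 v w : V) (s : S) :
    twist β m v0 v w s = (β v0 v0)⁻¹ • m v0 v (m w v0 s) := rfl

theorem IsECM.apply_apply (hm : IsECM β m) (u v w : V) (s : S) :
    m u v (m v w s) = β v v • m u w s := LinearMap.congr_fun (hm.2 u v w) s

theorem IsECM.twist (hm : IsECM β m) {v0 : V} (h0 : β v0 v0 ≠ 0) : IsECM β (twist β m v0) := by
  refine ⟨fun v => ?_, fun u v w => ?_⟩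
  · ext s
    rw [twist_apply, hm.apply_apply, hm.1, LinearMap.smul_apply, LinearMap.smul_apply,
      Module.End.one_apply, smul_comm, inv_smul_smul₀ h0]
  · ext s
    rw [Module.End.mul_apply, twist_apply, twist_apply, LinearMap.smul_apply, twist_apply]
    simp only [map_smul]
    rw [hm.apply_apply v v0, map_smul, inv_smul_smul₀ h0, hm.1, LinearMap.smul_apply,
      Module.End.one_apply, map_smul, smul_comm]

variable {F : Type} [Field F] [Algebra F K] [Module F V] [Module F S] [IsScalarTower F K S]
  [IsScalarTower F K V] {c b0 : F} (E : QExt F K c) {J : V →ₗ[F] V} {Φ : S →ₗ[F] S} {κ : K}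

/-- The conjugate-linear map compatible with the twisted even Clifford map. -/
noncomputable def twistJ (β : V →ₗ[K] V →ₗ[K] K) (m : V →ₗ[K] V →ₗ[K] Module.End K S) (v0 : V)
    (E : QExt F K c) (J : V →ₗ[F] V) (Φ : S →ₗ[F] S) : S →ₗ[F] S :=
  ((E.conj (β v0 v0))⁻¹ • m v0 (J v0)).restrictScalars F ∘ₗ Φ

omit [IsScalarTower F K V] in
theorem twistJ_apply (v0 : V) (s : S) : twistJ β m v0 E J Φ s =
    (E.conj (β v0 v0))⁻¹ • m v0 (J v0) (Φ s) := rfl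

omit [IsScalarTower F K V] in
theorem twistJ_smul (hΦ : ∀ (k : K) s, Φ (k • s) = E.conj k • Φ s) (v0 : V) (k : K) (s : S) :
    twistJ β m v0 E J Φ (k • s) = E.conj k • twistJ β m v0 E J Φ s := by
  rw [twistJ_apply, twistJ_apply, hΦ, map_smul, smul_comm]

theorem twistJ_twistJ (hm : IsECM β m) {v0 : V} (h0 : β v0 v0 ≠ 0)
    (hΦ : ∀ (k : K) s, Φ (k • s) = E.conj k • Φ s) (hΦΦ : ∀ s, Φ (Φ s) = s) (hκ : κ ≠ 0)
    (hΦm : ∀ v w s, Φ (m v w s) = κ⁻¹ • m (J v) (J w) (Φ s)) (hJJ : ∀ v, J (J v) = b0 • v)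
    (hβ : ∀ v w, β (J v) (J w) = κ * E.conj (β v w)) (s : S) :
    twistJ β m v0 E J Φ (twistJ β m v0 E J Φ s) = b0 • s := by
  have h0' : E.conj (β v0 v0) ≠ 0 := by simpa using h0
  rw [twistJ_apply, twistJ_apply, hΦ, hΦm, hΦΦ, hJJ, ← algebraMap_smul K b0, map_smul (m (J v0)),
    LinearMap.smul_apply, map_inv₀, E.conj_conj, map_smul, map_smul, map_smul, hm.apply_apply,
    hm.1, hβ, LinearMap.smul_apply, Module.End.one_apply, ← algebraMap_smul K b0]
  simp only [smul_smul]
  congr 1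
  field_simp

omit [IsScalarTower F K V] in
theorem twistJ_twist (hm : IsECM β m) {v0 : V} (h0 : β v0 v0 ≠ 0)
    (hΦ : ∀ (k : K) s, Φ (k • s) = E.conj k • Φ s) (hκ : κ ≠ 0)
    (hΦm : ∀ v w s, Φ (m v w s) = κ⁻¹ • m (J v) (J w) (Φ s))
    (hβ : ∀ v w, β (J v) (J w) = κ * E.conj (β v w)) (v w : V) (s : S) :
    twistJ β m v0 E J Φ (twist β m v0 v w s) =
      κ⁻¹ • twist β m v0 (J v) (J w) (twistJ β m v0 E J Φ s) := by
  have h0' : E.conj (β v0 v0) ≠ 0 := by simpa using h0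
  rw [twistJ_apply, twistJ_apply, twist_apply, twist_apply, hΦ, hΦm, hΦm]
  simp only [map_smul]
  rw [hm.apply_apply v0 (J v0), hm.apply_apply (J w) v0, hβ, map_smul, map_inv₀]
  simp only [smul_smul]
  congr 1
  field_simp

end Twist

section Relation

variable {F A C : Type} [Field F] [Ring A] [Algebra F A] [Ring C] [Algebra F C]
  {T : A →ₗ[F] F} {σ : A →ₗ[F] A} {ℓ : A}

/-- The tensor product of the underlying division algebras of `A` and of a component of the
Clifford algebra acts on a small module of the Clifford algebra. -/
theorem exists_commuting_actions {c1 b1 c2 b2 : F} (hA : IsCSA F A) (hT : IsReducedTrace F A T)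
    (hqp : IsQuadraticPair F A T σ ℓ) (h1 : 0 < deg F A) (h2 : 0 < deg F C)
    (φ : CliffordAlg F A T σ ℓ →ₐ[F] C) (hqA : QuatRep F A c1 b1) (hqC : QuatRep F C c2 b2) :
    ∃ (R : Type) (_ : AddCommGroup R) (_ : Module F R) (_ : Module.Finite F R)
      (ρ : CliffordAlg F A T σ ℓ →ₐ[F] Module.End F R)
      (g1 : QuaternionAlgebra F (-c1) 1 b1 →ₐ[F] Module.End F R)
      (g2 : QuaternionAlgebra F (-c2) 1 b2 →ₐ[F] Module.End F R),
      finrank F R = 4 * deg F C ∧ (∀ x y, Commute (g1 x) (g2 y)) ∧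
        (∀ x y, Commute (g1 x) (ρ y)) ∧ ∀ x y, Commute (g2 x) (ρ y) := by
  obtain ⟨K, _, _, ⟨E⟩⟩ := exists_qext c1 (hqA.1.rootless i_not_scalar i_sq)
  have hb1 := hqA.1.ne_zero
  obtain ⟨V, _, _, _, _, _, τ, J, hV, hJJ, hJ, hJA⟩ := hqA.kRep_self E
  obtain ⟨-, S, _, _, _, ρS, g, hS, hc⟩ := hqC
  have : Nontrivial V := Module.nontrivial_of_finrank_pos (R := K) (by omega)
  have : Nontrivial S := Module.nontrivial_of_finrank_pos (R := F) (by omega)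
  have hℓ := hqp.2.2.2
  let ρ : CliffordAlg F A T σ ℓ →ₐ[F] Module.End K (K ⊗[F] S) :=
    (Module.End.baseChangeHom F K S).comp (ρS.comp φ)
  obtain ⟨b, h⟩ := exists_QS_one hA hT hqp hV τ (ρS.comp φ)
  have hJs : Function.Surjective J := fun v => ⟨b1⁻¹ • J v, by
    rw [map_smul, hJJ, smul_smul, inv_mul_cancel₀ hb1, one_smul]⟩
  obtain ⟨κ, hκ, hb⟩ := h.exists_multiplier E hJs hJ hJA
  have hβ := fun v w => QS.beta_semilinear (ℓ := ℓ) E hJA hb v w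
  obtain ⟨v0, h0⟩ := (h.nondeg hℓ).exists_anisotropic
  have hm := h.fwd_isECM hA ρ
  have hΦ := E.J_smul (V := S)
  have hΦρ : ∀ x s, E.J S (ρ x s) = ρ x (E.J S s) := by
    intro x s
    induction s with
    | zero => simp
    | add s s' hs hs' => simp only [map_add, hs, hs']
    | tmul k s => rfl
  have hΦm := h.fwd_semilinear ρ E.conj (E.J S) hΦ hΦρ J hJs hJ hJA κ hκ hb
  obtain ⟨e, e', he⟩ := exists_dualBases h.nd h.symm
  obtain ⟨ρ', hρ'⟩ := h.exists_back hqp.1 he (hm.twist h0)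
  let Ψ := twistJ (beta τ b ℓ) (h.fwd ρ) v0 E J (E.J S)
  have hΨ := twistJ_smul (β := beta τ b ℓ) (m := h.fwd ρ) (J := J) E hΦ v0
  have hΨρ := cliff_commute ρ' Ψ fun a s => by
    rw [hρ']
    exact he.psiLift_semilinear h.symm E.conj Ψ J hJs hJ κ hκ hb
      (twistJ_twist E hm h0 hΦ hκ hΦm hβ) (τ a) (hJA a) s
  let G := (Module.End.baseChangeHom F K S).comp g
  have hGρ : ∀ y x s, G y (ρ x s) = ρ x (G y s) := by
    intro y x s
    induction s with
    | zero => simp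
    | add s s' hs hs' => simp only [map_add, hs, hs']
    | tmul k s => exact congrArg (k ⊗ₜ[F] ·) (LinearMap.congr_fun (hc (φ x) y) s).symm
  have hGm : ∀ y v w s, G y (h.fwd ρ v w s) = h.fwd ρ v w (G y s) := fun y =>
    h.fwd_comm ρ (endRestrict F K _ (G y)) (fun k s => map_smul (G y) k s) (fun x s => hGρ y x s)
  have hGΨ : ∀ y s, Ψ (G y s) = G y (Ψ s) := by
    intro y s
    have : E.J S (G y s) = G y (E.J S s) := by
      induction s with
      | zero => simp
      | add s s' hs hs' => simp only [map_add, hs, hs']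
      | tmul k s => rfl
    simp only [Ψ, twistJ_apply, this, map_smul, hGm]
  have hGρ' : ∀ y x s, G y (ρ' x s) = ρ' x (G y s) := fun y =>
    cliff_commute ρ' (endRestrict F K _ (G y)) fun a s => by
      rw [hρ']
      simp only [endRestrict_apply, psiLift_apply, LinearMap.sum_apply, map_sum, twist_apply,
        map_smul, hGm]
  let q : QuaternionAlgebra.Basis (Module.End F (K ⊗[F] S)) (-c1) 1 b1 :=
    { i := Algebra.lsmul F F (K ⊗[F] S) E.ω, j := Ψ
      k := Algebra.lsmul F F (K ⊗[F] S) E.ω * Ψ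
      i_mul_i := by
        rw [← map_mul, E.sq, map_sub, AlgHom.commutes, Algebra.algebraMap_eq_smul_one]
        module
      j_mul_j := by
        apply LinearMap.ext
        intro s
        exact twistJ_twistJ E hm h0 hΦ E.J_J hκ hΦm hJJ hβ s
      i_mul_j := rfl
      j_mul_i := by
        apply LinearMap.ext
        intro s
        rw [one_smul]
        change Ψ (E.ω • s) = Ψ s - E.ω • Ψ s
        rw [hΨ, E.conj_ω, sub_smul, one_smul] }
  have hq : ∀ x s, q.liftHom x s = x.re • s + x.imI • E.ω • s + x.imJ • Ψ s
      + x.imK • E.ω • Ψ s := fun x s => by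
    simp [QuaternionAlgebra.Basis.lift, q, Algebra.algebraMap_eq_smul_one]
  have hfin := E.finite
  refine ⟨K ⊗[F] S, inferInstance, inferInstance, inferInstance, (endRestrict F K _).comp ρ',
    q.liftHom, (endRestrict F K _).comp G, ?_, fun x y => ?_, fun x y => ?_, fun x y => ?_⟩
  · rw [Module.finrank_tensorProduct, E.finrank_eq, hS]
    ring
  · apply LinearMap.ext
    intro s
    change q.liftHom x (G y s) = G y (q.liftHom x s)
    simp only [hq, map_add, map_smul, hGΨ, LinearMap.map_smul_of_tower]
  · apply LinearMap.ext
    intro s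
    change q.liftHom x (ρ' y s) = ρ' y (q.liftHom x s)
    simp only [hq, map_add, map_smul, hΨρ, LinearMap.map_smul_of_tower]
  · apply LinearMap.ext
    intro s
    exact hGρ' x y s

end Relation

section Common

variable {F C : Type} [Field F] [Ring C] [Algebra F C] {c1 b1 c2 b2 : F}

/-- Restriction of a representation commuting with that of `C` to a submodule. -/
theorem exists_restrict_centralizer {Q S : Type} [Ring Q] [Algebra F Q] [AddCommGroup S]
    [Module F S] {X : Submodule F S} (ψ : C →ₐ[F] Module.End F X) (ρ : C → Module.End F S)
    (hψ : ∀ x s, (ψ x s : S) = ρ x s) (g : Q →ₐ[F] Module.End F S)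
    (hg : ∀ y x, Commute (g y) (ρ x)) (hX : ∀ y, ∀ s ∈ X, g y s ∈ X) :
    ∃ g' : Q →ₐ[F] Subalgebra.centralizer F (Set.range ψ),
      ∀ y s, ((g' y).1 s : S) = g y s := by
  let r : Q →ₐ[F] Module.End F X := restrictRep (g : Q →ₙₐ[F] Module.End F S) X hX
    (fun x _ => LinearMap.congr_fun (map_one g) x)
  have hr : ∀ y s, (r y s : S) = g y s := fun _ _ => rfl
  refine ⟨r.codRestrict _ fun y => ?_, fun y s => rfl⟩
  rw [Subalgebra.mem_centralizer_iff]
  rintro _ ⟨x, rfl⟩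
  ext s
  simp only [Module.End.mul_apply, hψ, hr]
  exact (LinearMap.congr_fun (hg y x) s).symm

theorem exists_common_of_component {S : Type} [AddCommGroup S] [Module F S] [Module.Finite F S]
    (hC : IsCSA F C) (hi : schurIndex F C ≤ 2) (hd0 : 0 < deg F C) (H1 : Aniso c1 b1)
    (H2 : Aniso c2 b2) (P : Module.End F S) [Nontrivial (LinearMap.range P)]
    (ψ : C →ₐ[F] Module.End F (LinearMap.range P)) (ρ : C → Module.End F S)
    (hψ : ∀ x s, (ψ x s : S) = ρ x s) (hd : finrank F S ≤ 4 * deg F C)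
    (g1 : QuaternionAlgebra F (-c1) 1 b1 →ₐ[F] Module.End F S)
    (g2 : QuaternionAlgebra F (-c2) 1 b2 →ₐ[F] Module.End F S)
    (h12 : ∀ x y, Commute (g1 x) (g2 y)) (h1 : ∀ y x, Commute (g1 y) (ρ x))
    (h2 : ∀ y x, Commute (g2 y) (ρ x)) (h1P : ∀ y, Commute (g1 y) P)
    (h2P : ∀ y, Commute (g2 y) P) :
    ∃ (c : F) (z1 : QuaternionAlgebra F (-c1) 1 b1) (z2 : QuaternionAlgebra F (-c2) 1 b2),
      (∀ a : F, z1 ≠ a • 1) ∧ (∀ a : F, z2 ≠ a • 1) ∧ z1 * z1 = z1 - c • 1 ∧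
        z2 * z2 = z2 - c • 1 := by
  have hX : ∀ f : Module.End F S, Commute f P → ∀ s ∈ LinearMap.range P,
      f s ∈ LinearMap.range P := by
    rintro f hf _ ⟨y, rfl⟩
    exact ⟨f y, (LinearMap.congr_fun hf y).symm⟩
  obtain ⟨k1, hk1⟩ := exists_restrict_centralizer ψ ρ hψ g1 h1 fun y => hX _ (h1P y)
  obtain ⟨k2, hk2⟩ := exists_restrict_centralizer ψ ρ hψ g2 h2 fun y => hX _ (h2P y)
  have hk : ∀ x y, Commute (k1 x) (k2 y) := by
    intro x y
    apply Subtype.ext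
    ext s
    change ((k1 x).1 ((k2 y).1 s) : S) = (k2 y).1 ((k1 x).1 s)
    rw [hk1, hk2, hk2, hk1]
    exact LinearMap.congr_fun (h12 x y) s
  obtain ⟨D, _, _, k, l, e, hk0, _, _, hD⟩ := hC.exists_division hi
  obtain ⟨δ, hδ, hδ2⟩ : ∃ δ, finrank F D = δ * δ ∧ δ ≤ 2 := by
    rcases hD with h | h
    · exact ⟨1, h, by norm_num⟩
    · exact ⟨2, h, le_rfl⟩
  have hkl := morita_deg hC hδ e
  have hl : 0 < l := Nat.pos_of_mul_pos_right (hkl ▸ Nat.mul_pos hk0 hd0)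
  obtain ⟨R, _, _, _, -, Θ, -, hR⟩ := morita hl e.symm ψ
  have hX0 : 0 < finrank F (LinearMap.range P) := Module.finrank_pos
  have hX1 : finrank F (LinearMap.range P) ≤ finrank F S := Submodule.finrank_le _
  have hR0 : 0 < finrank F R := Nat.pos_of_mul_pos_left (hR ▸ Nat.mul_pos hk0 hX0)
  have : Nontrivial R := Module.nontrivial_of_finrank_pos hR0
  refine exists_common_subfield H1 H2 (Θ.comp k1) (Θ.comp k2) (fun x y => (hk x y).map Θ) ?_
  refine Nat.le_of_mul_le_mul_left ?_ hl
  calc l * finrank F R = k * finrank F (LinearMap.range P) := hR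
    _ ≤ k * (4 * deg F C) := Nat.mul_le_mul_left _ (hX1.trans hd)
    _ = 4 * (l * δ) := by rw [← hkl]; ring
    _ ≤ l * 8 := by nlinarith

end Common

section Main

variable {F A C C' : Type} [Field F] [Ring A] [Algebra F A] [Ring C] [Algebra F C] [Ring C']
  [Algebra F C'] {T : A →ₗ[F] F} {σ : A →ₗ[F] A} {ℓ : A}

theorem isotropic_of_small_component (h3 : I3Trivial F) (hA : IsCSA F A)
    (hT : IsReducedTrace F A T) (hqp : IsQuadraticPair F A T σ ℓ) {m : ℕ} (hm : 3 ≤ m)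
    (hdeg : deg F A = 2 * m) (hindA : schurIndex F A ≤ 2) (hC : IsCSA F C) (hC' : IsCSA F C')
    (φ : CliffordAlg F A T σ ℓ ≃ₐ[F] C × C') (hi : schurIndex F C ≤ 2)
    (hi' : schurIndex F C' ≤ 2) (hd0 : 0 < deg F C) (hdd : deg F C ≤ deg F C')
    (hd : deg F C ≤ 2 ^ (m - 1)) : QPIsotropic F A T σ ℓ := by
  have hF := repAll_of_I3Trivial h3
  let φ1 : CliffordAlg F A T σ ℓ →ₐ[F] C := (AlgHom.fst F C C').comp φ.toAlgHom
  have key : ∀ {c : F}, (∀ x, x * x - x + c ≠ 0) → (∀ (K : Type) (_ : Field K) (_ : Algebra F K)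
      (E : QExt F K c), (∃ β, β ≠ 0 ∧ KRep E A (deg F A) β) ∧ ∃ β, KRep E C (deg F C) β) →
      QPIsotropic F A T σ ℓ := by
    intro c hc h
    obtain ⟨K, _, _, ⟨E⟩⟩ := exists_qext c hc
    obtain ⟨⟨β, hβ, hKA⟩, β', hKC⟩ := h K _ _ E
    exact isotropic_of_kRep hF E hA hT hqp hm hdeg hd0 hd φ1 hβ hKA hKC
  rcases hA.rep hindA with sA | ⟨c1, b1, qA⟩ <;> rcases hC.rep hi with sC | ⟨c2, b2, qC⟩
  · by_cases hroot : ∀ c : F, ∃ x : F, x * x - x + c = 0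
    · have := hC.2.1
      exact isotropic_of_forall_root hA hT hqp (by omega) φ1 sA hroot
    · push Not at hroot
      obtain ⟨c, hc⟩ := hroot
      exact key hc fun K _ _ E => ⟨⟨1, one_ne_zero, sA.kRep E⟩, 1, sC.kRep E⟩
  · exact key (qC.1.rootless i_not_scalar i_sq) fun K _ _ E =>
      ⟨⟨1, one_ne_zero, sA.kRep E⟩, b2, qC.kRep_self E⟩
  · exact key (qA.1.rootless i_not_scalar i_sq) fun K _ _ E =>
      ⟨⟨b1, qA.1.ne_zero, qA.kRep_self E⟩, 1, sC.kRep E⟩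
  · obtain ⟨R, _, _, _, ρ, g1, g2, hR, h12, h1, h2⟩ :=
      exists_commuting_actions hA hT hqp (by omega) hd0 φ1 qA qC
    have : Nontrivial R := Module.nontrivial_of_finrank_pos (R := F) (by omega)
    obtain ⟨c, z1, z2, hz1, hz2, hzz1, hzz2⟩ : ∃ (c : F)
        (z1 : QuaternionAlgebra F (-c1) 1 b1) (z2 : QuaternionAlgebra F (-c2) 1 b2),
        (∀ a : F, z1 ≠ a • 1) ∧ (∀ a : F, z2 ≠ a • 1) ∧ z1 * z1 = z1 - c • 1 ∧
          z2 * z2 = z2 - c • 1 := by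
      rcases exists_component (ρ.comp φ.symm.toAlgHom) with ⟨_, ψ, hψ⟩ | ⟨_, ψ, hψ⟩
      · exact exists_common_of_component hC hi hd0 qA.1 qC.1 _ ψ _ hψ hR.le g1 g2 h12
          (fun y x => h1 y _) (fun y x => h2 y _) (fun y => h1 y _) (fun y => h2 y _)
      · exact exists_common_of_component hC' hi' (by omega) qA.1 qC.1 _ ψ _ hψ (by omega) g1 g2 h12
          (fun y x => h1 y _) (fun y x => h2 y _) (fun y => h1 y _) (fun y => h2 y _)
    refine key (qA.1.rootless hz1 hzz1) fun K _ _ E => ⟨qA.kRep E hz1 hzz1, ?_⟩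
    obtain ⟨β, -, h⟩ := qC.kRep E hz2 hzz2
    exact ⟨β, h⟩

end Main

theorem IsCSA.deg_pos {F A : Type} [Field F] [Ring A] [Algebra F A] (hA : IsCSA F A) :
    0 < deg F A := by
  have := hA.2.1
  have := hA.2.2
  have h : 0 < finrank F A := Module.finrank_pos
  exact Nat.sqrt_pos.2 h

theorem IsCSA.deg_le {F A : Type} [Field F] [Ring A] [Algebra F A] (hA : IsCSA F A) {k : ℕ}
    (h : finrank F A ≤ 4 ^ k) : deg F A ≤ 2 ^ k := by
  rw [hA.finrank_eq, show 4 = 2 * 2 from rfl, mul_pow] at h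
  exact Nat.mul_self_le_mul_self_iff.1 h

/-- Proposition 4.2 (1) of the paper.  Assume `I_q³F = 0`.  Let
`(A, σ, f)` be an `F`-algebra with quadratic pair such that `deg A` is divisible by 4,
`deg A > 4`, `ind A ≤ 2` and `disc(σ, f)` is trivial (the Clifford algebra decomposes
as a product of two central simple algebras `C⁺ × C⁻`).  If both components `C⁺`, `C⁻`
have Schur index at most 2, then `(A, σ, f)` is isotropic. -/
theorem qp_isotropic_of_index_le_two (F : Type) [Field F] (h3 : I3Trivial F)
    (A : Type) [Ring A] [Algebra F A] (hA : IsCSA F A)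
    (T : A →ₗ[F] F) (hT : IsReducedTrace F A T)
    (σ : A →ₗ[F] A) (ℓ : A) (hqp : IsQuadraticPair F A T σ ℓ)
    (hdvd : 4 ∣ deg F A) (hgt : 4 < deg F A)
    (hindA : schurIndex F A ≤ 2)
    (Cp Cm : Type) [Ring Cp] [Algebra F Cp] [Ring Cm] [Algebra F Cm]
    (hCp : IsCSA F Cp) (hCm : IsCSA F Cm)
    (hdisc : Nonempty (CliffordAlg F A T σ ℓ ≃ₐ[F] Cp × Cm))
    (hip : schurIndex F Cp ≤ 2) (him : schurIndex F Cm ≤ 2) :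
    QPIsotropic F A T σ ℓ := by
  obtain ⟨φ⟩ := hdisc
  obtain ⟨m, hm⟩ : ∃ m, deg F A = 2 * m := (Dvd.dvd.trans (by norm_num) hdvd : 2 ∣ deg F A)
  have hmin : deg F Cp ≤ 2 ^ (m - 1) ∨ deg F Cm ≤ 2 ^ (m - 1) :=
    (exists_small_component hA hT hqp hCp hCm φ (by omega) hm).imp hCp.deg_le hCm.deg_le
  rcases le_total (deg F Cp) (deg F Cm) with h | h
  · exact isotropic_of_small_component h3 hA hT hqp (by omega) hm hindA hCp hCm φ hip him
      hCp.deg_pos h (hmin.elim id h.trans)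
  · exact isotropic_of_small_component h3 hA hT hqp (by omega) hm hindA hCm hCp
      (φ.trans (AlgEquiv.ofAlgHom ((AlgHom.snd F Cp Cm).prod (AlgHom.fst F Cp Cm))
        ((AlgHom.snd F Cm Cp).prod (AlgHom.fst F Cm Cp)) rfl rfl)) him hip hCm.deg_pos h (hmin.elim h.trans id)

end Triality
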